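/- arXiv:1509.02577 — 2 statements merged into one kernel-verified Lean document; each statement's English description precedes it below -/
import Mathlib

section
/- Whenever constants satisfy the hierarchy 0 < 1/n ≪ η ≪ ε, γ ≪ 1, the following holds: let H be a 3-graph on n vertices such that |Ñ_{1,γε}(v)| ≥ (1/4 − 3γ)n for every v ∈ V(H). Then there is a partition 𝒫 = {V₁,...,V_d} of V(H) with d ≤ 4 such that each Vᵢ is (16, η)-closed in H and |Vᵢ| ≥ (1/4 − 4γ)n. -/
open Finset

/-- `H` is the edge set of a 3-uniform hypergraph (3-graph) on `Fin n`. -/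
def Is3Graph (n : ℕ) (H : Finset (Finset (Fin n))) : Prop :=
  ∀ e ∈ H, e.card = 3

/-- `degOn H x y U` : number of `z ∈ U` with `{x,y,z} ∈ H`, i.e. `deg_H(xy, U)`. -/
def degOn {n : ℕ} (H : Finset (Finset (Fin n))) (x y : Fin n) (U : Finset (Fin n)) : ℕ :=
  (U.filter fun z => ({x, y, z} : Finset (Fin n)) ∈ H).card

/-- The minimum codegree `δ₂(H)` is at least `t`. -/
def CodegLB {n : ℕ} (H : Finset (Finset (Fin n))) (t : ℝ) : Prop :=
  ∀ x y : Fin n, x ≠ y → t ≤ (degOn H x y Finset.univ : ℝ)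

/-- `S` spans a copy of `K₄⁻` in `H`: it has 4 vertices and at least 3 of its
four 3-subsets are edges. -/
def SpansK4m {n : ℕ} (H : Finset (Finset (Fin n))) (S : Finset (Fin n)) : Prop :=
  S.card = 4 ∧ 3 ≤ ((S.powersetCard 3).filter (· ∈ H)).card

/-- `S` spans a copy of `K₄³` (the complete 3-graph on 4 vertices) in `H`. -/
def SpansK43 {n : ℕ} (H : Finset (Finset (Fin n))) (S : Finset (Fin n)) : Prop :=
  S.card = 4 ∧ ((S.powersetCard 3).filter (· ∈ H)).card = 4

/-- The induced subgraph `H[X]` contains a `K₄⁻`-factor. -/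
def HasK4mFactorOn {n : ℕ} (H : Finset (Finset (Fin n))) (X : Finset (Fin n)) : Prop :=
  ∃ P : Finset (Finset (Fin n)),
    (∀ S ∈ P, SpansK4m H S) ∧
    (∀ S ∈ P, ∀ T ∈ P, S ≠ T → Disjoint S T) ∧
    P.biUnion id = X

/-- `S` is an `(x,y)`-connector of length `c` in `H`. -/
def IsConnector {n : ℕ} (H : Finset (Finset (Fin n))) (c : ℕ) (x y : Fin n)
    (S : Finset (Fin n)) : Prop :=
  x ∉ S ∧ y ∉ S ∧ S.card = 4 * c - 1 ∧
    HasK4mFactorOn H (insert x S) ∧ HasK4mFactorOn H (insert y S)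

/-- `x` and `y` are `(c,η)`-close in `H` (a 3-graph on `n` vertices). -/
def Close {n : ℕ} (H : Finset (Finset (Fin n))) (c : ℕ) (η : ℝ) (x y : Fin n) : Prop :=
  η * (n : ℝ) ^ (4 * c - 1) ≤ ({S : Finset (Fin n) | IsConnector H c x y S}.ncard : ℝ)

/-- `U` is `(c,η)`-closed in `H`. -/
def ClosedOn {n : ℕ} (H : Finset (Finset (Fin n))) (c : ℕ) (η : ℝ)
    (U : Finset (Fin n)) : Prop :=
  ∀ x ∈ U, ∀ y ∈ U, x ≠ y → Close H c η x y

/-- The number of `(X,Y)`-bridges `(x,y,S)` of length `c` in `H`. -/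
noncomputable def BridgeCount {n : ℕ} (H : Finset (Finset (Fin n))) (c : ℕ)
    (X Y : Finset (Fin n)) : ℕ :=
  {t : Fin n × Fin n × Finset (Fin n) |
    t.1 ∈ X ∧ t.2.1 ∈ Y ∧ IsConnector H c t.1 t.2.1 t.2.2}.ncard

/-- The 3-graph `𝓑[A,B]`: all triples in `A ∪ B` containing an odd number of
vertices of `A`. -/
def BGraph {n : ℕ} (A B : Finset (Fin n)) : Finset (Finset (Fin n)) :=
  ((A ∪ B).powersetCard 3).filter fun e => (e ∩ A).card % 2 = 1

/-- `H` (a 3-graph on `n` vertices) is `γ`-extremal. -/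
def IsExtremal {n : ℕ} (H : Finset (Finset (Fin n))) (γ : ℝ) : Prop :=
  ∃ A B : Finset (Fin n), Disjoint A B ∧ A ∪ B = Finset.univ ∧
    A.card = n / 2 ∧ B.card = n - n / 2 ∧
    ((BGraph A B \ H).card : ℝ) ≤ γ * (n : ℝ) ^ 3

/-- The number of `V₁V₂V₃`-edges of `H`. -/
def eCount {n : ℕ} (H : Finset (Finset (Fin n))) (A B C : Finset (Fin n)) : ℕ :=
  (H.filter fun e => ∃ a ∈ A, ∃ b ∈ B, ∃ c ∈ C, e = {a, b, c}).card

/-- `Ñ_{c,η}(x)` : the set of vertices `(c,η)`-close to `x` in `H`. -/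
def Ntilde {n : ℕ} (H : Finset (Finset (Fin n))) (c : ℕ) (η : ℝ) (x : Fin n) :
    Set (Fin n) :=
  {y | y ≠ x ∧ Close H c η x y}

/-- The triple `{x,x',y}` is `(ρ,X,Y)`-typical. -/
def TypicalTriple {n : ℕ} (H : Finset (Finset (Fin n))) (ρ : ℝ) (X Y : Finset (Fin n))
    (x x' y : Fin n) : Prop :=
  (Y.card : ℝ) - ρ * n ≤ (degOn H x x' Y : ℝ) ∧
  (((X.filter fun z => ({x, y, z} : Finset (Fin n)) ∈ H ∧
      ({x', y, z} : Finset (Fin n)) ∈ H).card : ℝ) ≤ ρ * n) ∧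
  (X.card : ℝ) - ρ * n ≤ (degOn H x y X : ℝ) + (degOn H x' y X : ℝ)

/-- `Q` spans an `(X,Y)`-bridge of length 1, i.e. `Q = {a,b} ∪ S` for some
`(X,Y)`-bridge `(a,b,S)` of length 1. -/
def SpansBridge1 {n : ℕ} (H : Finset (Finset (Fin n))) (X Y Q : Finset (Fin n)) : Prop :=
  ∃ a ∈ X, ∃ b ∈ Y, ∃ S : Finset (Fin n), IsConnector H 1 a b S ∧
    Q = insert a (insert b S)

open Classical in
lemma aux_contain {n : ℕ} (m : ℕ) (t : Fin n) (F : Finset (Finset (Fin n)))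
    (hF : ∀ S ∈ F, S.card = m + 1) : (F.filter (fun S => t ∈ S)).card ≤ n ^ m := by
  calc (F.filter (fun S => t ∈ S)).card
      ≤ ((Finset.univ : Finset (Fin n)).powersetCard m).card := by
        apply Finset.card_le_card_of_injOn (fun S => S.erase t)
        · intro S hS
          rw [Finset.mem_coe, Finset.mem_filter] at hS
          rw [Finset.mem_coe, Finset.mem_powersetCard]
          refine ⟨Finset.subset_univ _, ?_⟩
          rw [Finset.card_erase_of_mem hS.2, hF S hS.1]; rfl
        · intro S hS S' hS' h
          rw [Finset.mem_coe, Finset.mem_filter] at hS hS'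
          have h1 := Finset.insert_erase hS.2
          have h2 := Finset.insert_erase hS'.2
          simp only at h
          rw [← h1, ← h2, h]
    _ = n.choose m := by rw [Finset.card_powersetCard, Finset.card_univ, Fintype.card_fin]
    _ ≤ n ^ m := Nat.choose_le_pow _ _

open Classical in
lemma aux_avoid {n : ℕ} (m : ℕ) (T : Finset (Fin n)) (F : Finset (Finset (Fin n)))
    (hF : ∀ S ∈ F, S.card = m + 1) (a : ℝ) (ha : a * (n : ℝ) ^ (m + 1) ≤ F.card)
    (hn : 2 * (T.card : ℝ) ≤ a * n) :
    a / 2 * (n : ℝ) ^ (m + 1) ≤ (F.filter (fun S => Disjoint S T)).card := by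
  have h1 : (F.filter (fun S => ¬ Disjoint S T)).card ≤ T.card * n ^ m := by
    calc (F.filter (fun S => ¬ Disjoint S T)).card
        ≤ (T.biUnion (fun t => F.filter (fun S => t ∈ S))).card := by
          apply Finset.card_le_card
          intro S hS
          rw [Finset.mem_filter, Finset.not_disjoint_iff] at hS
          obtain ⟨hS, t, ht, ht'⟩ := hS
          simp only [Finset.mem_biUnion, Finset.mem_filter]
          exact ⟨t, ht', hS, ht⟩
      _ ≤ T.card * n ^ m := Finset.card_biUnion_le_card_mul _ _ _ (fun t _ => aux_contain m t F hF)
  have h2 := Finset.card_filter_add_card_filter_not (s := F) (fun S => Disjoint S T)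
  have h1' : ((F.filter (fun S => ¬ Disjoint S T)).card : ℝ) ≤ T.card * (n : ℝ) ^ m := by
    exact_mod_cast h1
  have h2' : ((F.filter (fun S => Disjoint S T)).card : ℝ)
      + (F.filter (fun S => ¬ Disjoint S T)).card = F.card := by exact_mod_cast h2
  have h3 : (2 * (T.card : ℝ)) * (n : ℝ) ^ m ≤ (a * n) * (n : ℝ) ^ m :=
    mul_le_mul_of_nonneg_right hn (by positivity)
  rw [pow_succ] at *
  nlinarith

open Classical in
lemma aux_triple (k1 k2 : ℕ) (μ a b : ℝ) (hμ : 0 < μ) (ha : 0 < a) (hb : 0 < b) :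
    ∃ η : ℝ, 0 < η ∧ ∃ n₀ : ℕ, ∀ n : ℕ, n₀ ≤ n → ∀ (x y : Fin n) (Z : Finset (Fin n))
      (F1 F2 : Fin n → Finset (Finset (Fin n))) (P : Finset (Fin n) → Prop),
      μ * n ≤ Z.card → (∀ z ∈ Z, ∀ S ∈ F1 z, S.card = k1 + 1) →
      (∀ z ∈ Z, ∀ S ∈ F2 z, S.card = k2 + 1) →
      (∀ z ∈ Z, a * (n : ℝ) ^ (k1 + 1) ≤ (F1 z).card) →
      (∀ z ∈ Z, b * (n : ℝ) ^ (k2 + 1) ≤ (F2 z).card) →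
      (∀ z ∈ Z, ∀ S1 ∈ F1 z, ∀ S2 ∈ F2 z, x ≠ z → y ≠ z → x ∉ S1 → y ∉ S1 → z ∉ S1 →
        x ∉ S2 → y ∉ S2 → z ∉ S2 → Disjoint S1 S2 → P (insert z (S1 ∪ S2))) →
      η * (n : ℝ) ^ (k1 + k2 + 3) ≤ ({S | P S}.ncard : ℝ) := by
  set m := k1 + k2 + 3 with hm
  set C : ℝ := (m : ℝ) * (2 ^ m * 2 ^ m) with hC
  have hC0 : 0 < C := by
    have : (0 : ℝ) < m := by rw [hm]; positivity
    positivity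
  refine ⟨μ / 2 * (a / 2) * (b / 2) / C, by positivity, ?_⟩
  obtain ⟨n1, hn1⟩ := exists_nat_ge (4 / μ)
  obtain ⟨n2, hn2⟩ := exists_nat_ge (6 / a)
  obtain ⟨n3, hn3⟩ := exists_nat_ge (2 * (k1 + 4) / b)
  refine ⟨n1 + n2 + n3, ?_⟩
  intro n hn x y Z F1 F2 P hZ hF1 hF2 hF1c hF2c hP
  have hn1' : 4 ≤ μ * n := by
    have : (n1 : ℝ) ≤ n := by exact_mod_cast (by omega)
    rw [div_le_iff₀ hμ] at hn1; nlinarith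
  have hn2' : 6 ≤ a * n := by
    have : (n2 : ℝ) ≤ n := by exact_mod_cast (by omega)
    rw [div_le_iff₀ ha] at hn2; nlinarith
  have hn3' : 2 * ((k1 : ℝ) + 4) ≤ b * n := by
    have : (n3 : ℝ) ≤ n := by exact_mod_cast (by omega)
    rw [div_le_iff₀ hb] at hn3; nlinarith
  set Z' := Z \ {x, y} with hZ'
  set F1' : Fin n → Finset (Finset (Fin n)) :=
    fun z => (F1 z).filter (fun S => Disjoint S {x, y, z}) with hF1'
  set F2' : Fin n → Finset (Fin n) → Finset (Finset (Fin n)) :=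
    fun z S1 => (F2 z).filter (fun S => Disjoint S (S1 ∪ {x, y, z})) with hF2'
  have hZ'c : μ / 2 * n ≤ (Z'.card : ℝ) := by
    have h1 : Z.card ≤ Z'.card + 2 := by
      have hsub : Z ⊆ Z' ∪ {x, y} := by
        intro z hz
        simp only [hZ', Finset.mem_union, Finset.mem_sdiff]
        tauto
      exact (Finset.card_le_card hsub).trans ((Finset.card_union_le _ _).trans
        (Nat.add_le_add_left Finset.card_le_two _))
    have h1' : (Z.card : ℝ) ≤ Z'.card + 2 := by exact_mod_cast h1
    linarith
  have h3 : ∀ z : Fin n, ({x, y, z} : Finset (Fin n)).card ≤ 3 := fun z => Finset.card_le_three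
  have hF1'c : ∀ z ∈ Z', a / 2 * (n : ℝ) ^ (k1 + 1) ≤ ((F1' z).card : ℝ) := by
    intro z hz
    have hz := (Finset.mem_sdiff.1 hz).1
    apply aux_avoid _ _ _ (hF1 z hz) _ (hF1c z hz)
    have : (({x, y, z} : Finset (Fin n)).card : ℝ) ≤ 3 := by exact_mod_cast h3 z
    linarith
  have hF2'c : ∀ z ∈ Z', ∀ S1 ∈ F1' z, b / 2 * (n : ℝ) ^ (k2 + 1) ≤ ((F2' z S1).card : ℝ) := by
    intro z hz S1 hS1
    have hz := (Finset.mem_sdiff.1 hz).1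
    apply aux_avoid _ _ _ (hF2 z hz) _ (hF2c z hz)
    have h4 : (S1 ∪ ({x, y, z} : Finset (Fin n))).card ≤ k1 + 4 := by
      have h5 := Finset.card_union_le S1 ({x, y, z} : Finset (Fin n))
      have h6 := hF1 z hz S1 (Finset.mem_filter.1 hS1).1
      have := h3 z
      omega
    have : ((S1 ∪ ({x, y, z} : Finset (Fin n))).card : ℝ) ≤ k1 + 4 := by exact_mod_cast h4
    linarith
  set D : Finset (Σ _ : Fin n, Σ _ : Finset (Fin n), Finset (Fin n)) :=
    Z'.sigma (fun z => (F1' z).sigma (fun S1 => F2' z S1)) with hD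
  have hDc : μ / 2 * (a / 2) * (b / 2) * (n : ℝ) ^ m ≤ (D.card : ℝ) := by
    have e1 : ∀ z ∈ Z', (a / 2 * (n : ℝ) ^ (k1 + 1)) * (b / 2 * (n : ℝ) ^ (k2 + 1)) ≤
        (((F1' z).sigma (fun S1 => F2' z S1)).card : ℝ) := by
      intro z hz
      rw [Finset.card_sigma, Nat.cast_sum]
      have := Finset.card_nsmul_le_sum (F1' z) (fun S1 => ((F2' z S1).card : ℝ)) _ (hF2'c z hz)
      rw [nsmul_eq_mul] at this
      refine le_trans ?_ this
      exact mul_le_mul_of_nonneg_right (hF1'c z hz) (by positivity)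
    rw [hD, Finset.card_sigma, Nat.cast_sum]
    have := Finset.card_nsmul_le_sum Z' _ _ e1
    rw [nsmul_eq_mul] at this
    refine le_trans ?_ this
    refine le_trans (le_of_eq ?_) (mul_le_mul_of_nonneg_right hZ'c (by positivity))
    rw [hm]; ring
  set G : Finset (Finset (Fin n)) :=
    ((Finset.univ : Finset (Fin n)).powersetCard m).filter P with hG
  have hDG : D.card ≤ (m * (2 ^ m * 2 ^ m)) * G.card := by
    have key : ∀ p ∈ D, insert p.1 (p.2.1 ∪ p.2.2) ∈ G := by
      rintro ⟨z, S1, S2⟩ hp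
      simp only [hD, Finset.mem_sigma, hZ', hF1', hF2', Finset.mem_filter, Finset.mem_sdiff,
        Finset.disjoint_union_right, Finset.disjoint_insert_right, Finset.disjoint_singleton_right,
        Finset.mem_insert, Finset.mem_singleton, not_or] at hp
      obtain ⟨⟨hz, hzx, hzy⟩, ⟨hS1, hx1, hy1, hz1⟩, hS2, hd, hx2, hy2, hz2⟩ := hp
      simp only [hG, Finset.mem_filter, Finset.mem_powersetCard]
      refine ⟨⟨Finset.subset_univ _, ?_⟩, hP z hz S1 hS1 S2 hS2 (Ne.symm hzx) (Ne.symm hzy)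
        hx1 hy1 hz1 hx2 hy2 hz2 hd.symm⟩
      rw [Finset.card_insert_of_notMem (by simp [hz1, hz2]), Finset.card_union_of_disjoint hd.symm,
        hF1 z hz S1 hS1, hF2 z hz S2 hS2]
      omega
    refine Finset.card_le_mul_card_image_of_maps_to (f := fun p => insert p.1 (p.2.1 ∪ p.2.2))
      key _ ?_
    intro S hS
    have hSm : S.card = m := (Finset.mem_powersetCard.1 (Finset.mem_filter.1 hS).1).2
    calc _ ≤ (S.sigma (fun _ => S.powerset.sigma (fun _ => S.powerset))).card := by
          apply Finset.card_le_card
          rintro ⟨z, S1, S2⟩ hp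
          rw [Finset.mem_filter] at hp
          have hp := hp.2
          simp only at hp
          simp only [Finset.mem_sigma, Finset.mem_powerset, ← hp]
          refine ⟨Finset.mem_insert_self _ _, ?_, ?_⟩
          · exact Finset.subset_union_left.trans (Finset.subset_insert _ _)
          · exact Finset.subset_union_right.trans (Finset.subset_insert _ _)
      _ = m * (2 ^ m * 2 ^ m) := by
          simp [Finset.card_sigma, hSm]
  have hGP : G.card ≤ {S | P S}.ncard := by
    rw [← Set.ncard_coe_finset]
    apply Set.ncard_le_ncard _ (Set.toFinite _)
    intro S hS
    exact (Finset.mem_filter.1 (Finset.mem_coe.1 hS)).2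
  have hDG' : (D.card : ℝ) ≤ C * ({S | P S}.ncard : ℝ) := by
    have : (D.card : ℝ) ≤ C * G.card := by rw [hC]; exact_mod_cast hDG
    have h' : (G.card : ℝ) ≤ ({S | P S}.ncard : ℝ) := by exact_mod_cast hGP
    nlinarith
  rw [div_mul_eq_mul_div, div_le_iff₀ hC0]
  linarith

lemma aux_factor_union {n : ℕ} {H : Finset (Finset (Fin n))} {X Y : Finset (Fin n)}
    (hX : HasK4mFactorOn H X) (hY : HasK4mFactorOn H Y) (h : Disjoint X Y) :
    HasK4mFactorOn H (X ∪ Y) := by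
  obtain ⟨P, hP, hPd, hPX⟩ := hX
  obtain ⟨Q, hQ, hQd, hQY⟩ := hY
  have sP : ∀ S ∈ P, S ⊆ X := by
    intro S hS; rw [← hPX]; exact Finset.subset_biUnion_of_mem id hS
  have sQ : ∀ S ∈ Q, S ⊆ Y := by
    intro S hS; rw [← hQY]; exact Finset.subset_biUnion_of_mem id hS
  refine ⟨P ∪ Q, ?_, ?_, ?_⟩
  · intro S hS
    rcases Finset.mem_union.1 hS with h1 | h1
    · exact hP S h1
    · exact hQ S h1
  · intro S hS T hT hne
    rcases Finset.mem_union.1 hS with h1 | h1 <;> rcases Finset.mem_union.1 hT with h2 | h2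
    · exact hPd S h1 T h2 hne
    · exact Finset.disjoint_of_subset_left (sP S h1) (Finset.disjoint_of_subset_right (sQ T h2) h)
    · exact Finset.disjoint_of_subset_left (sQ S h1)
        (Finset.disjoint_of_subset_right (sP T h2) h.symm)
    · exact hQd S h1 T h2 hne
  · rw [Finset.union_biUnion, hPX, hQY]

lemma aux_close_symm {n : ℕ} {H : Finset (Finset (Fin n))} {c : ℕ} {η : ℝ} {x y : Fin n}
    (h : Close H c η x y) : Close H c η y x := by
  unfold Close at *
  have : {S : Finset (Fin n) | IsConnector H c y x S} = {S | IsConnector H c x y S} := by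
    ext S
    simp only [Set.mem_ofPred_eq, IsConnector]
    tauto
  rwa [this]

lemma aux_close_mono {n : ℕ} {H : Finset (Finset (Fin n))} {c : ℕ} {η η' : ℝ} {x y : Fin n}
    (h : Close H c η x y) (hη : η' ≤ η) : Close H c η' x y := by
  unfold Close at *
  exact le_trans (mul_le_mul_of_nonneg_right hη (by positivity)) h

lemma aux_close_self {n : ℕ} {H : Finset (Finset (Fin n))} {c : ℕ} {η : ℝ} {x y : Fin n}
    (h : Close H c η x y) : Close H c η x x := by
  unfold Close at *
  refine le_trans h ?_
  norm_cast
  apply Set.ncard_le_ncard _ (Set.toFinite _)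
  intro S hS
  exact ⟨hS.1, hS.1, hS.2.2.1, hS.2.2.2.1, hS.2.2.2.1⟩

open Classical in
lemma aux_L1 (c1 c2 : ℕ) (h1 : 1 ≤ c1) (h2 : 1 ≤ c2) (μ a b : ℝ) (hμ : 0 < μ) (ha : 0 < a)
    (hb : 0 < b) :
    ∃ η : ℝ, 0 < η ∧ ∃ n₀ : ℕ, ∀ n : ℕ, n₀ ≤ n → ∀ (H : Finset (Finset (Fin n))) (x y : Fin n),
      μ * n ≤ ((Finset.univ.filter (fun z => Close H c1 a x z ∧ Close H c2 b z y)).card : ℝ) →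
      Close H (c1 + c2) η x y := by
  obtain ⟨k1, rfl⟩ : ∃ k, c1 = k + 1 := ⟨c1 - 1, by omega⟩
  obtain ⟨k2, rfl⟩ : ∃ k, c2 = k + 1 := ⟨c2 - 1, by omega⟩
  obtain ⟨η, hη, n₀, h⟩ := aux_triple (4 * k1 + 2) (4 * k2 + 2) μ a b hμ ha hb
  refine ⟨η, hη, n₀, ?_⟩
  intro n hn H x y hc
  have e1 : 4 * (k1 + 1) - 1 = 4 * k1 + 2 + 1 := by omega
  have e2 : 4 * (k2 + 1) - 1 = 4 * k2 + 2 + 1 := by omega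
  have e3 : 4 * (k1 + 1 + (k2 + 1)) - 1 = 4 * k1 + 2 + (4 * k2 + 2) + 3 := by omega
  have key := h n hn x y _ (fun z => Finset.univ.filter (fun S => IsConnector H (k1 + 1) x z S))
    (fun z => Finset.univ.filter (fun S => IsConnector H (k2 + 1) z y S))
    (fun S => IsConnector H (k1 + 1 + (k2 + 1)) x y S) hc ?_ ?_ ?_ ?_ ?_
  · unfold Close
    rw [e3]; exact key
  · intro z _ S hS
    rw [← e1]; exact (Finset.mem_filter.1 hS).2.2.2.1
  · intro z _ S hS
    rw [← e2]; exact (Finset.mem_filter.1 hS).2.2.2.1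
  · intro z hz
    have := (Finset.mem_filter.1 hz).2.1
    unfold Close at this
    rw [e1] at this
    rw [← Set.ncard_coe_finset]
    simpa using this
  · intro z hz
    have := (Finset.mem_filter.1 hz).2.2
    unfold Close at this
    rw [e2] at this
    rw [← Set.ncard_coe_finset]
    simpa using this
  · intro z _ S1 hS1 S2 hS2 hxz hyz hx1 hy1 hz1 hx2 hy2 hz2 hd
    have hS1 := (Finset.mem_filter.1 hS1).2
    have hS2 := (Finset.mem_filter.1 hS2).2
    refine ⟨by simp [hxz, hx1, hx2], by simp [hyz, hy1, hy2], ?_, ?_, ?_⟩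
    · rw [Finset.card_insert_of_notMem (by simp [hz1, hz2]), Finset.card_union_of_disjoint hd,
        hS1.2.2.1, hS2.2.2.1]
      omega
    · have := aux_factor_union hS1.2.2.2.1 hS2.2.2.2.1
        (by simp [Finset.disjoint_insert_right, hxz.symm, hz1, hx2, hd])
      convert this using 1
      ext w; simp only [Finset.mem_insert, Finset.mem_union]; tauto
    · have := aux_factor_union hS1.2.2.2.2 hS2.2.2.2.2
        (by simp [Finset.disjoint_insert_right, hyz, hy1, hz2, hd])
      convert this using 1
      ext w; simp only [Finset.mem_insert, Finset.mem_union]; tauto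

open Classical in
lemma aux_L2 (c1 : ℕ) (h1 : 1 ≤ c1) (a α : ℝ) (ha : 0 < a) (hα : 0 < α) :
    ∃ η : ℝ, 0 < η ∧ ∃ n₀ : ℕ, ∀ n : ℕ, n₀ ≤ n → ∀ (H : Finset (Finset (Fin n))),
      (∀ v, Close H 1 α v v) → ∀ (x y : Fin n), Close H c1 a x y → Close H (c1 + 1) η x y := by
  obtain ⟨k1, rfl⟩ : ∃ k, c1 = k + 1 := ⟨c1 - 1, by omega⟩
  obtain ⟨η, hη, n₀, h⟩ := aux_triple (4 * k1 + 2) 2 1 a α one_pos ha hα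
  refine ⟨η, hη, n₀, ?_⟩
  intro n hn H hself x y hc
  have e1 : 4 * (k1 + 1) - 1 = 4 * k1 + 2 + 1 := by omega
  have e3 : 4 * (k1 + 1 + 1) - 1 = 4 * k1 + 2 + 2 + 3 := by omega
  have key := h n hn x y Finset.univ
    (fun z => Finset.univ.filter (fun S => IsConnector H (k1 + 1) x y S))
    (fun z => Finset.univ.filter (fun S => IsConnector H 1 z z S))
    (fun S => IsConnector H (k1 + 1 + 1) x y S) (by simp) ?_ ?_ ?_ ?_ ?_
  · unfold Close
    rw [e3]; exact key
  · intro z _ S hS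
    rw [← e1]; exact (Finset.mem_filter.1 hS).2.2.2.1
  · intro z _ S hS
    exact (Finset.mem_filter.1 hS).2.2.2.1
  · intro z hz
    unfold Close at hc
    rw [e1] at hc
    rw [← Set.ncard_coe_finset]
    simpa using hc
  · intro z hz
    have := hself z
    unfold Close at this
    rw [← Set.ncard_coe_finset]
    simpa using this
  · intro z _ S1 hS1 S2 hS2 hxz hyz hx1 hy1 hz1 hx2 hy2 hz2 hd
    have hS1 := (Finset.mem_filter.1 hS1).2
    have hS2 := (Finset.mem_filter.1 hS2).2
    refine ⟨by simp [hxz, hx1, hx2], by simp [hyz, hy1, hy2], ?_, ?_, ?_⟩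
    · rw [Finset.card_insert_of_notMem (by simp [hz1, hz2]), Finset.card_union_of_disjoint hd,
        hS1.2.2.1, hS2.2.2.1]
      omega
    · have := aux_factor_union hS1.2.2.2.1 hS2.2.2.2.1
        (by simp [Finset.disjoint_insert_right, hxz.symm, hz1, hx2, hd])
      convert this using 1
      ext w; simp only [Finset.mem_insert, Finset.mem_union]; tauto
    · have := aux_factor_union hS1.2.2.2.2 hS2.2.2.2.2
        (by simp [Finset.disjoint_insert_right, hyz.symm, hz1, hy2, hd])
      convert this using 1
      ext w; simp only [Finset.mem_insert, Finset.mem_union]; tauto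

lemma aux_pad (c1 : ℕ) (h1 : 1 ≤ c1) (a α : ℝ) (ha : 0 < a) (hα : 0 < α) (t : ℕ) :
    ∃ η : ℝ, 0 < η ∧ ∃ n₀ : ℕ, ∀ n : ℕ, n₀ ≤ n → ∀ (H : Finset (Finset (Fin n))),
      (∀ v, Close H 1 α v v) → ∀ (x y : Fin n), Close H c1 a x y → Close H (c1 + t) η x y := by
  induction t with
  | zero => exact ⟨a, ha, 0, fun n _ H _ x y h => h⟩
  | succ t ih =>
    obtain ⟨η, hη, n₀, h⟩ := ih
    obtain ⟨η', hη', n₁, h'⟩ := aux_L2 (c1 + t) (by omega) η α hη hα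
    refine ⟨η', hη', n₀ + n₁, ?_⟩
    intro n hn H hs x y hc
    exact h' n (by omega) H hs x y (h n (by omega) H hs x y hc)

open Classical in
/-- Concatenation and padding at once. -/
lemma aux_both (c1 c2 : ℕ) (h1 : 1 ≤ c1) (h2 : 1 ≤ c2) (μ a b α : ℝ) (hμ : 0 < μ) (ha : 0 < a)
    (hb : 0 < b) (hα : 0 < α) (c : ℕ) (hc : c1 + c2 ≤ c) :
    ∃ η : ℝ, 0 < η ∧ ∃ n₀ : ℕ, ∀ n : ℕ, n₀ ≤ n → ∀ (H : Finset (Finset (Fin n))),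
      (∀ v, Close H 1 α v v) → 
      (∀ x y : Fin n,
      μ * n ≤ ((Finset.univ.filter (fun z => Close H c1 a x z ∧ Close H c2 b z y)).card : ℝ) →
      Close H c η x y) ∧ (∀ x y : Fin n, Close H c1 a x y → Close H c η x y) ∧
      (∀ x y : Fin n, Close H c2 b x y → Close H c η x y) := by
  obtain ⟨e1, he1, n1, p1⟩ := aux_L1 c1 c2 h1 h2 μ a b hμ ha hb
  obtain ⟨e2, he2, n2, p2⟩ := aux_pad (c1 + c2) (by omega) e1 α he1 hα (c - (c1 + c2))
  obtain ⟨e3, he3, n3, p3⟩ := aux_pad c1 h1 a α ha hα (c - c1)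
  obtain ⟨e4, he4, n4, p4⟩ := aux_pad c2 h2 b α hb hα (c - c2)
  have q2 : c1 + c2 + (c - (c1 + c2)) = c := by omega
  have q3 : c1 + (c - c1) = c := by omega
  have q4 : c2 + (c - c2) = c := by omega
  rw [q2] at p2; rw [q3] at p3; rw [q4] at p4
  refine ⟨min e2 (min e3 e4), by positivity, n1 + n2 + n3 + n4, ?_⟩
  intro n hn H hs
  refine ⟨fun x y h => ?_, fun x y h => ?_, fun x y h => ?_⟩
  · exact aux_close_mono (p2 n (by omega) H hs x y (p1 n (by omega) H x y h)) (min_le_left _ _)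
  · exact aux_close_mono (p3 n (by omega) H hs x y h)
      ((min_le_right _ _).trans (min_le_left _ _))
  · exact aux_close_mono (p4 n (by omega) H hs x y h)
      ((min_le_right _ _).trans (min_le_right _ _))

open Classical in
lemma aux_bonf {V ι : Type*} [DecidableEq V] [DecidableEq ι] (N : ι → Finset V) (I : Finset ι) :
    ∑ i ∈ I, (N i).card ≤ (I.biUnion N).card
      + ∑ p ∈ I.offDiag, (N p.1 ∩ N p.2).card := by
  induction I using Finset.induction_on with
  | empty => simp
  | insert i I hi ih =>
    rw [Finset.sum_insert hi, Finset.biUnion_insert]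
    have h1 := Finset.card_union_add_card_inter (N i) (I.biUnion N)
    have h2 : (N i ∩ I.biUnion N).card ≤ ∑ j ∈ I, (N i ∩ N j).card := by
      rw [Finset.inter_biUnion]; exact Finset.card_biUnion_le
    have h3 : ∑ j ∈ I, (N i ∩ N j).card + ∑ p ∈ I.offDiag, (N p.1 ∩ N p.2).card
        ≤ ∑ p ∈ (insert i I).offDiag, (N p.1 ∩ N p.2).card := by
      have h4 : ∑ j ∈ I, (N i ∩ N j).card
          = ∑ p ∈ I.image (fun j => (i, j)), (N p.1 ∩ N p.2).card := by
        rw [Finset.sum_image]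
        intro a _ b _ h; simpa using h
      rw [h4, ← Finset.sum_union]
      · apply Finset.sum_le_sum_of_subset
        intro p hp
        rcases Finset.mem_union.1 hp with h | h
        · obtain ⟨j, hj, rfl⟩ := Finset.mem_image.1 h
          simp only [Finset.mem_offDiag, Finset.mem_insert, true_or, hj, or_true, true_and]
          rintro rfl; exact hi hj
        · simp only [Finset.mem_offDiag, Finset.mem_insert] at h ⊢
          tauto
      · rw [Finset.disjoint_left]
        intro p hp hp'
        obtain ⟨j, hj, rfl⟩ := Finset.mem_image.1 hp
        exact hi (Finset.mem_offDiag.1 hp').1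
    omega

open Classical in
lemma aux_step {n : ℕ} (γ : ℝ) (hγ : 0 < γ) (hγ' : γ ≤ 1 / 100) (hn : 0 < n)
    (N R A T : Fin n → Fin n → Prop)
    (hNc : ∀ v, (1 / 4 - 3 * γ) * n ≤ ((Finset.univ.filter (fun z => N v z)).card : ℝ))
    (hNs : ∀ x y, N x y → N y x) (hRs : ∀ x y, R x y → R y x)
    (hTs : ∀ x y, T x y → T y x)
    (hNR : ∀ x y, N x y → R x y) (hRT : ∀ x y, R x y → T x y) (hAT : ∀ x y, A x y → T x y)
    (hA : ∀ x y, (1 / 20 : ℝ) * n ≤ ((Finset.univ.filter (fun z => N x z ∧ R z y)).card : ℝ) →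
      A x y)
    (hT : ∀ x y, (1 / 20 : ℝ) * n ≤ ((Finset.univ.filter (fun z => A x z ∧ N z y)).card : ℝ) →
      T x y)
    (d : ℕ) (hd : 1 ≤ d) (hd' : d ≤ 4) (v : Fin d → Fin n) (hv : ∀ i j, i ≠ j → ¬ R (v i) (v j))
    (hv2 : ∀ i j, i ≠ j →
      ((Finset.univ.filter (fun z => R (v i) z ∧ R z (v j))).card : ℝ) ≤ γ / 16 * n)
    (hmax : ∀ f : Fin (d + 1) → Fin n, ∃ i j, i ≠ j ∧ R (f i) (f j)) :
    ∃ V : Fin d → Finset (Fin n),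
      (∀ i j, i ≠ j → Disjoint (V i) (V j)) ∧
      (Finset.univ.biUnion V = (Finset.univ : Finset (Fin n))) ∧
      (∀ i, (∀ x ∈ V i, ∀ y ∈ V i, T x y) ∧ (1 / 4 - 4 * γ) * n ≤ ((V i).card : ℝ)) := by
  have hn0 : (0 : ℝ) < n := by exact_mod_cast hn
  set U : Fin d → Finset (Fin n) :=
    fun i => Finset.univ.filter (fun z => R z (v i) ∧ ∀ j, j ≠ i → ¬ R z (v j)) with hU
  have memU : ∀ i z, z ∈ U i ↔ (R z (v i) ∧ ∀ j, j ≠ i → ¬ R z (v j)) := by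
    intro i z; simp [hU]
  have Ucl : ∀ i, ∀ x ∈ U i, ∀ y ∈ U i, R x y := by
    intro i x hx y hy
    rw [memU] at hx hy
    obtain ⟨p, q, hpq, hR⟩ := hmax (Fin.cons y (Function.update v i x))
    have main : ∀ k, R y (Function.update v i x k) → R x y := by
      intro k hk
      by_cases hki : k = i
      · subst hki; rw [Function.update_self] at hk; exact hRs _ _ hk
      · rw [Function.update_of_ne hki] at hk; exact absurd hk (hy.2 k hki)
    induction p using Fin.cases with
    | zero =>
      induction q using Fin.cases with
      | zero => exact absurd rfl hpq
      | succ q =>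
        rw [Fin.cons_zero, Fin.cons_succ] at hR
        exact main q hR
    | succ p =>
      induction q using Fin.cases with
      | zero =>
        rw [Fin.cons_zero, Fin.cons_succ] at hR
        exact main p (hRs _ _ hR)
      | succ q =>
        rw [Fin.cons_succ, Fin.cons_succ] at hR
        have hpq' : p ≠ q := fun h => hpq (by rw [h])
        exfalso
        by_cases hp : p = i
        · subst hp
          rw [Function.update_self, Function.update_of_ne hpq'.symm] at hR
          exact hx.2 q hpq'.symm hR
        · rw [Function.update_of_ne hp] at hR
          by_cases hq : q = i
          · subst hq
            rw [Function.update_self] at hR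
            exact hx.2 p hp (hRs _ _ hR)
          · rw [Function.update_of_ne hq] at hR
            exact hv p q hpq' hR
  have hsome : ∀ z, ∃ k, R z (v k) := by
    intro z
    obtain ⟨p, q, hpq, hR⟩ := hmax (Fin.cons z v)
    induction p using Fin.cases with
    | zero =>
      induction q using Fin.cases with
      | zero => exact absurd rfl hpq
      | succ q => exact ⟨q, by simpa using hR⟩
    | succ p =>
      induction q using Fin.cases with
      | zero => exact ⟨p, hRs _ _ (by simpa using hR)⟩
      | succ q =>
        exact absurd (by simpa using hR) (hv p q (fun h => hpq (by rw [h])))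
  have Udisj : ∀ i j z, z ∈ U i → z ∈ U j → i = j := by
    intro i j z hi hj
    rw [memU] at hi hj
    by_contra h
    exact hj.2 i h hi.1
  set U0 : Finset (Fin n) := Finset.univ.filter (fun z => ∀ i, z ∉ U i) with hU0
  have U0c : (U0.card : ℝ) ≤ γ * n := by
    have h1 : U0 ⊆ (Finset.univ : Finset (Fin d)).offDiag.biUnion
        (fun p => Finset.univ.filter (fun z => R (v p.1) z ∧ R z (v p.2))) := by
      intro z hz
      have hz := (Finset.mem_filter.1 hz).2
      obtain ⟨k, hk⟩ := hsome z
      have h2 := hz k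
      rw [memU] at h2
      push Not at h2
      obtain ⟨j, hj, hjR⟩ := h2 hk
      simp only [Finset.mem_biUnion, Finset.mem_filter, Finset.mem_offDiag, Finset.mem_univ,
        true_and]
      exact ⟨(k, j), hj.symm, hRs _ _ hk, hjR⟩
    have h2 : (U0.card : ℝ) ≤ ∑ p ∈ (Finset.univ : Finset (Fin d)).offDiag,
        ((Finset.univ.filter (fun z => R (v p.1) z ∧ R z (v p.2))).card : ℝ) := by
      exact_mod_cast (Finset.card_le_card h1).trans Finset.card_biUnion_le
    have h3 := Finset.sum_le_card_nsmul (Finset.univ : Finset (Fin d)).offDiag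
      (fun p => ((Finset.univ.filter (fun z => R (v p.1) z ∧ R z (v p.2))).card : ℝ))
      (γ / 16 * n) (fun p hp => hv2 p.1 p.2 (Finset.mem_offDiag.1 hp).2.2)
    have h4 : (Finset.univ : Finset (Fin d)).offDiag.card ≤ 16 := by
      rw [Finset.offDiag_card, Finset.card_univ, Fintype.card_fin]
      have : d * d ≤ 4 * 4 := Nat.mul_le_mul hd' hd'
      omega
    have h5 : ((Finset.univ : Finset (Fin d)).offDiag.card : ℝ) ≤ 16 := by exact_mod_cast h4
    rw [nsmul_eq_mul] at h3
    have h6 : (0 : ℝ) < γ / 16 * n := by positivity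
    nlinarith
  have hbig : ∀ z, ∃ i, (1 / 20 : ℝ) * n ≤ ((U i ∩ Finset.univ.filter (fun w => N z w)).card : ℝ) := by
    intro z
    by_contra hcon
    push Not at hcon
    have h1 : (Finset.univ.filter (fun w => N z w)) ⊆
        U0 ∪ Finset.univ.biUnion (fun i => U i ∩ Finset.univ.filter (fun w => N z w)) := by
      intro w hw
      by_cases hw0 : ∀ i, w ∉ U i
      · exact Finset.mem_union_left _ (by simp only [hU0, Finset.mem_filter]; exact ⟨Finset.mem_univ _, hw0⟩)
      · push Not at hw0
        obtain ⟨i, hi⟩ := hw0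
        exact Finset.mem_union_right _ (Finset.mem_biUnion.2
          ⟨i, Finset.mem_univ _, Finset.mem_inter.2 ⟨hi, hw⟩⟩)
    have h2 : ((Finset.univ.filter (fun w => N z w)).card : ℝ) ≤ U0.card +
        ∑ i, ((U i ∩ Finset.univ.filter (fun w => N z w)).card : ℝ) := by
      have := (Finset.card_le_card h1).trans (Finset.card_union_le _ _)
      have h' := this.trans (Nat.add_le_add_left Finset.card_biUnion_le _)
      exact_mod_cast h'
    have h3 := Finset.sum_le_card_nsmul Finset.univ
      (fun i => ((U i ∩ Finset.univ.filter (fun w => N z w)).card : ℝ))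
      ((1 / 20 : ℝ) * n) (fun i _ => (hcon i).le)
    rw [nsmul_eq_mul, Finset.card_univ, Fintype.card_fin] at h3
    have h4 : (d : ℝ) ≤ 4 := by exact_mod_cast hd'
    have h5 := hNc z
    nlinarith
  have hg : ∀ z, ∃ i, z ∈ U i ∨ ((∀ j, z ∉ U j) ∧
      (1 / 20 : ℝ) * n ≤ ((U i ∩ Finset.univ.filter (fun w => N z w)).card : ℝ)) := by
    intro z
    by_cases hz : ∀ i, z ∉ U i
    · obtain ⟨i, hi⟩ := hbig z
      exact ⟨i, Or.inr ⟨hz, hi⟩⟩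
    · push Not at hz
      obtain ⟨i, hi⟩ := hz
      exact ⟨i, Or.inl hi⟩
  choose g hg using hg
  refine ⟨fun i => Finset.univ.filter (fun z => g z = i), ?_, ?_, ?_⟩
  · intro i j hij
    rw [Finset.disjoint_left]
    intro z hz hz'
    simp only [Finset.mem_filter, Finset.mem_univ, true_and] at hz hz'
    exact hij (hz.symm.trans hz')
  · ext z; simp
  · intro i
    have hmix : ∀ x, ∀ u ∈ U i, 
        (1 / 20 : ℝ) * n ≤ ((U i ∩ Finset.univ.filter (fun w => N x w)).card : ℝ) → A x u := by
      intro x u hu hx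
      apply hA
      refine hx.trans ?_
      norm_cast
      apply Finset.card_le_card
      intro w hw
      simp only [Finset.mem_inter, Finset.mem_filter, Finset.mem_univ, true_and] at hw ⊢
      exact ⟨hw.2, Ucl i w hw.1 u hu⟩
    constructor
    · intro x hx y hy
      simp only [Finset.mem_filter, Finset.mem_univ, true_and] at hx hy
      have gx := hg x
      have gy := hg y
      rw [hx] at gx
      rw [hy] at gy
      rcases gx with gx | ⟨-, gx⟩ <;> rcases gy with gy | ⟨-, gy⟩
      · exact hRT _ _ (Ucl i x gx y gy)
      · exact hTs _ _ (hAT _ _ (hmix y x gx gy))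
      · exact hAT _ _ (hmix x y gy gx)
      · apply hT
        refine gy.trans ?_
        norm_cast
        apply Finset.card_le_card
        intro w hw
        simp only [Finset.mem_inter, Finset.mem_filter, Finset.mem_univ, true_and] at hw ⊢
        exact ⟨hmix x w hw.1 gx, hNs _ _ hw.2⟩
    · have h1 : Finset.univ.filter (fun z => N (v i) z) ⊆
          U0 ∪ Finset.univ.filter (fun z => g z = i) := by
        intro w hw
        simp only [Finset.mem_filter, Finset.mem_univ, true_and] at hw
        by_cases hw0 : ∀ i, w ∉ U i
        · exact Finset.mem_union_left _ (by simp only [hU0, Finset.mem_filter]; exact ⟨Finset.mem_univ _, hw0⟩)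
        · apply Finset.mem_union_right
          simp only [Finset.mem_filter, Finset.mem_univ, true_and]
          have hw1 : w ∈ U (g w) := by
            rcases hg w with h | h
            · exact h
            · exact absurd h.1 hw0
          by_contra hne
          exact ((memU _ _).1 hw1).2 i (Ne.symm hne) (hRs _ _ (hNR _ _ hw))
      have h2 := (Finset.card_le_card h1).trans (Finset.card_union_le _ _)
      have h3 : ((Finset.univ.filter (fun z => N (v i) z)).card : ℝ) ≤
          U0.card + (Finset.univ.filter (fun z => g z = i)).card := by exact_mod_cast h2
      have := hNc (v i)
      linarith

open Classical in
lemma aux_five {n : ℕ} {ι : Type} [Fintype ι] (hι : Fintype.card ι = 5) (γ : ℝ) (hγ' : γ ≤ 1 / 100) (hn : 0 < n)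
    (N : Fin n → Fin n → Prop)
    (hNc : ∀ v, (1 / 4 - 3 * γ) * n ≤ ((Finset.univ.filter (fun z => N v z)).card : ℝ))
    (hNs : ∀ x y, N x y → N y x) (f : ι → Fin n) :
    ∃ i j, i ≠ j ∧ (1 / 1000 : ℝ) * n ≤
      ((Finset.univ.filter (fun z => N (f i) z ∧ N z (f j))).card : ℝ) := by
  by_contra hcon
  push Not at hcon
  have hn0 : (0 : ℝ) < n := by exact_mod_cast hn
  have h1 := aux_bonf (fun i => Finset.univ.filter (fun z => N (f i) z)) (Finset.univ : Finset ι)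
  have h2 : ((Finset.univ : Finset ι).biUnion
      (fun i => Finset.univ.filter (fun z => N (f i) z))).card ≤ n := by
    simpa using Finset.card_le_univ ((Finset.univ : Finset ι).biUnion
      (fun i => Finset.univ.filter (fun z => N (f i) z)))
  have h1' : ∑ i : ι, ((Finset.univ.filter (fun z => N (f i) z)).card : ℝ) ≤ n +
      ∑ p ∈ (Finset.univ : Finset ι).offDiag,
        (((Finset.univ.filter (fun z => N (f p.1) z)) ∩
          (Finset.univ.filter (fun z => N (f p.2) z))).card : ℝ) := by
    exact_mod_cast h1.trans (Nat.add_le_add_right h2 _)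
  have h3 := Finset.sum_le_card_nsmul (Finset.univ : Finset ι).offDiag
    (fun p => (((Finset.univ.filter (fun z => N (f p.1) z)) ∩
          (Finset.univ.filter (fun z => N (f p.2) z))).card : ℝ)) ((1 / 1000 : ℝ) * n) (by
      intro p hp
      refine le_trans ?_ (hcon p.1 p.2 (Finset.mem_offDiag.1 hp).2.2).le
      norm_cast
      apply Finset.card_le_card
      intro w hw
      simp only [Finset.mem_inter, Finset.mem_filter, Finset.mem_univ, true_and] at hw ⊢
      exact ⟨hw.1, hNs _ _ hw.2⟩)
  have h4 := Finset.card_nsmul_le_sum (Finset.univ : Finset ι)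
    (fun i => ((Finset.univ.filter (fun z => N (f i) z)).card : ℝ)) _ (fun i _ => hNc (f i))
  rw [nsmul_eq_mul, Finset.offDiag_card, Finset.card_univ, hι] at h3
  rw [nsmul_eq_mul, Finset.card_univ, hι] at h4
  have e1 : ((5 * 5 - 5 : ℕ) : ℝ) = 20 := by norm_num
  have e2 : ((5 : ℕ) : ℝ) = 5 := by norm_num
  rw [e1] at h3
  rw [e2] at h4
  have h5 := h4.trans (h1'.trans (add_le_add_right h3 _))
  clear h1 h1' h2 h3 h4 hcon hNc
  nlinarith

/-- partitioning `V(H)` into at most four `(16,η)`-closed parts. -/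
theorem stmt_14 :
    ∃ δ₀ : ℝ, 0 < δ₀ ∧ ∀ ε γ : ℝ, 0 < ε → ε ≤ δ₀ → 0 < γ → γ ≤ δ₀ →
      ∃ η₀ : ℝ, 0 < η₀ ∧ ∀ η : ℝ, 0 < η → η ≤ η₀ →
        ∃ n₀ : ℕ, ∀ n : ℕ, n₀ ≤ n →
          ∀ H : Finset (Finset (Fin n)), Is3Graph n H →
            (∀ v : Fin n, (1 / 4 - 3 * γ) * n ≤ ((Ntilde H 1 (γ * ε) v).ncard : ℝ)) →
            ∃ d : ℕ, 1 ≤ d ∧ d ≤ 4 ∧ ∃ V : Fin d → Finset (Fin n),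
              (∀ i j, i ≠ j → Disjoint (V i) (V j)) ∧
              (Finset.univ.biUnion V = (Finset.univ : Finset (Fin n))) ∧
              (∀ i, ClosedOn H 16 η (V i) ∧ (1 / 4 - 4 * γ) * n ≤ ((V i).card : ℝ)) := by
  classical
  refine ⟨1 / 100, by norm_num, ?_⟩
  intro ε γ hε _ hγ hγ'
  set α := γ * ε with hαd
  have hα : 0 < α := by positivity
  have hμ : 0 < γ / 16 := by positivity
  obtain ⟨e4, he4, n4, p4⟩ := aux_both 1 1 le_rfl le_rfl (1 / 1000) α α α (by norm_num) hα hα hα 2 le_rfl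
  obtain ⟨e3, he3, n3, p3⟩ := aux_both 2 2 (by norm_num) (by norm_num) (γ / 16) e4 e4 α hμ he4 he4 hα 4 le_rfl
  obtain ⟨e2, he2, n2, p2⟩ := aux_both 4 4 (by norm_num) (by norm_num) (γ / 16) e3 e3 α hμ he3 he3 hα 8 le_rfl
  obtain ⟨e1, he1, n1, p1⟩ := aux_both 8 8 (by norm_num) (by norm_num) (γ / 16) e2 e2 α hμ he2 he2 hα 16 le_rfl
  obtain ⟨eA, heA, nA, pA⟩ := aux_both 1 8 (by norm_num) (by norm_num) (1 / 20) α e2 α (by norm_num) hα he2 hα 9 le_rfl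
  obtain ⟨eT, heT, nT, pT⟩ := aux_both 9 1 (by norm_num) (by norm_num) (1 / 20) eA α α (by norm_num) heA hα hα 16 (by norm_num)
  refine ⟨min e1 eT, by positivity, ?_⟩
  intro η hη hηle
  refine ⟨n4 + n3 + n2 + n1 + nA + nT + 1, ?_⟩
  intro n hn H _ hH
  have hn0 : 0 < n := by omega
  have hn0' : (0 : ℝ) < n := by exact_mod_cast hn0
  have hself : ∀ v, Close H 1 α v v := by
    intro v
    have h1 : (0 : ℝ) < ((Ntilde H 1 α v).ncard : ℝ) := by
      refine lt_of_lt_of_le ?_ (hH v)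
      apply mul_pos _ hn0'
      linarith
    have h2 : (Ntilde H 1 α v).Nonempty := by
      rw [← Set.ncard_pos (Set.toFinite _)]
      exact_mod_cast h1
    obtain ⟨y, hy⟩ := h2
    exact aux_close_self hy.2
  obtain ⟨p4a, p4b, -⟩ := p4 n (by omega) H hself
  obtain ⟨p3a, p3b, -⟩ := p3 n (by omega) H hself
  obtain ⟨p2a, p2b, -⟩ := p2 n (by omega) H hself
  obtain ⟨p1a, p1b, -⟩ := p1 n (by omega) H hself
  obtain ⟨pAa, -, -⟩ := pA n (by omega) H hself
  obtain ⟨pTa, pTb, -⟩ := pT n (by omega) H hself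
  have hNc : ∀ v, (1 / 4 - 3 * γ) * n ≤
      ((Finset.univ.filter (fun z => Close H 1 α v z)).card : ℝ) := by
    intro v
    refine (hH v).trans ?_
    rw [← Set.ncard_coe_finset]
    apply Nat.cast_le.2
    apply Set.ncard_le_ncard _ (Set.toFinite _)
    intro z hz
    simpa using hz.2
  have hη1 : η ≤ e1 := hηle.trans (min_le_left _ _)
  have hηT : η ≤ eT := hηle.trans (min_le_right _ _)
  -- the general step
  have step : ∀ (d : ℕ) (c : ℕ) (e : ℝ), 1 ≤ d → d ≤ 4 →
      (∀ x y, Close H 1 α x y → Close H c e x y) → (∀ x y, Close H c e x y → Close H 8 e2 x y) →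
      (∃ v : Fin d → Fin n, ∀ i j, i ≠ j → ¬ Close H c e (v i) (v j) ∧
        ((Finset.univ.filter (fun z => Close H c e (v i) z ∧ Close H c e z (v j))).card : ℝ)
          ≤ γ / 16 * n) →
      (∀ f : Fin (d + 1) → Fin n, ∃ i j, i ≠ j ∧ Close H c e (f i) (f j)) →
      ∃ d : ℕ, 1 ≤ d ∧ d ≤ 4 ∧ ∃ V : Fin d → Finset (Fin n),
              (∀ i j, i ≠ j → Disjoint (V i) (V j)) ∧
              (Finset.univ.biUnion V = (Finset.univ : Finset (Fin n))) ∧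
              (∀ i, ClosedOn H 16 η (V i) ∧ (1 / 4 - 4 * γ) * n ≤ ((V i).card : ℝ)) := by
    intro d c e hd hd' hup hdown ⟨v, hv⟩ hmax
    obtain ⟨V, hV1, hV2, hV3⟩ := aux_step γ hγ hγ' hn0 (fun x y => Close H 1 α x y)
      (fun x y => Close H c e x y) (fun x y => Close H 9 eA x y) (fun x y => Close H 16 η x y)
      hNc (fun x y h => aux_close_symm h) (fun x y h => aux_close_symm h)
      (fun x y h => aux_close_symm h) hup
      (fun x y h => aux_close_mono (p1b _ _ (hdown _ _ h)) hη1)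
      (fun x y h => aux_close_mono (pTb _ _ h) hηT)
      (fun x y h => pAa x y (h.trans (by
        norm_cast
        apply Finset.card_le_card
        intro w hw
        simp only [Finset.mem_filter, Finset.mem_univ, true_and] at hw ⊢
        exact ⟨hw.1, hdown _ _ hw.2⟩)))
      (fun x y h => aux_close_mono (pTa x y h) hηT)
      d hd hd' v (fun i j hij => (hv i j hij).1) (fun i j hij => (hv i j hij).2) hmax
    exact ⟨d, hd, hd', V, hV1, hV2, fun i => ⟨fun x hx y hy _ => (hV3 i).1 x hx y hy, (hV3 i).2⟩⟩
  by_cases h1 : ∀ f : Fin 2 → Fin n, ∃ i j, i ≠ j ∧ Close H 16 e1 (f i) (f j)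
  · refine ⟨1, le_rfl, by norm_num, fun _ => Finset.univ, ?_, ?_, ?_⟩
    · intro i j hij; exact absurd (Subsingleton.elim i j) hij
    · ext z; simp
    · intro i
      constructor
      · intro x _ y _ _
        obtain ⟨i, j, hij, hc⟩ := h1 ![x, y]
        apply aux_close_mono _ hη1
        fin_cases i <;> fin_cases j <;> simp at hij hc
        · exact hc
        · exact aux_close_symm hc
      · rw [Finset.card_univ, Fintype.card_fin]
        nlinarith
  push Not at h1
  obtain ⟨v2, hv2⟩ := h1
  by_cases h2 : ∀ f : Fin 3 → Fin n, ∃ i j, i ≠ j ∧ Close H 8 e2 (f i) (f j)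
  · refine step 2 8 e2 (by norm_num) (by norm_num)
      (fun x y h => p2b _ _ (p3b _ _ (p4b _ _ h))) (fun x y h => h) ⟨v2, fun i j hij => ?_⟩ h2
    refine ⟨fun h => hv2 i j hij (p1b _ _ h), ?_⟩
    by_contra h
    push Not at h
    exact hv2 i j hij (p1a _ _ h.le)
  push Not at h2
  obtain ⟨v3, hv3⟩ := h2
  by_cases h3 : ∀ f : Fin 4 → Fin n, ∃ i j, i ≠ j ∧ Close H 4 e3 (f i) (f j)
  · refine step 3 4 e3 (by norm_num) (by norm_num)
      (fun x y h => (p3b _ _ (p4b _ _ h))) (fun x y h => p2b _ _ h) ⟨v3, fun i j hij => ?_⟩ h3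
    refine ⟨fun h => hv3 i j hij (p2b _ _ h), ?_⟩
    by_contra h
    push Not at h
    exact hv3 i j hij (p2a _ _ h.le)
  push Not at h3
  obtain ⟨v4, hv4⟩ := h3
  refine step 4 2 e4 (by norm_num) (by norm_num)
      (fun x y h => (p4b _ _ h)) (fun x y h => p2b _ _ (p3b _ _ h)) ⟨v4, fun i j hij => ?_⟩ ?_
  · refine ⟨fun h => hv4 i j hij (p3b _ _ h), ?_⟩
    by_contra h
    push Not at h
    exact hv4 i j hij (p3a _ _ h.le)
  · intro f
    obtain ⟨i, j, hij, h⟩ := aux_five (Fintype.card_fin 5) γ hγ' hn0 (fun x y => Close H 1 α x y) hNc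
      (fun x y h => aux_close_symm h) f
    exact ⟨i, j, hij, p4a _ _ h⟩
end

section
/- Whenever constants satisfy the hierarchy 0 < 1/n ≪ η' ≪ ε, η ≪ γ ≪ 1/c with c ∈ ℕ, the following holds: let H be a 3-graph on n vertices with δ₂(H) ≥ (1/2 − γ)n. Suppose there is a partition 𝒫 = {V₁,...,V_d} of V(H) with 2 ≤ d ≤ 4 such that each Vᵢ is (c,η)-closed in H and |Vᵢ| ≥ (1/4 − 4γ)n. Suppose further that there are (not necessarily distinct) indices i₁,i₂,i₃,i₄ ∈ [d] with {i₁,i₂} ∩ {i₃,i₄} = ∅ such that at least εn⁴ copies of K₄⁻ in H are of type V_{i₁}V_{i₂}V_{i₃}V_{i₄}. Then there exist distinct i, j ∈ [d] such that Vᵢ ∪ V_j is (3c+1, η')-closed in H. -/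
open Finset

namespace St15
open Classical

noncomputable def ind (P : Prop) : ℝ := if P then 1 else 0

lemma ind_t {P : Prop} (h : P) : ind P = 1 := by simp [ind, h]
lemma ind_f {P : Prop} (h : ¬P) : ind P = 0 := by simp [ind, h]
lemma ind_nn (P : Prop) : 0 ≤ ind P := by unfold ind; split_ifs <;> norm_num
lemma ind_le (P : Prop) : ind P ≤ 1 := by unfold ind; split_ifs <;> norm_num
lemma ind_mono {P Q : Prop} (h : P → Q) : ind P ≤ ind Q := by
  by_cases hp : P
  · rw [ind_t hp, ind_t (h hp)]
  · rw [ind_f hp]; exact ind_nn _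

noncomputable def cnt {n : ℕ} (P : Fin n → Prop) : ℝ := ∑ e, ind (P e)

section cnt
variable {n : ℕ} {P Q R : Fin n → Prop}

lemma cnt_eq_card (P : Fin n → Prop) : cnt P = ((univ.filter P).card : ℝ) := by
  simp [cnt, ind]

lemma cnt_nn (P : Fin n → Prop) : 0 ≤ cnt P := sum_nonneg fun _ _ => ind_nn _
lemma cnt_mono (h : ∀ e, P e → Q e) : cnt P ≤ cnt Q := sum_le_sum fun e _ => ind_mono (h e)
lemma cnt_true : cnt (fun _ : Fin n => True) = n := by simp [cnt, ind]
lemma cnt_le (P : Fin n → Prop) : cnt P ≤ n := by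
  rw [← cnt_true]; exact cnt_mono fun _ _ => trivial
lemma cnt_or (P Q : Fin n → Prop) : cnt (fun e => P e ∨ Q e) ≤ cnt P + cnt Q := by
  unfold cnt; rw [← sum_add_distrib]; refine sum_le_sum fun e _ => ?_
  by_cases hp : P e
  · rw [ind_t hp]; have := ind_le (P e ∨ Q e); have := ind_nn (Q e); linarith
  · rw [ind_f hp, zero_add]; exact ind_mono (by tauto)
lemma cnt_split (P Q : Fin n → Prop) :
    cnt P = cnt (fun e => P e ∧ Q e) + cnt (fun e => P e ∧ ¬ Q e) := by
  unfold cnt; rw [← sum_add_distrib]; refine sum_congr rfl fun e _ => ?_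
  by_cases hp : P e <;> by_cases hq : Q e <;> simp [ind, hp, hq]
lemma cnt_cover (h : ∀ e, P e → Q e ∨ R e) : cnt P ≤ cnt Q + cnt R :=
  (cnt_mono h).trans (cnt_or _ _)
lemma exists_avoid (h : cnt Q < cnt P) : ∃ e, P e ∧ ¬ Q e := by
  by_contra hc; push Not at hc
  exact absurd (cnt_mono hc) (not_le.mpr h)

/-- Markov style: double counting. -/
lemma cnt_swap (A B : Fin n → Prop) (R : Fin n → Fin n → Prop) :
    ∑ a, ind (A a) * cnt (fun b => R a b ∧ B b) = ∑ b, ind (B b) * cnt (fun a => R a b ∧ A a) := by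
  unfold cnt; simp_rw [mul_sum]; rw [sum_comm]
  refine sum_congr rfl fun b _ => sum_congr rfl fun a _ => ?_
  by_cases h1 : A a <;> by_cases h2 : B b <;> by_cases h3 : R a b <;> simp [ind, h1, h2, h3]

lemma markov (A : Fin n → Prop) (f : Fin n → ℝ) (hf : ∀ a, 0 ≤ f a) (t s : ℝ)
    (hs : ∑ a, ind (A a) * f a ≤ t * s) (ht : 0 < t) : cnt (fun a => A a ∧ t < f a) ≤ s := by
  have : t * cnt (fun a => A a ∧ t < f a) ≤ ∑ a, ind (A a) * f a := by
    unfold cnt; rw [mul_sum]; refine sum_le_sum fun a _ => ?_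
    by_cases h1 : A a
    · by_cases h2 : t < f a
      · simp [ind, h1, h2]; exact h2.le
      · simp [ind, h1, h2]; exact hf a
    · simp [ind, h1]
  exact le_of_mul_le_mul_left (this.trans hs) ht

end cnt

structure Sys (n d : ℕ) where
  E : Fin n → Fin n → Fin n → Prop
  K : Fin n → Fin n → Fin n → Fin n → Prop
  Ks : Fin n → Fin n → Fin n → Fin n → Prop
  p : Fin n → Fin d
  m : ℝ
  E12 : ∀ {x y z}, E x y z → E y x z
  E23 : ∀ {x y z}, E x y z → E x z y
  Ene : ∀ {x y z}, E x y z → x ≠ y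
  K12 : ∀ {x y z w}, K x y z w → K y x z w
  K23 : ∀ {x y z w}, K x y z w → K x z y w
  K34 : ∀ {x y z w}, K x y z w → K x y w z
  S12 : ∀ {x y z w}, Ks x y z w → Ks y x z w
  S23 : ∀ {x y z w}, Ks x y z w → Ks x z y w
  S34 : ∀ {x y z w}, Ks x y z w → Ks x y w z
  Kne : ∀ {x y z w}, K x y z w → x ≠ y
  EK : ∀ {x y z w}, E x y z → E x y w → E x z w → K x y z w
  KE : ∀ {x y z w}, K x y z w → (E x y z ∧ E x y w ∧ E x z w) ∨ (E x y z ∧ E x y w ∧ E y z w) ∨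
    (E x y z ∧ E x z w ∧ E y z w) ∨ (E x y w ∧ E x z w ∧ E y z w)
  SK : ∀ {x y z w}, Ks x y z w → K x y z w
  cons : ∀ {x y z w z' w'}, Ks x y z w → Ks x y z' w' → p z = p z' → p w = p w'
  hm : 0 < m
  hN : (n : ℝ) = 10 ^ 7 * m
  codeg : ∀ {x y}, x ≠ y → n / 2 - m ≤ cnt (E x y)
  part : ∀ x, n / 4 - 4 * m ≤ cnt (fun e => p e = p x)

namespace Sys
variable {n d : ℕ} (S : Sys n d)

def exc (x y z e : Fin n) : Prop := S.K x y z e ∧ ¬ S.Ks x y z e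
def bad3 (x y z : Fin n) : Prop := S.m < cnt (S.exc x y z)
def bad2 (x y : Fin n) : Prop := S.m < cnt (S.bad3 x y)
def bad1 (x : Fin n) : Prop := S.m < cnt (S.bad2 x)

variable {S}
lemma E13 {x y z} (h : S.E x y z) : S.E z y x := S.E12 (S.E23 (S.E12 h))
lemma Erot {x y z} (h : S.E x y z) : S.E y z x := S.E23 (S.E12 h)
lemma Erot' {x y z} (h : S.E x y z) : S.E z x y := S.E12 (S.E23 h)
lemma Ene13 {x y z} (h : S.E x y z) : x ≠ z := S.Ene (S.E23 h)
lemma Ene23 {x y z} (h : S.E x y z) : y ≠ z := S.Ene (Erot h)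

lemma exc12 {x y z e} : S.exc x y z e ↔ S.exc y x z e :=
  ⟨fun h => ⟨S.K12 h.1, fun h' => h.2 (S.S12 h')⟩, fun h => ⟨S.K12 h.1, fun h' => h.2 (S.S12 h')⟩⟩
lemma exc23 {x y z e} : S.exc x y z e ↔ S.exc x z y e :=
  ⟨fun h => ⟨S.K23 h.1, fun h' => h.2 (S.S23 h')⟩, fun h => ⟨S.K23 h.1, fun h' => h.2 (S.S23 h')⟩⟩
lemma bad3_12 {x y z} : S.bad3 x y z ↔ S.bad3 y x z := by
  unfold bad3; rw [show S.exc x y z = S.exc y x z from funext fun e => propext exc12]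
lemma bad3_23 {x y z} : S.bad3 x y z ↔ S.bad3 x z y := by
  unfold bad3; rw [show S.exc x y z = S.exc x z y from funext fun e => propext exc23]
lemma bad2_12 {x y} : S.bad2 x y ↔ S.bad2 y x := by
  unfold bad2; rw [show S.bad3 x y = S.bad3 y x from funext fun e => propext bad3_12]
lemma cexc {x y z} (h : ¬ S.bad3 x y z) : cnt (S.exc x y z) ≤ S.m := not_lt.mp h
lemma cbad3 {x y} (h : ¬ S.bad2 x y) : cnt (S.bad3 x y) ≤ S.m := not_lt.mp h
lemma cbad2 {x} (h : ¬ S.bad1 x) : cnt (S.bad2 x) ≤ S.m := not_lt.mp h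

/-- for a non-edge: three link edges give a copy -/
lemma tri2 {x y z e} (h : ¬ S.K x y z e) :
    ind (S.E x y e) + ind (S.E x z e) + ind (S.E y z e) ≤ 2 := by
  have hh : ¬ (S.E x y e ∧ S.E x z e ∧ S.E y z e) := by
    rintro ⟨a, b, c⟩
    have := S.EK (Erot' a) (Erot' b) (Erot' c)
    exact h (S.K34 (S.K23 (S.K12 this)))
  by_cases a : S.E x y e <;> by_cases b : S.E x z e <;> by_cases c : S.E y z e <;>
    simp_all [ind] <;> norm_num

lemma Kof {x y z e} (hE : S.E x y z)
    (h : (S.E x y e ∧ S.E x z e) ∨ (S.E x y e ∧ S.E y z e) ∨ (S.E x z e ∧ S.E y z e)) :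
    S.K x y z e := by
  rcases h with ⟨a, b⟩ | ⟨a, b⟩ | ⟨a, b⟩
  · exact S.EK hE a b
  · exact S.K12 (S.EK (S.E12 hE) (S.E12 a) b)
  · exact S.K23 (S.K12 (S.EK (Erot' hE) (S.E12 a) (S.E12 b)))

lemma tri {x y z e} (hE : S.E x y z) (h : ¬ S.K x y z e) :
    ind (S.E x y e) + ind (S.E x z e) + ind (S.E y z e) ≤ 1 := by
  have hh := mt (Kof hE) h
  by_cases a : S.E x y e <;> by_cases b : S.E x z e <;> by_cases c : S.E y z e <;>
    simp_all [ind]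

/-- target: a non-exceptional extension outside the target part is impossible. -/
lemma notK {x y z w e} (h : S.Ks x y z w) (he : ¬ S.exc x y z e) (hp : S.p e ≠ S.p w) :
    ¬ S.K x y z e := by
  intro hK
  have : S.Ks x y z e := by by_contra h'; exact he ⟨hK, h'⟩
  exact hp (S.cons this h rfl)

lemma ext {x y z} (hE : S.E x y z) (hb : ¬ S.bad3 x y z) : ∃ e, S.Ks x y z e := by
  by_contra hc; push Not at hc
  have hpt : ∀ e, ind (S.E x y e) + ind (S.E x z e) + ind (S.E y z e) ≤ 1 + 2 * ind (S.exc x y z e) := by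
    intro e
    by_cases hK : S.K x y z e
    · rw [ind_t (show S.exc x y z e from ⟨hK, hc e⟩)]
      linarith [ind_le (S.E x y e), ind_le (S.E x z e), ind_le (S.E y z e)]
    · linarith [tri hE hK, ind_nn (S.exc x y z e)]
  have := sum_le_sum fun e (_ : e ∈ univ) => hpt e
  simp only [sum_add_distrib, ← mul_sum] at this
  have h1 := S.codeg (S.Ene hE); have h2 := S.codeg (Ene13 hE); have h3 := S.codeg (Ene23 hE)
  have h4 := cexc hb
  have h5 := S.hN; have h6 := S.hm
  simp only [cnt] at h1 h2 h3 h4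
  simp at this
  linarith

end Sys
end St15
namespace St15
open Classical
namespace Sys
variable {n d : ℕ} {S : Sys n d}

lemma S_124 {x y z w} (h : S.Ks x y z w) : S.Ks x y w z := S.S34 h
lemma S_134 {x y z w} (h : S.Ks x y z w) : S.Ks x z w y := S.S34 (S.S23 h)
lemma S_234 {x y z w} (h : S.Ks x y z w) : S.Ks y z w x := S.S34 (S.S23 (S.S12 h))

lemma codeg6 {x1 x2 x3 x4 : Fin n} (hK : S.K x1 x2 x3 x4) :
    3 * (n : ℝ) - 6 * S.m ≤ cnt (S.E x1 x2) + cnt (S.E x1 x3) + cnt (S.E x1 x4) + cnt (S.E x2 x3)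
      + cnt (S.E x2 x4) + cnt (S.E x3 x4) := by
  have n12 := S.Kne hK
  have n13 := S.Kne (S.K23 hK)
  have n14 := S.Kne (S.K23 (S.K34 hK))
  have n23 := S.Kne (S.K23 (S.K12 hK))
  have n24 := S.Kne (S.K23 (S.K34 (S.K12 hK)))
  have n34 := S.Kne (S.K12 (S.K23 (S.K34 (S.K12 (S.K23 hK)))))
  have := S.codeg n12; have := S.codeg n13; have := S.codeg n14
  have := S.codeg n23; have := S.codeg n24; have := S.codeg n34.symm
  have := S.codeg n34
  linarith

lemma XZ (A B C D F : Prop) : ind (F ∧ (A ∨ B)) + ind (¬ (A ∨ B ∨ C ∨ D)) ≤ 1 := by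
  by_cases h : A ∨ B
  · rw [ind_f (show ¬ ¬ (A ∨ B ∨ C ∨ D) by tauto)]; linarith [ind_le (F ∧ (A ∨ B))]
  · rw [ind_f (show ¬ (F ∧ (A ∨ B)) by tauto)]; linarith [ind_le (¬ (A ∨ B ∨ C ∨ D))]

lemma L43 {x1 x2 x3 x4 : Fin n} (hK : S.Ks x1 x2 x3 x4)
    (e123 : S.E x1 x2 x3) (e124 : S.E x1 x2 x4) (e134 : S.E x1 x3 x4) (e234 : S.E x2 x3 x4)
    (b123 : ¬ S.bad3 x1 x2 x3) (b124 : ¬ S.bad3 x1 x2 x4) (b134 : ¬ S.bad3 x1 x3 x4)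
    (b234 : ¬ S.bad3 x2 x3 x4)
    (h13 : S.p x1 ≠ S.p x3) (h14 : S.p x1 ≠ S.p x4) (h23 : S.p x2 ≠ S.p x3)
    (h24 : S.p x2 ≠ S.p x4) :
    cnt (fun e => S.E x1 x2 e ∧ (S.p e = S.p x1 ∨ S.p e = S.p x2)) +
    cnt (fun e => ¬ (S.p e = S.p x1 ∨ S.p e = S.p x2 ∨ S.p e = S.p x3 ∨ S.p e = S.p x4)) ≤
      22 * S.m := by
  have hpt : ∀ e, ind (S.E x1 x2 e) + ind (S.E x1 x3 e) + ind (S.E x1 x4 e) + ind (S.E x2 x3 e)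
      + ind (S.E x2 x4 e) + ind (S.E x3 x4 e)
      + ind (S.E x1 x2 e ∧ (S.p e = S.p x1 ∨ S.p e = S.p x2))
      + ind (¬ (S.p e = S.p x1 ∨ S.p e = S.p x2 ∨ S.p e = S.p x3 ∨ S.p e = S.p x4)) ≤
      3 + 4 * (ind (S.exc x1 x2 x3 e) + ind (S.exc x1 x2 x4 e) + ind (S.exc x1 x3 x4 e)
        + ind (S.exc x2 x3 x4 e)) := by
    intro e
    have l12 := ind_le (S.E x1 x2 e); have l13 := ind_le (S.E x1 x3 e)
    have l14 := ind_le (S.E x1 x4 e); have l23 := ind_le (S.E x2 x3 e)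
    have l24 := ind_le (S.E x2 x4 e); have l34 := ind_le (S.E x3 x4 e)
    have lXZ := XZ (S.p e = S.p x1) (S.p e = S.p x2) (S.p e = S.p x3) (S.p e = S.p x4) (S.E x1 x2 e)
    have g1 := ind_nn (S.exc x1 x2 x3 e); have g2 := ind_nn (S.exc x1 x2 x4 e)
    have g3 := ind_nn (S.exc x1 x3 x4 e); have g4 := ind_nn (S.exc x2 x3 x4 e)
    by_cases q1 : S.exc x1 x2 x3 e
    · have := ind_t q1; linarith
    by_cases q2 : S.exc x1 x2 x4 e
    · have := ind_t q2; linarith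
    by_cases q3 : S.exc x1 x3 x4 e
    · have := ind_t q3; linarith
    by_cases q4 : S.exc x2 x3 x4 e
    · have := ind_t q4; linarith
    have t1 := fun h => tri e123 (notK hK q1 h)
    have t2 := fun h => tri e124 (notK (S_124 hK) q2 h)
    have t3 := fun h => tri e134 (notK (S_134 hK) q3 h)
    have t4 := fun h => tri e234 (notK (S_234 hK) q4 h)
    by_cases hX : S.p e = S.p x1 ∨ S.p e = S.p x2
    · rw [ind_f (show ¬ ¬ (S.p e = S.p x1 ∨ S.p e = S.p x2 ∨ S.p e = S.p x3 ∨ S.p e = S.p x4) by tauto)]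
      have k3 : S.p e ≠ S.p x3 := by rcases hX with h | h <;> rw [h] <;> assumption
      have k4 : S.p e ≠ S.p x4 := by rcases hX with h | h <;> rw [h] <;> assumption
      have := t1 k4; have := t2 k3
      have := ind_mono (show S.E x1 x2 e ∧ (S.p e = S.p x1 ∨ S.p e = S.p x2) → S.E x1 x2 e from And.left)
      linarith
    · rw [ind_f (show ¬ (S.E x1 x2 e ∧ (S.p e = S.p x1 ∨ S.p e = S.p x2)) by tauto)]
      push Not at hX
      have := t3 hX.2; have := t4 hX.1
      by_cases hY : S.p e = S.p x3 ∨ S.p e = S.p x4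
      · rw [ind_f (show ¬ ¬ (S.p e = S.p x1 ∨ S.p e = S.p x2 ∨ S.p e = S.p x3 ∨ S.p e = S.p x4) by tauto)]
        linarith [ind_nn (S.E x3 x4 e)]
      · push Not at hY
        have := t1 hY.2; have := t2 hY.1
        linarith [ind_le (¬ (S.p e = S.p x1 ∨ S.p e = S.p x2 ∨ S.p e = S.p x3 ∨ S.p e = S.p x4))]
  have hs := sum_le_sum fun e (_ : e ∈ univ) => hpt e
  simp only [sum_add_distrib, ← mul_sum] at hs
  have h1 := codeg6 (S.SK hK)
  have h2 := cexc b123; have h3 := cexc b124; have h4 := cexc b134; have h5 := cexc b234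
  simp only [cnt] at h1 h2 h3 h4 h5 ⊢
  simp only [sum_const, card_univ, Fintype.card_fin, nsmul_eq_mul] at hs
  linarith

lemma ind_nat (P : Prop) : ∃ k : ℕ, ind P = k := by
  by_cases h : P
  · exact ⟨1, by simp [ind_t h]⟩
  · exact ⟨0, by simp [ind_f h]⟩

lemma int7 (A B C D F G : Prop) (h : 2 * (ind A + ind B + ind C + ind D + ind F + ind G) ≤ 7) :
    ind A + ind B + ind C + ind D + ind F + ind G ≤ 3 := by
  obtain ⟨a, ha⟩ := ind_nat A; obtain ⟨b, hb⟩ := ind_nat B; obtain ⟨c, hc⟩ := ind_nat C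
  obtain ⟨d, hd⟩ := ind_nat D; obtain ⟨f, hf⟩ := ind_nat F; obtain ⟨g, hg⟩ := ind_nat G
  rw [ha, hb, hc, hd, hf, hg] at h ⊢
  norm_cast at h ⊢; omega

lemma int5 (A B C D F G : Prop) (h : 2 * (ind A + ind B + ind C + ind D + ind F + ind G) ≤ 5) :
    ind A + ind B + ind C + ind D + ind F + ind G ≤ 2 := by
  obtain ⟨a, ha⟩ := ind_nat A; obtain ⟨b, hb⟩ := ind_nat B; obtain ⟨c, hc⟩ := ind_nat C
  obtain ⟨d, hd⟩ := ind_nat D; obtain ⟨f, hf⟩ := ind_nat F; obtain ⟨g, hg⟩ := ind_nat G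
  rw [ha, hb, hc, hd, hf, hg] at h ⊢
  norm_cast at h ⊢; omega

structure LH (S : Sys n d) (x1 x2 x3 x4 : Fin n) : Prop where
  hK : S.Ks x1 x2 x3 x4
  e123 : S.E x1 x2 x3
  e124 : S.E x1 x2 x4
  b123 : ¬ S.bad3 x1 x2 x3
  b124 : ¬ S.bad3 x1 x2 x4
  b134 : ¬ S.bad3 x1 x3 x4
  b234 : ¬ S.bad3 x2 x3 x4
  b12 : ¬ S.bad2 x1 x2
  b13 : ¬ S.bad2 x1 x3
  b14 : ¬ S.bad2 x1 x4
  b23 : ¬ S.bad2 x2 x3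
  b24 : ¬ S.bad2 x2 x4
  h13 : S.p x1 ≠ S.p x3
  h14 : S.p x1 ≠ S.p x4
  h23 : S.p x2 ≠ S.p x3
  h24 : S.p x2 ≠ S.p x4

lemma L {x1 x2 x3 x4 : Fin n} (h : S.LH x1 x2 x3 x4) :
    cnt (fun e => S.E x1 x2 e ∧ (S.p e = S.p x1 ∨ S.p e = S.p x2)) +
    cnt (fun e => ¬ (S.p e = S.p x1 ∨ S.p e = S.p x2 ∨ S.p e = S.p x3 ∨ S.p e = S.p x4)) ≤
      42 * S.m := by
  obtain ⟨hK, e123, e124, b123, b124, b134, b234, b12, b13, b14, b23, b24, h13, h14, h23, h24⟩ := h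
  have hm := S.hm
  -- replacement of x4
  by_cases r4 : ∃ e, S.Ks x1 x2 x3 e ∧ S.p e = S.p x4 ∧ S.E x1 x2 e ∧ S.E x1 x3 e ∧ S.E x2 x3 e ∧
      ¬ S.bad3 x1 x2 e ∧ ¬ S.bad3 x1 x3 e ∧ ¬ S.bad3 x2 x3 e
  · obtain ⟨e, k, pe, a, b, c, b1, b2, b3⟩ := r4
    have := L43 k e123 a b c b123 b1 b2 b3 h13 (pe ▸ h14) h23 (pe ▸ h24)
    rw [pe] at this
    linarith
  by_cases r3 : ∃ e, S.Ks x1 x2 x4 e ∧ S.p e = S.p x3 ∧ S.E x1 x2 e ∧ S.E x1 x4 e ∧ S.E x2 x4 e ∧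
      ¬ S.bad3 x1 x2 e ∧ ¬ S.bad3 x1 x4 e ∧ ¬ S.bad3 x2 x4 e
  · obtain ⟨e, k, pe, a, b, c, b1, b2, b3⟩ := r3
    have := L43 k e124 a b c b124 b1 b2 b3 h14 (pe ▸ h13) h24 (pe ▸ h23)
    rw [pe] at this
    have h2 : cnt (fun e => ¬ (S.p e = S.p x1 ∨ S.p e = S.p x2 ∨ S.p e = S.p x3 ∨ S.p e = S.p x4)) ≤
      cnt (fun e => ¬ (S.p e = S.p x1 ∨ S.p e = S.p x2 ∨ S.p e = S.p x4 ∨ S.p e = S.p x3)) :=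
      cnt_mono fun e => by tauto
    linarith
  have hpt : ∀ e, ind (S.E x1 x2 e) + ind (S.E x1 x3 e) + ind (S.E x1 x4 e) + ind (S.E x2 x3 e)
      + ind (S.E x2 x4 e) + ind (S.E x3 x4 e)
      + ind (S.E x1 x2 e ∧ (S.p e = S.p x1 ∨ S.p e = S.p x2))
      + ind (¬ (S.p e = S.p x1 ∨ S.p e = S.p x2 ∨ S.p e = S.p x3 ∨ S.p e = S.p x4)) ≤
      3 + 4 * (ind (S.exc x1 x2 x3 e) + ind (S.exc x1 x2 x4 e) + ind (S.exc x1 x3 x4 e)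
        + ind (S.exc x2 x3 x4 e) + ind (S.bad3 x1 x2 e) + ind (S.bad3 x1 x3 e) + ind (S.bad3 x2 x3 e)
        + ind (S.bad3 x1 x4 e) + ind (S.bad3 x2 x4 e)) := by
    intro e
    have l12 := ind_le (S.E x1 x2 e); have l13 := ind_le (S.E x1 x3 e)
    have l14 := ind_le (S.E x1 x4 e); have l23 := ind_le (S.E x2 x3 e)
    have l24 := ind_le (S.E x2 x4 e); have l34 := ind_le (S.E x3 x4 e)
    have lXZ := XZ (S.p e = S.p x1) (S.p e = S.p x2) (S.p e = S.p x3) (S.p e = S.p x4) (S.E x1 x2 e)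
    have g1 := ind_nn (S.exc x1 x2 x3 e); have g2 := ind_nn (S.exc x1 x2 x4 e)
    have g3 := ind_nn (S.exc x1 x3 x4 e); have g4 := ind_nn (S.exc x2 x3 x4 e)
    have g5 := ind_nn (S.bad3 x1 x2 e); have g6 := ind_nn (S.bad3 x1 x3 e)
    have g7 := ind_nn (S.bad3 x2 x3 e); have g8 := ind_nn (S.bad3 x1 x4 e)
    have g9 := ind_nn (S.bad3 x2 x4 e)
    by_cases q1 : S.exc x1 x2 x3 e
    · have := ind_t q1; linarith
    by_cases q2 : S.exc x1 x2 x4 e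
    · have := ind_t q2; linarith
    by_cases q3 : S.exc x1 x3 x4 e
    · have := ind_t q3; linarith
    by_cases q4 : S.exc x2 x3 x4 e
    · have := ind_t q4; linarith
    by_cases q5 : S.bad3 x1 x2 e
    · have := ind_t q5; linarith
    by_cases q6 : S.bad3 x1 x3 e
    · have := ind_t q6; linarith
    by_cases q7 : S.bad3 x2 x3 e
    · have := ind_t q7; linarith
    by_cases q8 : S.bad3 x1 x4 e
    · have := ind_t q8; linarith
    by_cases q9 : S.bad3 x2 x4 e
    · have := ind_t q9; linarith
    have t1 := fun h => tri e123 (notK hK q1 h)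
    have t2 := fun h => tri e124 (notK (S_124 hK) q2 h)
    by_cases hX : S.p e = S.p x1 ∨ S.p e = S.p x2
    · rw [ind_f (show ¬ ¬ (S.p e = S.p x1 ∨ S.p e = S.p x2 ∨ S.p e = S.p x3 ∨ S.p e = S.p x4) by tauto)]
      have k3 : S.p e ≠ S.p x3 := by rcases hX with h | h <;> rw [h] <;> assumption
      have k4 : S.p e ≠ S.p x4 := by rcases hX with h | h <;> rw [h] <;> assumption
      have := t1 k4; have := t2 k3
      have := ind_mono (show S.E x1 x2 e ∧ (S.p e = S.p x1 ∨ S.p e = S.p x2) → S.E x1 x2 e from And.left)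
      linarith
    · rw [ind_f (show ¬ (S.E x1 x2 e ∧ (S.p e = S.p x1 ∨ S.p e = S.p x2)) by tauto)]
      push Not at hX
      -- the two triangles containing x3 x4
      have key : (ind (S.E x1 x3 e) + ind (S.E x1 x4 e) + ind (S.E x3 x4 e)) +
          (ind (S.E x2 x3 e) + ind (S.E x2 x4 e) + ind (S.E x3 x4 e)) ≤ 3 := by
        have k3 := notK (S_134 hK) q3 hX.2
        have k4 := notK (S_234 hK) q4 hX.1
        have h := S.KE (S.SK hK)
        by_cases e134 : S.E x1 x3 x4
        · have := tri e134 k3; have := tri2 k4; linarith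
        · have e234 : S.E x2 x3 x4 := by tauto
          have := tri e234 k4; have := tri2 k3; linarith
      by_cases hY : S.p e = S.p x3 ∨ S.p e = S.p x4
      · rw [ind_f (show ¬ ¬ (S.p e = S.p x1 ∨ S.p e = S.p x2 ∨ S.p e = S.p x3 ∨ S.p e = S.p x4) by tauto)]
        have i2 : ∀ A B C : Prop, ¬ (A ∧ B ∧ C) → ind A + ind B + ind C ≤ 2 := by
          intro A B C
          by_cases A <;> by_cases B <;> by_cases C <;> simp_all [ind] <;> norm_num
        have s1 : ind (S.E x1 x2 e) + ind (S.E x1 x3 e) + ind (S.E x2 x3 e) ≤ 2 := by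
          by_cases k : S.p e = S.p x4
          · refine i2 _ _ _ fun ⟨a, b, c⟩ => r4 ⟨e, ?_, k, a, b, c, q5, q6, q7⟩
            by_contra hc
            exact q1 ⟨Kof e123 (Or.inl ⟨a, b⟩), hc⟩
          · linarith [t1 k]
        have s2 : ind (S.E x1 x2 e) + ind (S.E x1 x4 e) + ind (S.E x2 x4 e) ≤ 2 := by
          by_cases k : S.p e = S.p x3
          · refine i2 _ _ _ fun ⟨a, b, c⟩ => r3 ⟨e, ?_, k, a, b, c, q5, q8, q9⟩
            by_contra hc
            exact q2 ⟨Kof e124 (Or.inl ⟨a, b⟩), hc⟩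
          · linarith [t2 k]
        have := int7 (S.E x1 x2 e) (S.E x1 x3 e) (S.E x1 x4 e) (S.E x2 x3 e) (S.E x2 x4 e) (S.E x3 x4 e)
          (by linarith)
        linarith
      · push Not at hY
        have := t1 hY.2; have := t2 hY.1
        have := int5 (S.E x1 x2 e) (S.E x1 x3 e) (S.E x1 x4 e) (S.E x2 x3 e) (S.E x2 x4 e) (S.E x3 x4 e)
          (by linarith)
        linarith [ind_le (¬ (S.p e = S.p x1 ∨ S.p e = S.p x2 ∨ S.p e = S.p x3 ∨ S.p e = S.p x4))]
  have hs := sum_le_sum fun e (_ : e ∈ univ) => hpt e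
  simp only [sum_add_distrib, ← mul_sum] at hs
  have h1 := codeg6 (S.SK hK)
  have h2 := cexc b123; have h3 := cexc b124; have h4 := cexc b134; have h5 := cexc b234
  have h6 := cbad3 b12; have h7 := cbad3 b13; have h8 := cbad3 b23
  have h9 := cbad3 b14; have h10 := cbad3 b24
  simp only [cnt] at h1 h2 h3 h4 h5 h6 h7 h8 h9 h10 ⊢
  simp only [sum_const, card_univ, Fintype.card_fin, nsmul_eq_mul] at hs
  linarith

end Sys
end St15
namespace St15
open Classical
namespace Sys
variable {n d : ℕ} {S : Sys n d}

lemma nb12 {x y z} (h : ¬ S.bad3 x y z) : ¬ S.bad3 y x z := fun h' => h (bad3_12.1 h')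
lemma nb23 {x y z} (h : ¬ S.bad3 x y z) : ¬ S.bad3 x z y := fun h' => h (bad3_23.1 h')
lemma np12 {x y} (h : ¬ S.bad2 x y) : ¬ S.bad2 y x := fun h' => h (bad2_12.1 h')

def inX (S : Sys n d) (x y e : Fin n) : Prop := S.p e = S.p x ∨ S.p e = S.p y
lemma inX_comm (x y : Fin n) : S.inX x y = S.inX y x := by
  funext e; unfold inX; exact propext or_comm

structure Base (S : Sys n d) (x1 x2 x3 x4 : Fin n) : Prop where
  lh : S.LH x1 x2 x3 x4
  b34 : ¬ S.bad2 x3 x4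
  b1 : ¬ S.bad1 x1
  b2 : ¬ S.bad1 x2
  hb : cnt S.bad1 ≤ S.m
  m1 : 1 ≤ S.m

lemma Base.swap {x1 x2 x3 x4 : Fin n} (h : S.Base x1 x2 x3 x4) : S.Base x2 x1 x3 x4 := by
  obtain ⟨⟨hK, e123, e124, b123, b124, b134, b234, b12, b13, b14, b23, b24, h13, h14, h23, h24⟩,
    b34, b1, b2, hb, m1⟩ := h
  exact ⟨⟨S.S12 hK, S.E12 e123, S.E12 e124, nb12 b123, nb12 b124, b234, b134, np12 b12, b23, b24,
    b13, b14, h23, h24, h13, h14⟩, b34, b2, b1, hb, m1⟩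

lemma SX0 {x1 x2 x3 x4 : Fin n} (B : S.Base x1 x2 x3 x4) (e134 : S.E x1 x3 x4) :
    n / 2 - 23 * S.m ≤ cnt (S.inX x1 x2) := by
  obtain ⟨⟨hK, e123, e124, b123, b124, b134, b234, b12, b13, b14, b23, b24, h13, h14, h23, h24⟩,
    b34, b1, b2, hb, m1⟩ := B
  have hm := S.hm
  by_cases r : ∃ e, S.Ks x1 x3 x4 e ∧ S.E x1 x3 e ∧ S.E x1 x4 e ∧ S.E x3 x4 e ∧
      ¬ S.bad3 x1 x3 e ∧ ¬ S.bad3 x1 x4 e ∧ ¬ S.bad3 x3 x4 e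
  · obtain ⟨e, k, a, b, c, q1, q2, q3⟩ := r
    have pe : S.p e = S.p x2 := S.cons k (S_134 hK) rfl
    have := L43 (x1 := x3) (x2 := x4) (x3 := x1) (x4 := e) (S.S23 (S.S12 k)) (Erot e134) c (S.E12 a) (S.E12 b)
      (nb23 (nb12 b134)) q3 (nb12 q1) (nb12 q2) h13.symm (by rw [pe]; exact h23.symm) h14.symm
      (by rw [pe]; exact h24.symm)
    rw [pe] at this
    have h1 := S.codeg (Ene23 e134)
    have h2 := cnt_split (S.E x3 x4) (fun e => S.p e = S.p x3 ∨ S.p e = S.p x4)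
    have h3 := cnt_cover (P := fun e => S.E x3 x4 e ∧ ¬ (S.p e = S.p x3 ∨ S.p e = S.p x4))
      (Q := S.inX x1 x2)
      (R := fun e => ¬ (S.p e = S.p x3 ∨ S.p e = S.p x4 ∨ S.p e = S.p x1 ∨ S.p e = S.p x2))
      (fun e => by unfold inX; tauto)
    linarith
  · have hpt : ∀ e, ind (S.E x1 x3 e) + ind (S.E x1 x4 e) + ind (S.E x3 x4 e) ≤
        1 + ind (S.p e = S.p x2) + 2 * (ind (S.exc x1 x3 x4 e) + ind (S.bad3 x1 x3 e)
          + ind (S.bad3 x1 x4 e) + ind (S.bad3 x3 x4 e)) := by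
      intro e
      have l13 := ind_le (S.E x1 x3 e); have l14 := ind_le (S.E x1 x4 e)
      have l34 := ind_le (S.E x3 x4 e)
      have g0 := ind_nn (S.p e = S.p x2)
      have g1 := ind_nn (S.exc x1 x3 x4 e); have g2 := ind_nn (S.bad3 x1 x3 e)
      have g3 := ind_nn (S.bad3 x1 x4 e); have g4 := ind_nn (S.bad3 x3 x4 e)
      by_cases q1 : S.exc x1 x3 x4 e
      · have := ind_t q1; linarith
      by_cases q2 : S.bad3 x1 x3 e
      · have := ind_t q2; linarith
      by_cases q3 : S.bad3 x1 x4 e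
      · have := ind_t q3; linarith
      by_cases q4 : S.bad3 x3 x4 e
      · have := ind_t q4; linarith
      by_cases pe : S.p e = S.p x2
      · have := ind_t pe
        by_cases a : S.E x1 x3 e
        · by_cases b : S.E x1 x4 e
          · by_cases c : S.E x3 x4 e
            · exfalso
              refine r ⟨e, ?_, a, b, c, q2, q3, q4⟩
              by_contra hc
              exact q1 ⟨Kof e134 (Or.inl ⟨a, b⟩), hc⟩
            · have := ind_f c; linarith
          · have := ind_f b; linarith
        · have := ind_f a; linarith
      · have := tri e134 (notK (S_134 hK) q1 pe)
        linarith
    have hs := sum_le_sum fun e (_ : e ∈ univ) => hpt e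
    simp only [sum_add_distrib, ← mul_sum] at hs
    have h1 := S.codeg (S.Ene e134); have h2 := S.codeg (Ene13 e134); have h3 := S.codeg (Ene23 e134)
    have h4 := cexc b134; have h5 := cbad3 b13; have h6 := cbad3 b14; have h7 := cbad3 b34
    have h8 : cnt (fun e => S.p e = S.p x2) ≤ cnt (S.inX x1 x2) := cnt_mono fun e h => Or.inr h
    simp only [cnt] at h1 h2 h3 h4 h5 h6 h7 h8 ⊢
    simp only [sum_const, card_univ, Fintype.card_fin, nsmul_eq_mul] at hs
    linarith

structure Siz (S : Sys n d) (x1 x2 x3 x4 : Fin n) : Prop where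
  sx : n / 2 - 23 * S.m ≤ cnt (S.inX x1 x2)
  sy : n / 2 - 43 * S.m ≤ cnt (S.inX x3 x4)
  xu : cnt (S.inX x1 x2) ≤ n / 2 + 43 * S.m
  yu : cnt (S.inX x3 x4) ≤ n / 2 + 23 * S.m
  ye : cnt (fun e => S.inX x3 x4 e ∧ ¬ S.E x1 x2 e) ≤ 66 * S.m
  disj : ∀ e, S.inX x1 x2 e → S.inX x3 x4 e → False
  ds : ∀ a b, a ≠ b → n / 2 - 43 * S.m ≤ cnt (fun e => S.E a b e ∧ S.inX x1 x2 e) +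
    cnt (fun e => S.E a b e ∧ S.inX x3 x4 e)

lemma siz {x1 x2 x3 x4 : Fin n} (B : S.Base x1 x2 x3 x4) : S.Siz x1 x2 x3 x4 := by
  have hm := S.hm
  have sx : n / 2 - 23 * S.m ≤ cnt (S.inX x1 x2) := by
    have h := S.KE (S.SK B.lh.hK)
    by_cases e134 : S.E x1 x3 x4
    · exact SX0 B e134
    · have e234 : S.E x2 x3 x4 := by tauto
      rw [inX_comm]; exact SX0 B.swap e234
  have hL := L B.lh
  have disj : ∀ e, S.inX x1 x2 e → S.inX x3 x4 e → False := by
    intro e h1 h2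
    have := B.lh.h13; have := B.lh.h14; have := B.lh.h23; have := B.lh.h24
    unfold inX at h1 h2
    rcases h1 with h1 | h1 <;> rcases h2 with h2 | h2 <;> rw [h1] at h2 <;> contradiction
  have nn1 := cnt_nn (fun e => S.E x1 x2 e ∧ (S.p e = S.p x1 ∨ S.p e = S.p x2))
  have nn2 := cnt_nn (fun e => ¬ (S.p e = S.p x1 ∨ S.p e = S.p x2 ∨ S.p e = S.p x3 ∨ S.p e = S.p x4))
  have sp : ∀ a b, cnt (S.E a b) ≤ cnt (fun e => S.E a b e ∧ S.inX x1 x2 e) +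
      cnt (fun e => S.E a b e ∧ S.inX x3 x4 e) + cnt (fun e => ¬ (S.p e = S.p x1 ∨ S.p e = S.p x2 ∨ S.p e = S.p x3 ∨ S.p e = S.p x4)) := by
    intro a b
    refine (cnt_cover (Q := fun e => (S.E a b e ∧ S.inX x1 x2 e) ∨ (S.E a b e ∧ S.inX x3 x4 e))
      (R := fun e => ¬ (S.p e = S.p x1 ∨ S.p e = S.p x2 ∨ S.p e = S.p x3 ∨ S.p e = S.p x4)) ?_).trans ?_
    · intro e; unfold inX; tauto
    · have := cnt_or (fun e => S.E a b e ∧ S.inX x1 x2 e) (fun e => S.E a b e ∧ S.inX x3 x4 e)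
      linarith
  have ds : ∀ a b, a ≠ b → n / 2 - 43 * S.m ≤ cnt (fun e => S.E a b e ∧ S.inX x1 x2 e) +
      cnt (fun e => S.E a b e ∧ S.inX x3 x4 e) := by
    intro a b hab
    have := sp a b; have := S.codeg hab
    linarith
  have sum : cnt (S.inX x1 x2) + cnt (S.inX x3 x4) ≤ n := by
    rw [← cnt_true]
    unfold cnt; rw [← sum_add_distrib]; refine sum_le_sum fun e _ => ?_
    rw [ind_t trivial]
    by_cases h : S.inX x1 x2 e
    · rw [ind_f (disj e h)]; linarith [ind_le (S.inX x1 x2 e)]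
    · rw [ind_f h]; linarith [ind_le (S.inX x3 x4 e)]
  have e12 : n / 2 - 43 * S.m ≤ cnt (fun e => S.E x1 x2 e ∧ S.inX x3 x4 e) := by
    have := sp x1 x2; have := S.codeg (S.Ene B.lh.e123)
    have : cnt (fun e => S.E x1 x2 e ∧ S.inX x1 x2 e) =
      cnt (fun e => S.E x1 x2 e ∧ (S.p e = S.p x1 ∨ S.p e = S.p x2)) := rfl
    linarith
  have hsp := cnt_split (S.inX x3 x4) (S.E x1 x2)
  have hc : cnt (fun e => S.E x1 x2 e ∧ S.inX x3 x4 e) = cnt (fun e => S.inX x3 x4 e ∧ S.E x1 x2 e) := by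
    simp only [and_comm]
  have := cnt_nn (fun e => S.inX x3 x4 e ∧ ¬ S.E x1 x2 e)
  exact ⟨sx, by linarith, by linarith, by linarith, by linarith, disj, ds⟩

lemma F0a {x1 x2 x3 x4 : Fin n} (B : S.Base x1 x2 x3 x4) {b e : Fin n} (hb : S.inX x3 x4 b)
    (h : S.Ks x1 x2 b e) : S.inX x3 x4 e := by
  rcases hb with hb | hb
  · exact Or.inr (S.cons h B.lh.hK hb)
  · exact Or.inl (S.cons h (S.S34 B.lh.hK) hb)

lemma F1 {x1 x2 x3 x4 : Fin n} (B : S.Base x1 x2 x3 x4) {a : Fin n} (pa : S.p a = S.p x2)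
    (h1a : ¬ S.bad2 x1 a) (ha : ¬ S.bad1 a) :
    cnt (fun e => S.E x1 a e ∧ S.inX x1 x2 e) ≤ 42 * S.m ∨
    cnt (fun e => S.E x1 a e ∧ S.inX x3 x4 e) ≤ 71 * S.m := by
  have Z := siz B
  have hm := S.hm
  by_contra hcon
  push Not at hcon
  obtain ⟨c1, c2⟩ := hcon
  have key : cnt (fun e => (S.inX x3 x4 e ∧ ¬ S.E x1 x2 e) ∨ S.bad3 x1 a e ∨ S.bad3 x1 x2 e ∨ S.bad2 x1 e
      ∨ S.bad2 a e) ≤ 70 * S.m := by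
    have t1 := cnt_or (fun e => S.inX x3 x4 e ∧ ¬ S.E x1 x2 e) (fun e => S.bad3 x1 a e ∨ S.bad3 x1 x2 e ∨ S.bad2 x1 e
      ∨ S.bad2 a e)
    have t2 := cnt_or (S.bad3 x1 a) (fun e => S.bad3 x1 x2 e ∨ S.bad2 x1 e ∨ S.bad2 a e)
    have t3 := cnt_or (S.bad3 x1 x2) (fun e => S.bad2 x1 e ∨ S.bad2 a e)
    have t4 := cnt_or (S.bad2 x1) (S.bad2 a)
    have := cbad3 h1a; have := cbad3 B.lh.b12; have := cbad2 B.b1; have := cbad2 ha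
    have := Z.ye
    linarith
  obtain ⟨b, ⟨e1ab, yb⟩, hb⟩ := exists_avoid (lt_of_le_of_lt key (by linarith : 70 * S.m < cnt (fun e => S.E x1 a e ∧ S.inX x3 x4 e)))
  push Not at hb
  obtain ⟨hb1, b1ab, b12b, b1b, bab⟩ := hb
  have e12b := hb1 yb
  obtain ⟨e0, k0⟩ := ext e12b b12b
  have ye0 := F0a B yb k0
  have pe0 : ∀ e, S.Ks x1 a b e → S.p e = S.p e0 := fun e h =>
    S.cons (S.S23 h) (S.S23 k0) pa
  have n1 : S.p x1 ≠ S.p b := by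
    intro h; exact Z.disj b (Or.inl h.symm) yb
  have n2 : S.p a ≠ S.p b := by
    intro h; exact Z.disj b (Or.inr (h.symm.trans pa)) yb
  have n3 : S.p x1 ≠ S.p e0 := by
    intro h; exact Z.disj e0 (Or.inl h.symm) ye0
  have n4 : S.p a ≠ S.p e0 := by
    intro h; exact Z.disj e0 (Or.inr (h.symm.trans pa)) ye0
  by_cases r : ∃ e, S.Ks x1 a b e ∧ S.E x1 a e ∧ ¬ S.bad3 x1 a e ∧ ¬ S.bad3 x1 b e ∧ ¬ S.bad3 a b e ∧
      ¬ S.bad2 x1 e ∧ ¬ S.bad2 a e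
  · obtain ⟨e, k, u, q1, q2, q3, q4, q5⟩ := r
    have pe := pe0 e k
    have := L (x1 := x1) (x2 := a) (x3 := b) (x4 := e) ⟨k, e1ab, u, b1ab, q1, q2, q3, h1a, b1b, q4, bab, q5, n1,
      by rw [pe]; exact n3, n2, by rw [pe]; exact n4⟩
    have nn := cnt_nn (fun e' => ¬ (S.p e' = S.p x1 ∨ S.p e' = S.p a ∨ S.p e' = S.p b ∨ S.p e' = S.p e))
    have h2 : cnt (fun e => S.E x1 a e ∧ S.inX x1 x2 e) = cnt (fun e => S.E x1 a e ∧ (S.p e = S.p x1 ∨ S.p e = S.p a)) := by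
      unfold inX; rw [pa]
    linarith
  · have hpt : ∀ e, ind (S.E x1 a e) + ind (S.E x1 b e) + ind (S.E a b e) ≤
        1 + ind (S.inX x3 x4 e ∧ ¬ S.E x1 a e) + 2 * (ind (S.exc x1 a b e) + ind (S.bad3 x1 a e)
          + ind (S.bad3 x1 b e) + ind (S.bad3 a b e) + ind (S.bad2 x1 e) + ind (S.bad2 a e)) := by
      intro e
      have l13 := ind_le (S.E x1 a e); have l14 := ind_le (S.E x1 b e)
      have l34 := ind_le (S.E a b e)
      have g0 := ind_nn (S.inX x3 x4 e ∧ ¬ S.E x1 a e)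
      have g1 := ind_nn (S.exc x1 a b e); have g2 := ind_nn (S.bad3 x1 a e)
      have g3 := ind_nn (S.bad3 x1 b e); have g4 := ind_nn (S.bad3 a b e)
      have g5 := ind_nn (S.bad2 x1 e); have g6 := ind_nn (S.bad2 a e)
      by_cases q1 : S.exc x1 a b e
      · have := ind_t q1; linarith
      by_cases q2 : S.bad3 x1 a e
      · have := ind_t q2; linarith
      by_cases q3 : S.bad3 x1 b e
      · have := ind_t q3; linarith
      by_cases q4 : S.bad3 a b e
      · have := ind_t q4; linarith
      by_cases q5 : S.bad2 x1 e
      · have := ind_t q5; linarith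
      by_cases q6 : S.bad2 a e
      · have := ind_t q6; linarith
      by_cases hK : S.K x1 a b e
      · have hKs : S.Ks x1 a b e := by by_contra h; exact q1 ⟨hK, h⟩
        by_cases u : S.E x1 a e
        · exact absurd ⟨e, hKs, u, q2, q3, q4, q5, q6⟩ r
        · have ye : S.inX x3 x4 e := by
            have := pe0 e hKs
            unfold inX at ye0 ⊢; rwa [this]
          have := ind_t (show S.inX x3 x4 e ∧ ¬ S.E x1 a e from ⟨ye, u⟩)
          have := ind_f u; linarith
      · have := tri e1ab hK
        linarith
    have hs := sum_le_sum fun e (_ : e ∈ univ) => hpt e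
    simp only [sum_add_distrib, ← mul_sum] at hs
    have h1 := S.codeg (S.Ene e1ab); have h2 := S.codeg (Ene13 e1ab); have h3 := S.codeg (Ene23 e1ab)
    have h4 := cexc b1ab; have h5 := cbad3 h1a; have h6 := cbad3 b1b; have h7 := cbad3 bab
    have h8 := cbad2 B.b1; have h9 := cbad2 ha
    have h10 := cnt_split (S.inX x3 x4) (S.E x1 a)
    have hc : cnt (fun e => S.E x1 a e ∧ S.inX x3 x4 e) = cnt (fun e => S.inX x3 x4 e ∧ S.E x1 a e) := by
      simp only [and_comm]
    rw [hc] at c2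
    have h11 := Z.yu
    simp only [sum_const, card_univ, Fintype.card_fin, nsmul_eq_mul] at hs
    simp only [cnt] at h1 h2 h3 h4 h5 h6 h7 h8 h9 h10 h11 c2
    linarith

lemma cnt_eq_one (x : Fin n) : cnt (fun e => e = x) = 1 := by
  unfold cnt; rw [Finset.sum_eq_single x (fun b _ hb => ind_f hb) (by simp), ind_t rfl]

lemma sum_le_cnt (A : Fin n → Prop) (f : Fin n → ℝ) (t : ℝ) (h : ∀ a, A a → f a ≤ t) :
    ∑ a, ind (A a) * f a ≤ t * cnt A := by
  unfold cnt; rw [mul_sum]; refine sum_le_sum fun a _ => ?_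
  by_cases ha : A a
  · rw [ind_t ha]; linarith [h a ha]
  · rw [ind_f ha]; linarith

lemma sum_ge_cnt (A : Fin n → Prop) (f : Fin n → ℝ) (t : ℝ) (h : ∀ a, A a → t ≤ f a) :
    t * cnt A ≤ ∑ a, ind (A a) * f a := by
  unfold cnt; rw [mul_sum]; refine sum_le_sum fun a _ => ?_
  by_cases ha : A a
  · rw [ind_t ha]; linarith [h a ha]
  · rw [ind_f ha]; linarith

/-- sum bound with an exceptional set -/
lemma sum_le_cnt2 (A G : Fin n → Prop) (f : Fin n → ℝ) (t : ℝ) (ht : 0 ≤ t) (hn : ∀ a, f a ≤ n)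
    (h : ∀ a, A a → G a → f a ≤ t) :
    ∑ a, ind (A a) * f a ≤ t * n + n * cnt (fun a => A a ∧ ¬ G a) := by
  have : t * (n : ℝ) = ∑ a : Fin n, t := by simp [mul_comm]
  rw [this]; unfold cnt; rw [mul_sum, ← sum_add_distrib]; refine sum_le_sum fun a _ => ?_
  have hn0 : (0 : ℝ) ≤ n := Nat.cast_nonneg n
  by_cases ha : A a
  · by_cases hg : G a
    · rw [ind_t ha, ind_f (show ¬ (A a ∧ ¬ G a) by tauto)]; linarith [h a ha hg]
    · rw [ind_t ha, ind_t (show (A a ∧ ¬ G a) from ⟨ha, hg⟩)]; linarith [hn a]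
  · rw [ind_f ha]; have := ind_nn (A a ∧ ¬ G a); have := mul_nonneg hn0 this; linarith

lemma DC (A B X : Fin n → Prop) (R : Fin n → Fin n → Prop) (α β : ℝ)
    (hA : ∀ a, A a → X a) (hB : ∀ a, B a → X a)
    (h1 : ∀ a, A a → cnt (fun e => R a e ∧ X e) ≤ α)
    (h2 : ∀ b, B b → cnt (fun e => X e ∧ ¬ R e b) ≤ β) :
    cnt B * (cnt A - β) ≤ α * cnt A := by
  have s1 := sum_le_cnt A (fun a => cnt (fun b => R a b ∧ B b)) α (fun a ha =>
    (cnt_mono fun e h => ⟨h.1, hB e h.2⟩).trans (h1 a ha))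
  rw [cnt_swap] at s1
  have s2 := sum_ge_cnt B (fun b => cnt (fun a => R a b ∧ A a)) (cnt A - β) (fun b hb => by
    have := cnt_split A (fun a => R a b)
    have h3 : cnt (fun a => A a ∧ ¬ R a b) ≤ β := (cnt_mono fun e h => ⟨hA e h.1, h.2⟩).trans (h2 b hb)
    have h4 : cnt (fun a => R a b ∧ A a) = cnt (fun a => A a ∧ R a b) := by simp only [and_comm]
    show cnt A - β ≤ cnt (fun a => R a b ∧ A a)
    linarith)
  linarith

def T (S : Sys n d) (x1 x2 a : Fin n) : Prop :=
  a ≠ x1 ∧ S.p a = S.p x2 ∧ cnt (fun e => S.E x1 a e ∧ S.inX x1 x2 e) ≤ 42 * S.m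
def R (S : Sys n d) (x1 x2 x3 x4 a : Fin n) : Prop :=
  a ≠ x1 ∧ S.p a = S.p x2 ∧ cnt (fun e => S.E x1 a e ∧ S.inX x3 x4 e) ≤ 71 * S.m

lemma F2a {x1 x2 x3 x4 : Fin n} (B : S.Base x1 x2 x3 x4) :
    cnt (fun a => S.p a = S.p x2 ∧ ¬ (S.T x1 x2 a ∨ S.R x1 x2 x3 x4 a)) ≤ 3 * S.m := by
  have h0 : cnt (fun a => S.p a = S.p x2 ∧ ¬ (S.T x1 x2 a ∨ S.R x1 x2 x3 x4 a)) ≤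
    cnt (fun a => a = x1 ∨ S.bad2 x1 a ∨ S.bad1 a) := by
    refine cnt_mono fun a ⟨pa, h⟩ => ?_
    by_contra hc
    push Not at hc
    have := F1 B pa hc.2.1 hc.2.2
    unfold T R at h
    tauto
  have t1 := cnt_or (fun a => a = x1) (fun a => S.bad2 x1 a ∨ S.bad1 a)
  have t2 := cnt_or (S.bad2 x1) S.bad1
  have := cnt_eq_one x1
  have := cbad2 B.b1; have := B.hb; have := B.m1
  linarith

lemma F2b {x1 x2 x3 x4 : Fin n} (B : S.Base x1 x2 x3 x4) :
    cnt (S.T x1 x2) < 314 * S.m ∨ cnt (S.R x1 x2 x3 x4) ≤ 84 * S.m := by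
  have Z := siz B
  have hm := S.hm
  by_contra hcon; push Not at hcon
  obtain ⟨c1, c2⟩ := hcon
  have := DC (S.T x1 x2) (S.R x1 x2 x3 x4) (S.inX x1 x2) (S.E x1) (42 * S.m) (157 * S.m)
    (fun a h => Or.inr h.2.1) (fun a h => Or.inr h.2.1) (fun a h => h.2.2) (fun b h => by
      have h1 := Z.ds x1 b h.1.symm
      have h2 := h.2.2
      have h3 := cnt_split (S.inX x1 x2) (S.E x1 b)
      have hc : cnt (fun e => S.E x1 b e ∧ S.inX x1 x2 e) = cnt (fun e => S.inX x1 x2 e ∧ S.E x1 b e) := by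
        simp only [and_comm]
      have h4 : cnt (fun e => S.inX x1 x2 e ∧ ¬ S.E x1 e b) ≤ cnt (fun e => S.inX x1 x2 e ∧ ¬ S.E x1 b e) :=
        cnt_mono fun e he => ⟨he.1, fun h' => he.2 (S.E23 h')⟩
      have := Z.xu
      linarith)
  nlinarith

lemma F3 {x1 x2 x3 x4 : Fin n} (B : S.Base x1 x2 x3 x4) (hT : cnt (S.T x1 x2) < 314 * S.m) : False := by
  have Z := siz B
  have hm := S.hm
  have hN := S.hN
  have hn0 : (0 : ℝ) ≤ n := Nat.cast_nonneg n
  have hp := S.part x2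
  -- double count
  have d1 := sum_le_cnt2 (fun a => S.p a = S.p x2) (S.R x1 x2 x3 x4)
    (fun a => cnt (fun b => S.E x1 a b ∧ S.inX x3 x4 b)) (71 * S.m) (by linarith) (fun a => cnt_le _)
    (fun a _ h => h.2.2)
  rw [cnt_swap] at d1
  have d2 : cnt (fun a => S.p a = S.p x2 ∧ ¬ S.R x1 x2 x3 x4 a) ≤ 317 * S.m := by
    have := cnt_cover (P := fun a => S.p a = S.p x2 ∧ ¬ S.R x1 x2 x3 x4 a)
      (Q := S.T x1 x2) (R := fun a => S.p a = S.p x2 ∧ ¬ (S.T x1 x2 a ∨ S.R x1 x2 x3 x4 a))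
      (fun e => by tauto)
    have := F2a B
    linarith
  have d3 := markov (S.inX x3 x4) (fun b => cnt (fun a => S.E x1 a b ∧ S.p a = S.p x2))
    (fun b => cnt_nn _) ((n : ℝ) / 100) (38800 * S.m) (by nlinarith) (by linarith)
  -- pick b
  have k1 : cnt (fun e => (S.inX x3 x4 e ∧ ¬ S.E x1 x2 e) ∨ S.bad3 x1 x2 e ∨ S.bad2 x1 e ∨
      (S.inX x3 x4 e ∧ (n : ℝ) / 100 < cnt (fun a => S.E x1 a e ∧ S.p a = S.p x2))) ≤ 38868 * S.m := by
    have t1 := cnt_or (fun e => S.inX x3 x4 e ∧ ¬ S.E x1 x2 e) (fun e => S.bad3 x1 x2 e ∨ S.bad2 x1 e ∨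
      (S.inX x3 x4 e ∧ (n : ℝ) / 100 < cnt (fun a => S.E x1 a e ∧ S.p a = S.p x2)))
    have t2 := cnt_or (S.bad3 x1 x2) (fun e => S.bad2 x1 e ∨
      (S.inX x3 x4 e ∧ (n : ℝ) / 100 < cnt (fun a => S.E x1 a e ∧ S.p a = S.p x2)))
    have t3 := cnt_or (S.bad2 x1) (fun e => 
      (S.inX x3 x4 e ∧ (n : ℝ) / 100 < cnt (fun a => S.E x1 a e ∧ S.p a = S.p x2)))
    have := Z.ye; have := cbad3 B.lh.b12; have := cbad2 B.b1
    linarith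
  obtain ⟨b, yb, hb⟩ := exists_avoid (lt_of_le_of_lt k1 (by linarith [Z.sy] : 38868 * S.m < cnt (S.inX x3 x4)))
  push Not at hb
  obtain ⟨hb1, b12b, b1b, hb2⟩ := hb
  have e12b := hb1 yb
  have gb := hb2 yb
  have x1b : x1 ≠ b := Ene13 e12b
  -- many b'
  have many : 2 * 10 ^ 6 * S.m ≤ cnt (fun e => S.E x1 b e ∧ S.inX x3 x4 e) := by
    have h1 := Z.ds x1 b x1b
    have h2 := cnt_cover (P := fun e => S.E x1 b e ∧ S.inX x1 x2 e)
      (Q := fun a => S.E x1 a b ∧ S.p a = S.p x2) (R := fun e => S.inX x1 x2 e ∧ ¬ (S.p e = S.p x2))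
      (fun e h => by
        by_cases q : S.p e = S.p x2
        · exact Or.inl ⟨S.E23 h.1, q⟩
        · exact Or.inr ⟨h.2, q⟩)
    have h3 := cnt_split (S.inX x1 x2) (fun e => S.p e = S.p x2)
    have h4 : cnt (fun e => S.p e = S.p x2) ≤ cnt (fun e => S.inX x1 x2 e ∧ S.p e = S.p x2) :=
      cnt_mono fun e h => ⟨Or.inr h, h⟩
    have := Z.xu
    linarith
  have k2 : cnt (fun e => (S.inX x3 x4 e ∧ ¬ S.E x1 x2 e) ∨ S.exc x1 x2 b e ∨ S.bad3 x1 b e ∨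
      (S.inX x3 x4 e ∧ (n : ℝ) / 100 < cnt (fun a => S.E x1 a e ∧ S.p a = S.p x2))) ≤ 38868 * S.m := by
    have t1 := cnt_or (fun e => S.inX x3 x4 e ∧ ¬ S.E x1 x2 e) (fun e => S.exc x1 x2 b e ∨ S.bad3 x1 b e ∨
      (S.inX x3 x4 e ∧ (n : ℝ) / 100 < cnt (fun a => S.E x1 a e ∧ S.p a = S.p x2)))
    have t2 := cnt_or (S.exc x1 x2 b) (fun e => S.bad3 x1 b e ∨
      (S.inX x3 x4 e ∧ (n : ℝ) / 100 < cnt (fun a => S.E x1 a e ∧ S.p a = S.p x2)))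
    have t3 := cnt_or (S.bad3 x1 b) (fun e => 
      (S.inX x3 x4 e ∧ (n : ℝ) / 100 < cnt (fun a => S.E x1 a e ∧ S.p a = S.p x2)))
    have := Z.ye; have := cexc b12b; have := cbad3 b1b
    linarith
  obtain ⟨b', ⟨e1bb, yb'⟩, hb'⟩ := exists_avoid (lt_of_le_of_lt k2 (by linarith : 38868 * S.m < cnt (fun e => S.E x1 b e ∧ S.inX x3 x4 e)))
  push Not at hb'
  obtain ⟨hb1', ex, b1bb, hb2'⟩ := hb'
  have e12b' := hb1' yb'
  have gb' := hb2' yb'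
  have hKs : S.Ks x1 x2 b b' := by
    by_contra h
    exact ex ⟨S.EK e12b e12b' e1bb, h⟩
  have hpt : ∀ e, ind (S.E x1 b e) + ind (S.E x1 b' e) ≤ ind (S.E x1 e b ∧ S.p e = S.p x2) +
      ind (S.E x1 e b' ∧ S.p e = S.p x2) + ind (¬ S.p e = S.p x2) + ind (S.exc x1 b b' e) := by
    intro e
    have l1 := ind_le (S.E x1 b e); have l2 := ind_le (S.E x1 b' e)
    have g1 := ind_nn (S.exc x1 b b' e)
    have g2 := ind_nn (S.E x1 e b ∧ S.p e = S.p x2); have g3 := ind_nn (S.E x1 e b' ∧ S.p e = S.p x2)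
    by_cases q : S.p e = S.p x2
    · have := ind_mono (P := S.E x1 b e) (Q := S.E x1 e b ∧ S.p e = S.p x2) (fun h => ⟨S.E23 h, q⟩)
      have := ind_mono (P := S.E x1 b' e) (Q := S.E x1 e b' ∧ S.p e = S.p x2) (fun h => ⟨S.E23 h, q⟩)
      have := ind_nn (¬ S.p e = S.p x2)
      linarith
    · have := ind_t q
      by_cases q1 : S.exc x1 b b' e
      · have := ind_t q1; linarith
      have := tri e1bb (notK (S_134 hKs) q1 q)
      have := ind_nn (S.E b b' e)
      linarith
  have hs := sum_le_sum fun e (_ : e ∈ univ) => hpt e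
  simp only [sum_add_distrib] at hs
  have h1 := S.codeg x1b; have h2 := S.codeg (Ene13 e1bb)
  have h3 := cexc b1bb
  have h4 := cnt_split (fun _ => True) (fun e => S.p e = S.p x2)
  rw [cnt_true] at h4
  simp only [true_and] at h4
  simp only [cnt] at h1 h2 h3 h4 gb gb' hp
  linarith

lemma F4 {x1 x2 x3 x4 : Fin n} (B : S.Base x1 x2 x3 x4) (hR1 : cnt (S.R x1 x2 x3 x4) ≤ 84 * S.m)
    (hR2 : cnt (S.R x2 x1 x3 x4) ≤ 84 * S.m) : False := by
  have Z := siz B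
  have hm := S.hm
  have hN := S.hN
  have hn0 : (0 : ℝ) ≤ n := Nat.cast_nonneg n
  have hp1 := S.part x1
  have hp2 := S.part x2
  have hT1 : n / 4 - 91 * S.m ≤ cnt (S.T x1 x2) := by
    have h1 := cnt_cover (P := fun a => S.p a = S.p x2)
      (Q := fun a => S.T x1 x2 a ∨ S.R x1 x2 x3 x4 a)
      (R := fun a => S.p a = S.p x2 ∧ ¬ (S.T x1 x2 a ∨ S.R x1 x2 x3 x4 a)) (fun e => by tauto)
    have h2 := cnt_or (S.T x1 x2) (S.R x1 x2 x3 x4)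
    have := F2a B
    linarith
  -- good b with respect to x2, part of x1
  have d1 := sum_le_cnt2 (fun a => S.p a = S.p x1) (S.T x2 x1)
    (fun a => cnt (fun b => ¬ S.E x2 a b ∧ S.inX x3 x4 b)) (108 * S.m) (by linarith) (fun a => cnt_le _)
    (fun a _ h => by
      have h1 := Z.ds x2 a h.1.symm
      have h2 := h.2.2
      rw [inX_comm] at h2
      have h3 := cnt_split (S.inX x3 x4) (S.E x2 a)
      have hc : cnt (fun e => S.E x2 a e ∧ S.inX x3 x4 e) = cnt (fun e => S.inX x3 x4 e ∧ S.E x2 a e) := by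
        simp only [and_comm]
      have hc' : cnt (fun e => ¬ S.E x2 a e ∧ S.inX x3 x4 e) = cnt (fun e => S.inX x3 x4 e ∧ ¬ S.E x2 a e) := by
        simp only [and_comm]
      have := Z.yu
      show cnt (fun e => ¬ S.E x2 a e ∧ S.inX x3 x4 e) ≤ 108 * S.m
      linarith)
  rw [cnt_swap (R := fun a b => ¬ S.E x2 a b)] at d1
  have d2 : cnt (fun a => S.p a = S.p x1 ∧ ¬ S.T x2 x1 a) ≤ 87 * S.m := by
    have := cnt_cover (P := fun a => S.p a = S.p x1 ∧ ¬ S.T x2 x1 a)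
      (Q := S.R x2 x1 x3 x4) (R := fun a => S.p a = S.p x1 ∧ ¬ (S.T x2 x1 a ∨ S.R x2 x1 x3 x4 a))
      (fun e => by tauto)
    have := F2a B.swap
    linarith
  have d3 := markov (S.inX x3 x4) (fun b => cnt (fun a => ¬ S.E x2 a b ∧ S.p a = S.p x1))
    (fun b => cnt_nn _) ((n : ℝ) / 100) (19500 * S.m) (by nlinarith) (by linarith)
  -- sum over b
  have d4 := sum_le_cnt2 (S.inX x3 x4) (fun b => S.E x1 x2 b ∧ ¬ S.bad3 x1 x2 b ∧
      cnt (fun a => ¬ S.E x2 a b ∧ S.p a = S.p x1) ≤ (n : ℝ) / 100)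
    (fun b => cnt (fun a => S.E x1 a b ∧ S.p a = S.p x1)) (n / 100 + S.m) (by linarith) (fun b => cnt_le _)
    (fun b yb ⟨e12b, b12b, gb⟩ => by
      have h1 := cnt_cover (P := fun a => S.E x1 a b ∧ S.p a = S.p x1)
        (Q := fun a => ¬ S.E x2 a b ∧ S.p a = S.p x1) (R := S.exc x1 x2 b) (fun a ⟨u, pa⟩ => by
          by_cases q : S.E x2 a b
          · right
            have hK : S.K x1 x2 b a := Kof e12b (Or.inr (Or.inr ⟨S.E23 u, S.E23 q⟩))
            refine ⟨hK, fun h => ?_⟩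
            exact Z.disj a (Or.inl pa) (F0a B yb h)
          · exact Or.inl ⟨q, pa⟩)
      have := cexc b12b
      show cnt (fun a => S.E x1 a b ∧ S.p a = S.p x1) ≤ n / 100 + S.m
      linarith)
  have d5 : cnt (fun b => S.inX x3 x4 b ∧ ¬ (S.E x1 x2 b ∧ ¬ S.bad3 x1 x2 b ∧
      cnt (fun a => ¬ S.E x2 a b ∧ S.p a = S.p x1) ≤ (n : ℝ) / 100)) ≤ 19567 * S.m := by
    have h0 := cnt_cover (P := fun b => S.inX x3 x4 b ∧ ¬ (S.E x1 x2 b ∧ ¬ S.bad3 x1 x2 b ∧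
      cnt (fun a => ¬ S.E x2 a b ∧ S.p a = S.p x1) ≤ (n : ℝ) / 100))
      (Q := fun b => S.inX x3 x4 b ∧ ¬ S.E x1 x2 b)
      (R := fun b => S.bad3 x1 x2 b ∨ (S.inX x3 x4 b ∧ (n : ℝ) / 100 < cnt (fun a => ¬ S.E x2 a b ∧ S.p a = S.p x1)))
      (fun b => by rw [← not_le]; tauto)
    have h1 := cnt_or (S.bad3 x1 x2) (fun b => S.inX x3 x4 b ∧ (n : ℝ) / 100 < cnt (fun a => ¬ S.E x2 a b ∧ S.p a = S.p x1))
    have := Z.ye; have := cbad3 B.lh.b12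
    linarith
  rw [← cnt_swap (A := fun a => S.p a = S.p x1) (B := S.inX x3 x4) (R := S.E x1)] at d4
  have d6 := markov (fun a => S.p a = S.p x1) (fun a => cnt (fun b => S.E x1 a b ∧ S.inX x3 x4 b))
    (fun b => cnt_nn _) ((n : ℝ) / 5) (6 * 10 ^ 5 * S.m) (by nlinarith) (by linarith)
  have hB : 18 * 10 ^ 5 * S.m ≤ cnt (fun a => a ≠ x1 ∧ S.p a = S.p x1 ∧
      cnt (fun b => S.E x1 a b ∧ S.inX x3 x4 b) ≤ (n : ℝ) / 5) := by
    have h0 := cnt_cover (P := fun a => S.p a = S.p x1)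
      (Q := fun a => a ≠ x1 ∧ S.p a = S.p x1 ∧ cnt (fun b => S.E x1 a b ∧ S.inX x3 x4 b) ≤ (n : ℝ) / 5)
      (R := fun a => a = x1 ∨ (S.p a = S.p x1 ∧ (n : ℝ) / 5 < cnt (fun b => S.E x1 a b ∧ S.inX x3 x4 b)))
      (fun b => by rw [← not_le]; tauto)
    have h1 := cnt_or (fun a => a = x1) (fun a => S.p a = S.p x1 ∧ (n : ℝ) / 5 < cnt (fun b => S.E x1 a b ∧ S.inX x3 x4 b))
    have := cnt_eq_one x1; have := B.m1
    linarith
  have fin := DC (S.T x1 x2) (fun a => a ≠ x1 ∧ S.p a = S.p x1 ∧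
      cnt (fun b => S.E x1 a b ∧ S.inX x3 x4 b) ≤ (n : ℝ) / 5) (S.inX x1 x2) (S.E x1) (42 * S.m)
    (n / 5 + 86 * S.m)
    (fun a h => Or.inr h.2.1) (fun a h => Or.inl h.2.1) (fun a h => h.2.2) (fun b h => by
      have h1 := Z.ds x1 b h.1.symm
      have h2 := h.2.2
      have h3 := cnt_split (S.inX x1 x2) (S.E x1 b)
      have hc : cnt (fun e => S.E x1 b e ∧ S.inX x1 x2 e) = cnt (fun e => S.inX x1 x2 e ∧ S.E x1 b e) := by
        simp only [and_comm]
      have h4 : cnt (fun e => S.inX x1 x2 e ∧ ¬ S.E x1 e b) ≤ cnt (fun e => S.inX x1 x2 e ∧ ¬ S.E x1 b e) :=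
        cnt_mono fun e he => ⟨he.1, fun h' => he.2 (S.E23 h')⟩
      have := Z.xu
      linarith)
  have hTn := cnt_le (S.T x1 x2)
  generalize cnt (S.T x1 x2) = t at *
  generalize cnt (fun a => a ≠ x1 ∧ S.p a = S.p x1 ∧
      cnt (fun b => S.E x1 a b ∧ S.inX x3 x4 b) ≤ (n : ℝ) / 5) = s at *
  have h1 : 4 * 10 ^ 5 * S.m ≤ t - (n / 5 + 86 * S.m) := by linarith
  have h2 : 18 * 10 ^ 5 * S.m * (4 * 10 ^ 5 * S.m) ≤ s * (t - (n / 5 + 86 * S.m)) :=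
    mul_le_mul hB h1 (by linarith) (by linarith)
  have h3 : 42 * S.m * t ≤ 42 * S.m * (10 ^ 7 * S.m) := mul_le_mul_of_nonneg_left (by linarith) (by linarith)
  nlinarith [mul_pos hm hm]

lemma baseFalse {x1 x2 x3 x4 : Fin n} (B : S.Base x1 x2 x3 x4) : False := by
  rcases F2b B with h | h
  · exact F3 B h
  rcases F2b B.swap with h' | h'
  · exact F3 B.swap h'
  exact F4 B h h'

/-- The deterministic core. -/
lemma det {x1 x2 x3 x4 : Fin n} (hK : S.Ks x1 x2 x3 x4)
    (b123 : ¬ S.bad3 x1 x2 x3) (b124 : ¬ S.bad3 x1 x2 x4) (b134 : ¬ S.bad3 x1 x3 x4)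
    (b234 : ¬ S.bad3 x2 x3 x4) (b12 : ¬ S.bad2 x1 x2) (b13 : ¬ S.bad2 x1 x3) (b14 : ¬ S.bad2 x1 x4)
    (b23 : ¬ S.bad2 x2 x3) (b24 : ¬ S.bad2 x2 x4) (b34 : ¬ S.bad2 x3 x4)
    (b1 : ¬ S.bad1 x1) (b2 : ¬ S.bad1 x2) (b3 : ¬ S.bad1 x3) (b4 : ¬ S.bad1 x4)
    (hb : cnt S.bad1 ≤ S.m) (m1 : 1 ≤ S.m)
    (h13 : S.p x1 ≠ S.p x3) (h14 : S.p x1 ≠ S.p x4) (h23 : S.p x2 ≠ S.p x3)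
    (h24 : S.p x2 ≠ S.p x4) : False := by
  have h := S.KE (S.SK hK)
  by_cases c : S.E x1 x2 x3 ∧ S.E x1 x2 x4
  · exact baseFalse (S := S) (x1 := x1) (x2 := x2) (x3 := x3) (x4 := x4)
      ⟨⟨hK, c.1, c.2, b123, b124, b134, b234, b12, b13, b14, b23, b24, h13, h14, h23, h24⟩, b34, b1, b2, hb, m1⟩
  · have c' : S.E x1 x3 x4 ∧ S.E x2 x3 x4 := by tauto
    have hK' : S.Ks x3 x4 x1 x2 := S.S23 (S.S34 (S.S12 (S.S23 hK)))
    exact baseFalse (S := S) (x1 := x3) (x2 := x4) (x3 := x1) (x4 := x2)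
      ⟨⟨hK', Erot c'.1, Erot c'.2, nb23 (nb12 b134), nb23 (nb12 b234), nb12 (nb23 b123),
       nb12 (nb23 b124), b34, np12 b13, np12 b23, np12 b14, np12 b24,
       h13.symm, h23.symm, h14.symm, h24.symm⟩, b12, b3, b4, hb, m1⟩

end Sys
end St15
namespace St15
open Classical
section graph
variable {n : ℕ} {H : Finset (Finset (Fin n))}

def gE (H : Finset (Finset (Fin n))) (x y z : Fin n) : Prop := ({x, y, z} : Finset (Fin n)) ∈ H
def gK (H : Finset (Finset (Fin n))) (x y z w : Fin n) : Prop :=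
  SpansK4m H ({x, y, z, w} : Finset (Fin n))

lemma gE12 {x y z} (h : gE H x y z) : gE H y x z := by
  unfold gE at *; rwa [Finset.insert_comm]
lemma gE23 {x y z} (h : gE H x y z) : gE H x z y := by
  unfold gE at *; rwa [Finset.pair_comm]
lemma gEne (h3 : Is3Graph n H) {x y z} (h : gE H x y z) : x ≠ y := by
  rintro rfl
  have := h3 _ h
  simp at this
  have h2 := Finset.card_le_two (a := x) (b := z)
  omega
lemma gK12 {x y z w} (h : gK H x y z w) : gK H y x z w := by
  unfold gK at *; rwa [Finset.insert_comm]
lemma gK23 {x y z w} (h : gK H x y z w) : gK H x z y w := by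
  unfold gK at *; rwa [Finset.insert_comm z y]
lemma gK34 {x y z w} (h : gK H x y z w) : gK H x y w z := by
  unfold gK at *; rwa [Finset.pair_comm w z]
lemma gKne {x y z w} (h : gK H x y z w) : x ≠ y := by
  rintro rfl
  have := h.1
  simp at this
  have h2 := Finset.card_le_three (a := x) (b := z) (c := w)
  omega

lemma card4 {x y z w : Fin n} (h1 : x ≠ y) (h2 : x ≠ z) (h3 : x ≠ w) (h4 : y ≠ z) (h5 : y ≠ w)
    (h6 : z ≠ w) : ({x, y, z, w} : Finset (Fin n)).card = 4 := by
  rw [card_insert_of_notMem (by simp [*]), card_insert_of_notMem (by simp [*]), card_pair h6]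

lemma gEK (h3 : Is3Graph n H) {x y z w} (h1 : gE H x y z) (h2 : gE H x y w) (h4 : gE H x z w) :
    gK H x y z w := by
  have n12 := gEne h3 h1
  have n13 := gEne h3 (gE23 h1)
  have n23 := gEne h3 (gE23 (gE12 h1))
  have n14 := gEne h3 (gE23 h2)
  have n24 := gEne h3 (gE23 (gE12 h2))
  have n34 := gEne h3 (gE23 (gE12 h4))
  refine ⟨card4 n12 n13 n14 n23 n24 n34, ?_⟩
  have hsub : ({{x, y, z}, {x, y, w}, {x, z, w}} : Finset (Finset (Fin n))) ⊆
      (({x, y, z, w} : Finset (Fin n)).powersetCard 3).filter (· ∈ H) := by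
    intro T hT
    simp only [mem_insert, mem_singleton] at hT
    rw [mem_filter, mem_powersetCard]
    have hH : T ∈ H := by rcases hT with rfl | rfl | rfl <;> assumption
    refine ⟨⟨?_, h3 T hH⟩, hH⟩
    rcases hT with rfl | rfl | rfl <;> intro a <;> simp <;> tauto
  refine le_trans ?_ (card_le_card hsub)
  have a1 : ({x, y, z} : Finset (Fin n)) ≠ {x, y, w} := by
    intro h
    have : z ∈ ({x, y, w} : Finset (Fin n)) := by rw [← h]; simp
    simp [n13.symm, n23.symm, n34] at this
  have a2 : ({x, y, z} : Finset (Fin n)) ≠ {x, z, w} := by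
    intro h
    have : y ∈ ({x, z, w} : Finset (Fin n)) := by rw [← h]; simp
    simp [n12.symm, n23, n24] at this
  have a3 : ({x, y, w} : Finset (Fin n)) ≠ {x, z, w} := by
    intro h
    have : y ∈ ({x, z, w} : Finset (Fin n)) := by rw [← h]; simp
    simp [n12.symm, n23, n24] at this
  rw [card_insert_of_notMem (by simp [a1, a2]), card_pair a3]

lemma gKE {x y z w} (h : gK H x y z w) :
    (gE H x y z ∧ gE H x y w ∧ gE H x z w) ∨ (gE H x y z ∧ gE H x y w ∧ gE H y z w) ∨
    (gE H x y z ∧ gE H x z w ∧ gE H y z w) ∨ (gE H x y w ∧ gE H x z w ∧ gE H y z w) := by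
  have hsub : (({x, y, z, w} : Finset (Fin n)).powersetCard 3) ⊆
      {{x, y, z}, {x, y, w}, {x, z, w}, {y, z, w}} := by
    intro T hT
    rw [mem_powersetCard] at hT
    have hc : (({x, y, z, w} : Finset (Fin n)) \ T).card = 1 := by
      rw [card_sdiff_of_subset hT.1, h.1, hT.2]
    obtain ⟨v, hv⟩ := card_eq_one.1 hc
    have hT' : T = ({x, y, z, w} : Finset (Fin n)) \ {v} := by
      rw [← hv, Finset.sdiff_sdiff_eq_self hT.1]
    have n12 := gKne h
    have n13 := gKne (gK23 h)
    have n14 := gKne (gK23 (gK34 h))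
    have n23 := gKne (gK23 (gK12 h))
    have n24 := gKne (gK23 (gK34 (gK12 h)))
    have n34 := (gKne (gK12 (gK23 (gK34 (gK12 (gK23 h))))))
    have hvm : v ∈ ({x, y, z, w} : Finset (Fin n)) := by
      have : v ∈ ({x, y, z, w} : Finset (Fin n)) \ T := by rw [hv]; simp
      exact (mem_sdiff.1 this).1
    simp only [mem_insert, mem_singleton] at hvm ⊢
    rcases hvm with rfl | rfl | rfl | rfl
    · right; right; right; rw [hT']; ext a; simp; grind
    · right; right; left; rw [hT']; ext a; simp; grind
    · right; left; rw [hT']; ext a; simp; grind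
    · left; rw [hT']; ext a; simp; grind
  have h2 := h.2.trans (card_le_card (filter_subset_filter (· ∈ H) hsub))
  unfold gE
  simp only [filter_insert, filter_singleton] at h2
  have e2 := fun a b : Finset (Fin n) => Finset.card_le_two (a := a) (b := b)
  have e1 := fun a : Finset (Fin n) => Finset.card_singleton a
  by_cases a : ({x, y, z} : Finset (Fin n)) ∈ H <;> by_cases b : ({x, y, w} : Finset (Fin n)) ∈ H <;>
  by_cases c : ({x, z, w} : Finset (Fin n)) ∈ H <;> by_cases d : ({y, z, w} : Finset (Fin n)) ∈ H <;>
  simp only [a, b, c, d, if_true, if_false, true_and, and_true, false_and, and_false, or_true, true_or, or_false, false_or] at h2 ⊢ <;>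
  first
  | (have := h2.trans (e2 _ _); omega)
  | (rw [insert_empty_eq, e1] at h2; omega)
  | (rw [e1] at h2; omega)
  | (simp at h2)

end graph

section sums
variable {n : ℕ}

noncomputable def q4 (f : Fin n → Fin n → Fin n → Fin n → ℝ) : ℝ := ∑ x, ∑ y, ∑ z, ∑ w, f x y z w
noncomputable def q3 (f : Fin n → Fin n → Fin n → ℝ) : ℝ := ∑ x, ∑ y, ∑ z, f x y z
noncomputable def q2 (f : Fin n → Fin n → ℝ) : ℝ := ∑ x, ∑ y, f x y

lemma q4_12 (f : Fin n → Fin n → Fin n → Fin n → ℝ) : q4 (fun x y z w => f y x z w) = q4 f :=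
  Finset.sum_comm
lemma q4_23 (f : Fin n → Fin n → Fin n → Fin n → ℝ) : q4 (fun x y z w => f x z y w) = q4 f :=
  sum_congr rfl fun _ _ => Finset.sum_comm
lemma q4_34 (f : Fin n → Fin n → Fin n → Fin n → ℝ) : q4 (fun x y z w => f x y w z) = q4 f :=
  sum_congr rfl fun _ _ => sum_congr rfl fun _ _ => Finset.sum_comm
lemma q4_mono {f g : Fin n → Fin n → Fin n → Fin n → ℝ} (h : ∀ x y z w, f x y z w ≤ g x y z w) :
    q4 f ≤ q4 g :=
  sum_le_sum fun x _ => sum_le_sum fun y _ => sum_le_sum fun z _ => sum_le_sum fun w _ => h x y z w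
lemma q3_mono {f g : Fin n → Fin n → Fin n → ℝ} (h : ∀ x y z, f x y z ≤ g x y z) :
    q3 f ≤ q3 g :=
  sum_le_sum fun x _ => sum_le_sum fun y _ => sum_le_sum fun z _ => h x y z
lemma q2_mono {f g : Fin n → Fin n → ℝ} (h : ∀ x y, f x y ≤ g x y) :
    q2 f ≤ q2 g :=
  sum_le_sum fun x _ => sum_le_sum fun y _ => h x y
lemma q4_add (f g : Fin n → Fin n → Fin n → Fin n → ℝ) :
    q4 (fun x y z w => f x y z w + g x y z w) = q4 f + q4 g := by
  unfold q4; simp only [sum_add_distrib]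
lemma q4_of3 (f : Fin n → Fin n → Fin n → ℝ) : q4 (fun x y z _ => f x y z) = n * q3 f := by
  unfold q4 q3; simp [mul_sum]
lemma q3_of2 (f : Fin n → Fin n → ℝ) : q3 (fun x y _ => f x y) = n * q2 f := by
  unfold q3 q2; simp [mul_sum]
lemma q2_of1 (f : Fin n → ℝ) : q2 (fun x _ => f x) = n * ∑ x, f x := by
  unfold q2; simp [mul_sum]

lemma ind_or (P Q : Prop) : ind (P ∨ Q) ≤ ind P + ind Q := by
  by_cases h : P
  · have := ind_t h; have := ind_nn Q; have := ind_le (P ∨ Q); linarith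
  · have := ind_mono (show P ∨ Q → Q by tauto); have := ind_nn P; linarith

end sums
end St15
namespace St15
open Classical
section partI
variable {n d : ℕ}

lemma ind_ex {ι : Type*} [Fintype ι] (P : ι → Prop) : ind (∃ r, P r) ≤ ∑ r, ind (P r) := by
  by_cases h : ∃ r, P r
  · obtain ⟨r, hr⟩ := h
    rw [ind_t ⟨r, hr⟩, ← ind_t hr]
    exact Finset.single_le_sum (f := fun r => ind (P r)) (fun i _ => ind_nn _) (mem_univ r)
  · rw [ind_f h]; exact sum_nonneg fun i _ => ind_nn _

noncomputable def tau (H : Finset (Finset (Fin n))) (p : Fin n → Fin d) (x y : Fin n) (i j : Fin d) : ℝ :=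
  q2 fun z w => ind (p z = i ∧ p w = j ∧ gK H x y z w)

variable (H : Finset (Finset (Fin n))) (p : Fin n → Fin d) (r : ℝ)

def pure' (x y : Fin n) : Prop := ∀ i j j', j ≠ j' → ¬ (r ≤ tau H p x y i j ∧ r ≤ tau H p x y i j')
def CC (x y z w : Fin n) : Prop := gK H x y z w ∧ r ≤ tau H p x y (p z) (p w) ∧ pure' H p r x y
def KKs (x y z w : Fin n) : Prop := CC H p r x y z w ∧ CC H p r x z y w ∧ CC H p r x w y z ∧
  CC H p r y z x w ∧ CC H p r y w x z ∧ CC H p r z w x y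

variable {H p r}
lemma tau_xy (x y : Fin n) : tau H p x y = tau H p y x := by
  funext i j; unfold tau
  congr 1; funext z w
  exact congrArg ind (propext ⟨fun h => ⟨h.1, h.2.1, gK12 h.2.2⟩, fun h => ⟨h.1, h.2.1, gK12 h.2.2⟩⟩)
lemma tau_ij (x y : Fin n) (i j : Fin d) : tau H p x y i j = tau H p x y j i := by
  unfold tau q2; rw [sum_comm]
  refine sum_congr rfl fun z _ => sum_congr rfl fun w _ => ?_
  exact congrArg ind (propext ⟨fun h => ⟨h.2.1, h.1, gK34 h.2.2⟩, fun h => ⟨h.2.1, h.1, gK34 h.2.2⟩⟩)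
lemma CC12 {x y z w : Fin n} (h : CC H p r x y z w) : CC H p r y x z w := by
  obtain ⟨a, b, c⟩ := h
  unfold CC pure' at *
  rw [tau_xy]; exact ⟨gK12 a, b, c⟩
lemma CC34 {x y z w : Fin n} (h : CC H p r x y z w) : CC H p r x y w z := by
  obtain ⟨a, b, c⟩ := h
  unfold CC at *
  rw [tau_ij]; exact ⟨gK34 a, b, c⟩

lemma q2_prod (f : Fin n → Fin n → ℝ) : q2 f = ∑ q : Fin n × Fin n, f q.1 q.2 := by
  unfold q2; rw [Fintype.sum_prod_type]

lemma first_bound (x y : Fin n) (hr : 0 ≤ r) (hd : d ≤ 4) :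
    q2 (fun z w => ind (gK H x y z w ∧ tau H p x y (p z) (p w) < r)) ≤ 16 * r := by
  have h1 : q2 (fun z w => ind (gK H x y z w ∧ tau H p x y (p z) (p w) < r)) ≤
      ∑ s : Fin d × Fin d, r := by
    rw [q2_prod]
    calc _ ≤ ∑ q : Fin n × Fin n, ∑ s : Fin d × Fin d,
          ind (tau H p x y s.1 s.2 < r ∧ p q.1 = s.1 ∧ p q.2 = s.2 ∧ gK H x y q.1 q.2) := by
            refine sum_le_sum fun q _ => ?_
            refine le_trans (ind_mono ?_) (ind_ex _)
            rintro ⟨a, b⟩; exact ⟨(p q.1, p q.2), b, rfl, rfl, a⟩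
      _ = ∑ s : Fin d × Fin d, ∑ q : Fin n × Fin n,
          ind (tau H p x y s.1 s.2 < r ∧ p q.1 = s.1 ∧ p q.2 = s.2 ∧ gK H x y q.1 q.2) := sum_comm
      _ ≤ _ := by
        refine sum_le_sum fun s _ => ?_
        by_cases h : tau H p x y s.1 s.2 < r
        · simp only [h, true_and]
          have : tau H p x y s.1 s.2 = _ := q2_prod _
          rw [this] at h; exact h.le
        · simp only [h, false_and]; simp [ind, hr]
  refine h1.trans ?_
  simp only [sum_const, card_univ, Fintype.card_prod, Fintype.card_fin, nsmul_eq_mul]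
  have : ((d * d : ℕ) : ℝ) ≤ 16 := by
    have : d * d ≤ 16 := by nlinarith
    exact_mod_cast this
  exact mul_le_mul_of_nonneg_right this hr

lemma second_bound (hr : 0 ≤ r) (hd : d ≤ 4) (hI : ∀ i j j' : Fin d, j ≠ j' →
      q2 (fun x y => ind (r ≤ tau H p x y i j ∧ r ≤ tau H p x y i j')) ≤ r) :
    q2 (fun x y => ind (¬ pure' H p r x y)) ≤ 64 * r := by
  have h1 : q2 (fun x y => ind (¬ pure' H p r x y)) ≤ ∑ s : Fin d × Fin d × Fin d, r := by
    rw [q2_prod]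
    calc _ ≤ ∑ q : Fin n × Fin n, ∑ s : Fin d × Fin d × Fin d,
          ind (s.2.1 ≠ s.2.2 ∧ (r ≤ tau H p q.1 q.2 s.1 s.2.1 ∧ r ≤ tau H p q.1 q.2 s.1 s.2.2)) := by
            refine sum_le_sum fun q _ => ?_
            refine le_trans (ind_mono ?_) (ind_ex _)
            intro h
            unfold pure' at h; push Not at h
            obtain ⟨i, j, j', a, b⟩ := h
            exact ⟨(i, j, j'), a, b⟩
      _ = ∑ s : Fin d × Fin d × Fin d, ∑ q : Fin n × Fin n, 
          ind (s.2.1 ≠ s.2.2 ∧ (r ≤ tau H p q.1 q.2 s.1 s.2.1 ∧ r ≤ tau H p q.1 q.2 s.1 s.2.2)) := sum_comm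
      _ ≤ _ := by
        refine sum_le_sum fun s _ => ?_
        by_cases h : s.2.1 ≠ s.2.2
        · have := hI s.1 _ _ h
          rw [q2_prod] at this
          exact le_trans (sum_le_sum fun q _ => ind_mono And.right) this
        · refine le_trans (le_of_eq (sum_eq_zero fun q _ => ind_f fun hh => h hh.1)) hr
  refine h1.trans ?_
  simp only [sum_const, card_univ, Fintype.card_prod, Fintype.card_fin, nsmul_eq_mul]
  have : ((d * (d * d) : ℕ) : ℝ) ≤ 64 := by
    have h1 : d * d ≤ 16 := by nlinarith
    have : d * (d * d) ≤ 4 * 16 := Nat.mul_le_mul hd h1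
    exact_mod_cast this
  exact mul_le_mul_of_nonneg_right this hr

lemma D_bound (hr : 0 ≤ r) (hd : d ≤ 4) (hI : ∀ i j j' : Fin d, j ≠ j' →
      q2 (fun x y => ind (r ≤ tau H p x y i j ∧ r ≤ tau H p x y i j')) ≤ r) :
    q4 (fun x y z w => ind (gK H x y z w ∧ ¬ CC H p r x y z w)) ≤ 80 * r * n ^ 2 := by
  have h1 : q4 (fun x y z w => ind (gK H x y z w ∧ ¬ CC H p r x y z w)) ≤
      q4 (fun x y z w => ind (gK H x y z w ∧ tau H p x y (p z) (p w) < r)) +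
      q4 (fun x y _ _ => ind (¬ pure' H p r x y)) := by
    rw [← q4_add]
    refine q4_mono fun x y z w => ?_
    refine le_trans (ind_mono ?_) (ind_or _ _)
    unfold CC; rw [← not_le]; tauto
  have h2 : q4 (fun x y z w => ind (gK H x y z w ∧ tau H p x y (p z) (p w) < r)) ≤ 16 * r * n ^ 2 := by
    have : q4 (fun x y z w => ind (gK H x y z w ∧ tau H p x y (p z) (p w) < r)) ≤
      ∑ x : Fin n, ∑ y : Fin n, 16 * r :=
      sum_le_sum fun x _ => sum_le_sum fun y _ => first_bound x y hr hd
    refine this.trans (le_of_eq ?_)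
    simp; ring
  have h3 : q4 (fun x y _ _ => ind (¬ pure' H p r x y)) ≤ 64 * r * n ^ 2 := by
    rw [q4_of3 (fun x y _ => ind (¬ pure' H p r x y)), q3_of2]
    have := second_bound hr hd hI
    have h0 : (0:ℝ) ≤ n := Nat.cast_nonneg n
    nlinarith [mul_le_mul_of_nonneg_left this (mul_nonneg h0 h0)]
  linarith

lemma exc_bound (hr : 0 ≤ r) (hd : d ≤ 4) (hI : ∀ i j j' : Fin d, j ≠ j' →
      q2 (fun x y => ind (r ≤ tau H p x y i j ∧ r ≤ tau H p x y i j')) ≤ r) :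
    q4 (fun x y z w => ind (gK H x y z w ∧ ¬ KKs H p r x y z w)) ≤ 480 * r * n ^ 2 := by
  set D : Fin n → Fin n → Fin n → Fin n → ℝ := fun x y z w => ind (gK H x y z w ∧ ¬ CC H p r x y z w) with hD
  have hDb : q4 D ≤ 80 * r * n ^ 2 := D_bound hr hd hI
  have e1 := q4_23 D
  have e2 := q4_34 (fun x y z w => D x z y w)
  have e3 := q4_12 (fun x y z w => D x z y w)
  have e4 := q4_12 (fun x y z w => D x w y z)
  have e5 := q4_23 (fun x y z w => D y w x z)
  have h1 : q4 (fun x y z w => ind (gK H x y z w ∧ ¬ KKs H p r x y z w)) ≤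
      q4 (fun x y z w => D x y z w + (D x z y w + (D x w y z + (D y z x w + (D y w x z + D z w x y))))) := by
    refine q4_mono fun x y z w => ?_
    have s5 := ind_or (gK H y w x z ∧ ¬ CC H p r y w x z) (gK H z w x y ∧ ¬ CC H p r z w x y)
    have s4 := ind_or (gK H y z x w ∧ ¬ CC H p r y z x w) ((gK H y w x z ∧ ¬ CC H p r y w x z) ∨ (gK H z w x y ∧ ¬ CC H p r z w x y))
    have s3 := ind_or (gK H x w y z ∧ ¬ CC H p r x w y z) ((gK H y z x w ∧ ¬ CC H p r y z x w) ∨ (gK H y w x z ∧ ¬ CC H p r y w x z) ∨ (gK H z w x y ∧ ¬ CC H p r z w x y))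
    have s2 := ind_or (gK H x z y w ∧ ¬ CC H p r x z y w) ((gK H x w y z ∧ ¬ CC H p r x w y z) ∨ (gK H y z x w ∧ ¬ CC H p r y z x w) ∨ (gK H y w x z ∧ ¬ CC H p r y w x z) ∨ (gK H z w x y ∧ ¬ CC H p r z w x y))
    have s1 := ind_or (gK H x y z w ∧ ¬ CC H p r x y z w) ((gK H x z y w ∧ ¬ CC H p r x z y w) ∨ (gK H x w y z ∧ ¬ CC H p r x w y z) ∨ (gK H y z x w ∧ ¬ CC H p r y z x w) ∨ (gK H y w x z ∧ ¬ CC H p r y w x z) ∨ (gK H z w x y ∧ ¬ CC H p r z w x y))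
    have s0 : ind (gK H x y z w ∧ ¬ KKs H p r x y z w) ≤ ind ((gK H x y z w ∧ ¬ CC H p r x y z w) ∨ (gK H x z y w ∧ ¬ CC H p r x z y w) ∨ (gK H x w y z ∧ ¬ CC H p r x w y z) ∨ (gK H y z x w ∧ ¬ CC H p r y z x w) ∨ (gK H y w x z ∧ ¬ CC H p r y w x z) ∨ (gK H z w x y ∧ ¬ CC H p r z w x y)) := by
      refine ind_mono ?_
      rintro ⟨k, hk⟩
      have k1 := gK23 k
      have k2 := gK23 (gK34 k)
      have k3 := gK23 (gK12 k)
      have k4 := gK23 (gK34 (gK12 k))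
      have k5 : gK H z w x y := gK23 (gK34 (gK12 k1))
      unfold KKs at hk; tauto
    simp only [hD]
    linarith
  simp only [q4_add] at h1
  have e1' : q4 (fun x y z w => D x y z w) = q4 D := rfl
  linarith

noncomputable def mkSys (h3 : Is3Graph n H) (hn : 0 < n)
    (codeg : ∀ {x y}, x ≠ y → (n : ℝ) / 2 - n / 10 ^ 7 ≤ cnt (gE H x y))
    (part : ∀ x, (n : ℝ) / 4 - 4 * (n / 10 ^ 7) ≤ cnt (fun e => p e = p x)) : Sys n d where
  E := gE H
  K := gK H
  Ks := KKs H p r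
  p := p
  m := n / 10 ^ 7
  E12 := gE12
  E23 := gE23
  Ene := gEne h3
  K12 := gK12
  K23 := gK23
  K34 := gK34
  S12 := by
    rintro x y z w ⟨a, b, c, d, e, f⟩
    exact ⟨CC12 a, d, e, b, c, CC34 f⟩
  S23 := by
    rintro x y z w ⟨a, b, c, d, e, f⟩
    exact ⟨b, a, CC34 c, CC12 d, f, e⟩
  S34 := by
    rintro x y z w ⟨a, b, c, d, e, f⟩
    exact ⟨CC34 a, c, b, e, d, CC12 f⟩
  Kne := gKne
  EK := gEK h3
  KE := gKE
  SK := fun h => h.1.1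
  cons := by
    rintro x y z w z' w' ⟨a, -⟩ ⟨a', -⟩ hp
    by_contra hc
    refine a.2.2 (p z) (p w) (p w') hc ⟨a.2.1, ?_⟩
    rw [hp]; exact a'.2.1
  hm := by positivity
  hN := by ring
  codeg := codeg
  part := part

theorem partI (h3 : Is3Graph n H) (hn : 10 ^ 7 ≤ n) (hd : d ≤ 4)
    (codeg : ∀ {x y}, x ≠ y → (n : ℝ) / 2 - n / 10 ^ 7 ≤ cnt (gE H x y))
    (part : ∀ x, (n : ℝ) / 4 - 4 * (n / 10 ^ 7) ≤ cnt (fun e => p e = p x))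
    (ε : ℝ) (h0 : 0 < ε) (h1 : ε ≤ 1) (i1 i2 i3 i4 : Fin d)
    (h13 : i1 ≠ i3) (h14 : i1 ≠ i4) (h23 : i2 ≠ i3) (h24 : i2 ≠ i4)
    (ht : ε * n ^ 4 ≤ q4 (fun x y z w => ind (p x = i1 ∧ p y = i2 ∧ p z = i3 ∧ p w = i4 ∧ gK H x y z w))) :
    ∃ i j j' : Fin d, j ≠ j' ∧ ε / 10 ^ 40 * n ^ 2 < q2 (fun x y =>
      ind (ε / 10 ^ 40 * n ^ 2 ≤ tau H p x y i j ∧ ε / 10 ^ 40 * n ^ 2 ≤ tau H p x y i j')) := by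
  by_contra hcon
  push Not at hcon
  set r : ℝ := ε / 10 ^ 40 * n ^ 2 with hr
  have hn0 : 0 < n := by omega
  have hnR : (0 : ℝ) < n := by exact_mod_cast hn0
  have hn7 : (10 : ℝ) ^ 7 ≤ n := by exact_mod_cast hn
  have hr0 : 0 ≤ r := by positivity
  let S : Sys n d := mkSys (r := r) (p := p) h3 hn0 codeg part
  have hS : S = mkSys (r := r) (p := p) h3 hn0 codeg part := rfl
  have hm : S.m = n / 10 ^ 7 := rfl
  have hm0 := S.hm
  have hNm : (n : ℝ) = 10 ^ 7 * S.m := S.hN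
  have Q : q4 (fun x y z w => ind (S.exc x y z w)) ≤ 480 * r * n ^ 2 := exc_bound hr0 hd hcon
  have Q3 : S.m * q3 (fun x y z => ind (S.bad3 x y z)) ≤ 480 * r * n ^ 2 := by
    refine le_trans ?_ Q
    unfold q3; simp only [mul_sum]
    refine sum_le_sum fun x _ => sum_le_sum fun y _ => sum_le_sum fun z _ => ?_
    by_cases h : S.bad3 x y z
    · rw [ind_t h, mul_one]; exact h.le
    · rw [ind_f h, mul_zero]; exact cnt_nn _
  have Q2 : S.m * (S.m * q2 (fun x y => ind (S.bad2 x y))) ≤ 480 * r * n ^ 2 := by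
    refine le_trans (mul_le_mul_of_nonneg_left ?_ hm0.le) Q3
    unfold q2; simp only [mul_sum]
    refine sum_le_sum fun x _ => sum_le_sum fun y _ => ?_
    by_cases h : S.bad2 x y
    · rw [ind_t h, mul_one]; exact h.le
    · rw [ind_f h, mul_zero]; exact cnt_nn _
  have Q1 : S.m * (S.m * (S.m * cnt S.bad1)) ≤ 480 * r * n ^ 2 := by
    refine le_trans (mul_le_mul_of_nonneg_left (mul_le_mul_of_nonneg_left ?_ hm0.le) hm0.le) Q2
    unfold cnt; simp only [mul_sum]
    refine sum_le_sum fun x _ => ?_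
    by_cases h : S.bad1 x
    · rw [ind_t h, mul_one]; exact h.le
    · rw [ind_f h, mul_zero]; exact cnt_nn _
  have hrn : r * n ^ 2 = ε / 10 ^ 40 * n ^ 4 := by rw [hr]; ring
  have hn4 : (n : ℝ) ^ 4 = 10 ^ 28 * S.m ^ 4 := by rw [hNm]; ring
  have hb : cnt S.bad1 ≤ S.m := by
    have : S.m ^ 3 * cnt S.bad1 ≤ S.m ^ 3 * S.m := by
      calc S.m ^ 3 * cnt S.bad1 = S.m * (S.m * (S.m * cnt S.bad1)) := by ring
        _ ≤ _ := Q1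
        _ = 480 * (ε / 10 ^ 40 * (10 ^ 28 * S.m ^ 4)) := by rw [← hn4, ← hrn]; ring
        _ = (480 * (10:ℝ) ^ 28 / 10 ^ 40 * ε) * S.m ^ 4 := by ring
        _ ≤ 1 * S.m ^ 4 := mul_le_mul_of_nonneg_right (by norm_num; linarith) (by positivity)
        _ = _ := by ring
    exact le_of_mul_le_mul_left this (by positivity)
  have m1 : 1 ≤ S.m := by rw [hm, le_div_iff₀ (by norm_num)]; linarith
  -- the pieces
  set P3 : Fin n → Fin n → Fin n → Fin n → ℝ := fun x y z _ => ind (S.bad3 x y z)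
  have p0 : q4 P3 = n * q3 (fun x y z => ind (S.bad3 x y z)) := q4_of3 _
  have p1 := q4_34 P3
  have p2 := q4_23 (fun x y z w => P3 x y w z)
  have p3 := q4_12 (fun x y z w => P3 x z w y)
  set P2 : Fin n → Fin n → Fin n → Fin n → ℝ := fun x y _ _ => ind (S.bad2 x y)
  have o0 : q4 P2 = n * (n * q2 (fun x y => ind (S.bad2 x y))) :=
    (q4_of3 (fun x y _ => ind (S.bad2 x y))).trans (by rw [q3_of2])
  have o1 := q4_23 P2
  have o2 := q4_34 (fun x y z w => P2 x z y w)
  have o3 := q4_12 (fun x y z w => P2 x z y w)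
  have o4 := q4_12 (fun x y z w => P2 x w y z)
  have o5 := q4_23 (fun x y z w => P2 y w x z)
  set P1 : Fin n → Fin n → Fin n → Fin n → ℝ := fun x _ _ _ => ind (S.bad1 x)
  have r0 : q4 P1 = n * (n * (n * cnt S.bad1)) :=
    (q4_of3 (fun x _ _ => ind (S.bad1 x))).trans
      (by rw [q3_of2 (fun x _ => ind (S.bad1 x)), q2_of1]; rfl)
  have r1 := q4_12 P1
  have r2 := q4_23 (fun x y z w => P1 y x z w)
  have r3 := q4_34 (fun x y z w => P1 z x y w)
  have key : q4 (fun x y z w => ind (p x = i1 ∧ p y = i2 ∧ p z = i3 ∧ p w = i4 ∧ gK H x y z w)) ≤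
      q4 (fun x y z w => ind (S.exc x y z w) + (P3 x y z w + (P3 x y w z + (P3 x z w y + (P3 y z w x
        + (P2 x y z w + (P2 x z y w + (P2 x w y z + (P2 y z x w + (P2 y w x z + (P2 z w x y
        + (P1 x y z w + (P1 y x z w + (P1 z x y w + P1 w x y z)))))))))))))) := by
    refine q4_mono fun x y z w => ?_
    simp only [P3, P2, P1]
    have g0 := ind_nn (S.exc x y z w)
    have g1 := ind_nn (S.bad3 x y z); have g2 := ind_nn (S.bad3 x y w); have g3 := ind_nn (S.bad3 x z w)
    have g4 := ind_nn (S.bad3 y z w)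
    have g5 := ind_nn (S.bad2 x y); have g6 := ind_nn (S.bad2 x z); have g7 := ind_nn (S.bad2 x w)
    have g8 := ind_nn (S.bad2 y z); have g9 := ind_nn (S.bad2 y w); have g10 := ind_nn (S.bad2 z w)
    have g11 := ind_nn (S.bad1 x); have g12 := ind_nn (S.bad1 y); have g13 := ind_nn (S.bad1 z)
    have g14 := ind_nn (S.bad1 w)
    by_cases ht : p x = i1 ∧ p y = i2 ∧ p z = i3 ∧ p w = i4 ∧ gK H x y z w
    · rw [ind_t ht]
      by_contra hlt
      push Not at hlt
      have aux : ∀ P : Prop, ind P < 1 → ¬ P := fun P h hp => by rw [ind_t hp] at h; linarith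
      obtain ⟨t1, t2, t3, t4, hK⟩ := ht
      have hKs : S.Ks x y z w := by
        by_contra hc
        exact aux (S.exc x y z w) (by linarith) ⟨hK, hc⟩
      refine Sys.det (S := S) hKs (aux _ (by linarith)) (aux _ (by linarith)) (aux _ (by linarith))
        (aux _ (by linarith)) (aux _ (by linarith)) (aux _ (by linarith)) (aux _ (by linarith))
        (aux _ (by linarith)) (aux _ (by linarith)) (aux _ (by linarith)) (aux _ (by linarith))
        (aux _ (by linarith)) (aux _ (by linarith)) (aux _ (by linarith)) hb m1 ?_ ?_ ?_ ?_
      · change p x ≠ p z; rw [t1, t3]; exact h13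
      · change p x ≠ p w; rw [t1, t4]; exact h14
      · change p y ≠ p z; rw [t2, t3]; exact h23
      · change p y ≠ p w; rw [t2, t4]; exact h24
    · rw [ind_f ht]; linarith
  simp only [q4_add] at key
  have p0' : q4 (fun x y z w => P3 x y z w) = q4 P3 := rfl
  have o0' : q4 (fun x y z w => P2 x y z w) = q4 P2 := rfl
  have r0' : q4 (fun x y z w => P1 x y z w) = q4 P1 := rfl
  have B3 : q4 P3 ≤ 10 ^ 7 * (480 * r * n ^ 2) := by
    rw [p0]
    calc (n : ℝ) * q3 (fun x y z => ind (S.bad3 x y z)) = 10 ^ 7 * (S.m * q3 (fun x y z => ind (S.bad3 x y z))) := by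
          rw [hNm]; ring
      _ ≤ _ := by linarith
  have B2 : q4 P2 ≤ 10 ^ 14 * (480 * r * n ^ 2) := by
    rw [o0]
    calc (n : ℝ) * (n * q2 (fun x y => ind (S.bad2 x y))) = 10 ^ 14 * (S.m * (S.m * q2 (fun x y => ind (S.bad2 x y)))) := by
          rw [hNm]; ring
      _ ≤ _ := by linarith
  have B1 : q4 P1 ≤ 10 ^ 21 * (480 * r * n ^ 2) := by
    rw [r0]
    calc (n : ℝ) * (n * (n * cnt S.bad1)) = 10 ^ 21 * (S.m * (S.m * (S.m * cnt S.bad1))) := by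
          rw [hNm]; ring
      _ ≤ _ := by linarith
  have hrn' : 480 * r * n ^ 2 = 480 * (ε / 10 ^ 40 * n ^ 4) := by rw [← hrn]; ring
  rw [hrn'] at B1 B2 B3 Q
  have hpos : 0 < ε * (n : ℝ) ^ 4 := by positivity
  have e : ε / 10 ^ 40 * (n : ℝ) ^ 4 = (ε * (n : ℝ) ^ 4) / 10 ^ 40 := by ring
  rw [e] at B1 B2 B3 Q
  linarith

end partI
end St15
namespace St15
open Classical
section partII

noncomputable def ct {β : Type*} [Fintype β] (P : β → Prop) : ℝ := ∑ b, ind (P b)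

lemma ct_eq_card {β : Type*} [Fintype β] (P : β → Prop) [DecidablePred P] :
    ct P = ((univ.filter P).card : ℝ) := by
  unfold ct; rw [card_filter]; push_cast
  refine sum_congr rfl fun b _ => ?_
  by_cases hb : P b <;> simp [ind, hb]

lemma ct_mono {β : Type*} [Fintype β] {P Q : β → Prop} (h : ∀ b, P b → Q b) : ct P ≤ ct Q :=
  sum_le_sum fun b _ => ind_mono (h b)

lemma ct_or {β : Type*} [Fintype β] (P Q : β → Prop) : ct (fun b => P b ∨ Q b) ≤ ct P + ct Q := by
  unfold ct; rw [← sum_add_distrib]; exact sum_le_sum fun b _ => ind_or _ _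

lemma ct_nest {β γ : Type*} [Fintype β] [Fintype γ] (P : β → Prop) (Q : β → γ → Prop) (a k : ℝ)
    (hk : 0 ≤ k) (h1 : a ≤ ct P) (h2 : ∀ b, P b → k ≤ ct (Q b)) :
    a * k ≤ ct (fun q : β × γ => P q.1 ∧ Q q.1 q.2) := by
  unfold ct; rw [Fintype.sum_prod_type]
  calc a * k ≤ ct P * k := mul_le_mul_of_nonneg_right h1 hk
    _ = ∑ b, ind (P b) * k := by unfold ct; rw [sum_mul]
    _ ≤ _ := by
      refine sum_le_sum fun b _ => ?_
      by_cases hb : P b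
      · simp only [hb, true_and]; rw [ind_t trivial, one_mul]; exact h2 b hb
      · rw [ind_f hb, zero_mul]; exact sum_nonneg fun c _ => ind_nn _

variable {n : ℕ}

lemma pairL (R : Fin n → Fin n → Prop) (ρ : ℝ) (W : Finset (Fin n)) (w0 : ℕ) (hW : W.card ≤ w0)
    (hρ : 0 < ρ) (hn : 4 * w0 ≤ ρ * n) (h : ρ * n ^ 2 ≤ q2 (fun x y => ind (R x y))) :
    ρ / 2 * n ^ 2 ≤ ct (fun q : Fin n × Fin n => R q.1 q.2 ∧ q.1 ∉ W ∧ q.2 ∉ W) := by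
  rw [q2_prod] at h
  have h1 : ct (fun q : Fin n × Fin n => R q.1 q.2) ≤
      ct (fun q : Fin n × Fin n => R q.1 q.2 ∧ q.1 ∉ W ∧ q.2 ∉ W) +
      (ct (fun q : Fin n × Fin n => q.1 ∈ W) + ct (fun q : Fin n × Fin n => q.2 ∈ W)) := by
    have := ct_or (fun q : Fin n × Fin n => q.1 ∈ W) (fun q => q.2 ∈ W)
    have h2 := ct_or (fun q : Fin n × Fin n => R q.1 q.2 ∧ q.1 ∉ W ∧ q.2 ∉ W) (fun q => q.1 ∈ W ∨ q.2 ∈ W)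
    have h3 : ct (fun q : Fin n × Fin n => R q.1 q.2) ≤ ct (fun q : Fin n × Fin n => (R q.1 q.2 ∧ q.1 ∉ W ∧ q.2 ∉ W) ∨ q.1 ∈ W ∨ q.2 ∈ W) :=
      ct_mono fun q => by tauto
    linarith
  have s0 : ∑ x : Fin n, ind (x ∈ W) = W.card := by
    have := ct_eq_card (fun x : Fin n => x ∈ W)
    rw [filter_univ_mem] at this
    exact this
  have s1 : ct (fun q : Fin n × Fin n => q.1 ∈ W) = n * W.card := by
    unfold ct; rw [Fintype.sum_prod_type]; simp only [sum_const, card_univ, Fintype.card_fin, nsmul_eq_mul]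
    rw [← mul_sum, s0]
  have s2 : ct (fun q : Fin n × Fin n => q.2 ∈ W) = n * W.card := by
    unfold ct; rw [Fintype.sum_prod_type]
    simp only [s0, sum_const, card_univ, Fintype.card_fin, nsmul_eq_mul]
  have h0 : (0:ℝ) ≤ n := Nat.cast_nonneg n
  have hW' : (W.card : ℝ) ≤ w0 := by exact_mod_cast hW
  have e : ct (fun q : Fin n × Fin n => R q.1 q.2) = ∑ q : Fin n × Fin n, ind (R q.1 q.2) := rfl
  have k1 := mul_le_mul_of_nonneg_left hW' h0
  have k2 := mul_le_mul_of_nonneg_left hn h0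
  nlinarith

lemma through (k : ℕ) (a : Fin n) :
    (univ.filter (fun S : Finset (Fin n) => S.card = k + 1 ∧ a ∈ S)).card ≤ n ^ k := by
  calc _ ≤ ((univ : Finset (Fin n)).powersetCard k).card := by
        refine card_le_card_of_injOn (fun S => S.erase a) ?_ ?_
        · intro S hS
          simp only [coe_filter, mem_univ, true_and, Set.mem_ofPred_eq] at hS
          simp only [mem_coe, mem_powersetCard]
          exact ⟨subset_univ _, by rw [card_erase_of_mem hS.2, hS.1]; rfl⟩
        · intro S hS T hT h
          simp only [coe_filter, mem_univ, true_and, Set.mem_ofPred_eq] at hS hT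
          rw [← insert_erase hS.2, ← insert_erase hT.2]
          exact congrArg (insert a) h
    _ = n.choose k := by simp
    _ ≤ n ^ k := Nat.choose_le_pow n k

lemma setL (H : Finset (Finset (Fin n))) (c : ℕ) (hc : 0 < c) (η : ℝ) (W : Finset (Fin n)) (w0 : ℕ)
    (hW : W.card ≤ w0) (u v : Fin n)
    (hn : 2 * w0 ≤ η * n) (h : Close H c η u v) :
    η / 2 * n ^ (4 * c - 1) ≤ ct (fun S : Finset (Fin n) => IsConnector H c u v S ∧ Disjoint S W) := by
  unfold Close at h
  obtain ⟨k, hk⟩ : ∃ k, 4 * c - 1 = k + 1 := ⟨4 * c - 2, by omega⟩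
  have e : (({S : Finset (Fin n) | IsConnector H c u v S}.ncard : ℕ) : ℝ) = ct (fun S => IsConnector H c u v S) := by
    rw [ct_eq_card, ← Set.ncard_coe_finset]; simp
  rw [e] at h
  have h1 : ct (fun S => IsConnector H c u v S) ≤
      ct (fun S : Finset (Fin n) => IsConnector H c u v S ∧ Disjoint S W) +
      ct (fun S : Finset (Fin n) => S.card = k + 1 ∧ ∃ a ∈ W, a ∈ S) := by
    refine le_trans (ct_mono fun S hS => ?_) (ct_or _ _)
    by_cases hd : Disjoint S W
    · exact Or.inl ⟨hS, hd⟩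
    · right
      rw [not_disjoint_iff] at hd
      obtain ⟨a, h1, h2⟩ := hd
      exact ⟨by rw [hS.2.2.1, hk], a, h2, h1⟩
  have h2 : ct (fun S : Finset (Fin n) => S.card = k + 1 ∧ ∃ a ∈ W, a ∈ S) ≤ w0 * n ^ k := by
    rw [ct_eq_card]
    have : (univ.filter (fun S : Finset (Fin n) => S.card = k + 1 ∧ ∃ a ∈ W, a ∈ S)).card ≤ w0 * n ^ k := by
      calc _ ≤ (W.biUnion fun a => univ.filter (fun S : Finset (Fin n) => S.card = k + 1 ∧ a ∈ S)).card := by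
            refine card_le_card ?_
            intro S hS
            simp only [mem_filter, mem_univ, true_and, mem_biUnion] at hS ⊢
            obtain ⟨h1, a, h2, h3⟩ := hS
            exact ⟨a, h2, h1, h3⟩
        _ ≤ W.card * n ^ k := card_biUnion_le_card_mul _ _ _ fun a _ => through k a
        _ ≤ _ := Nat.mul_le_mul_right _ hW
    exact_mod_cast this
  rw [hk] at h ⊢
  have h0 : (0:ℝ) ≤ (n:ℝ) ^ k := by positivity
  have k2 := mul_le_mul_of_nonneg_right hn h0
  rw [pow_succ] at h ⊢
  nlinarith

lemma fac_union {H : Finset (Finset (Fin n))} {X Y : Finset (Fin n)} (hX : HasK4mFactorOn H X)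
    (hY : HasK4mFactorOn H Y) (hd : Disjoint X Y) : HasK4mFactorOn H (X ∪ Y) := by
  obtain ⟨P, p1, p2, p3⟩ := hX
  obtain ⟨Q, q1, q2, q3⟩ := hY
  have key : ∀ A ∈ P, ∀ B ∈ Q, Disjoint A B := by
    intro A hA B hB
    refine Finset.disjoint_of_subset_left ?_ (Finset.disjoint_of_subset_right ?_ hd)
    · rw [← p3]; exact subset_biUnion_of_mem id hA
    · rw [← q3]; exact subset_biUnion_of_mem id hB
  refine ⟨P ∪ Q, ?_, ?_, ?_⟩
  · intro A hA
    rcases mem_union.1 hA with h | h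
    · exact p1 A h
    · exact q1 A h
  · intro A hA B hB hne
    rcases mem_union.1 hA with h | h <;> rcases mem_union.1 hB with h' | h'
    · exact p2 A h B h' hne
    · exact key A h B h'
    · exact (key B h' A h).symm
    · exact q2 A h B h' hne
  · rw [← p3, ← q3]
    ext a; simp only [mem_biUnion, mem_union, id]
    constructor
    · rintro ⟨A, h | h, ha⟩
      · exact Or.inl ⟨A, h, ha⟩
      · exact Or.inr ⟨A, h, ha⟩
    · rintro (⟨A, h, ha⟩ | ⟨A, h, ha⟩)
      · exact ⟨A, Or.inl h, ha⟩
      · exact ⟨A, Or.inr h, ha⟩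

lemma fac_single {H : Finset (Finset (Fin n))} {x y z w : Fin n} (h : gK H x y z w) :
    HasK4mFactorOn H ({x, y, z, w} : Finset (Fin n)) := by
  refine ⟨{{x, y, z, w}}, ?_, ?_, ?_⟩
  · intro S hS; rw [mem_singleton] at hS; rw [hS]; exact h
  · intro S hS T hT hne
    rw [mem_singleton] at hS hT; exact absurd (hS.trans hT.symm) hne
  · simp

lemma fac4 {H : Finset (Finset (Fin n))} {A B C D X : Finset (Fin n)} (hA : HasK4mFactorOn H A)
    (hB : HasK4mFactorOn H B) (hC : HasK4mFactorOn H C) (hD : HasK4mFactorOn H D)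
    (h1 : Disjoint A B) (h2 : Disjoint A C) (h3 : Disjoint A D) (h4 : Disjoint B C) (h5 : Disjoint B D)
    (h6 : Disjoint C D) (hX : X = A ∪ B ∪ (C ∪ D)) : HasK4mFactorOn H X := by
  rw [hX]
  refine fac_union (fac_union hA hB h1) (fac_union hC hD h6) ?_
  rw [disjoint_union_left, disjoint_union_right, disjoint_union_right]
  exact ⟨⟨h2, h3⟩, h4, h5⟩

/-- the six special vertices -/
def six (x y z w z' w' : Fin n) : Finset (Fin n) := {x, y, z, w, z', w'}

abbrev Pr (n : ℕ) := Fin n × Fin n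
abbrev T6 (n : ℕ) := (Pr n × Pr n) × Pr n
abbrev T9 (n : ℕ) := ((T6 n × Finset (Fin n)) × Finset (Fin n)) × Finset (Fin n)

def sx6 (t : T6 n) : Finset (Fin n) := six t.1.1.1 t.1.1.2 t.1.2.1 t.1.2.2 t.2.1 t.2.2

structure G6 (u v : Fin n) (R0 : Fin n → Fin n → Prop) (R1 R2 : Fin n → Fin n → Fin n → Fin n → Prop)
    (t : T6 n) : Prop where
  r0 : R0 t.1.1.1 t.1.1.2
  d0 : t.1.1.1 ∉ ({u, v} : Finset (Fin n)) ∧ t.1.1.2 ∉ ({u, v} : Finset (Fin n))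
  r1 : R1 t.1.1.1 t.1.1.2 t.1.2.1 t.1.2.2
  d1 : t.1.2.1 ∉ ({u, v, t.1.1.1, t.1.1.2} : Finset (Fin n)) ∧
    t.1.2.2 ∉ ({u, v, t.1.1.1, t.1.1.2} : Finset (Fin n))
  r2 : R2 t.1.1.1 t.1.1.2 t.2.1 t.2.2
  d2 : t.2.1 ∉ ({u, v, t.1.1.1, t.1.1.2, t.1.2.1, t.1.2.2} : Finset (Fin n)) ∧
    t.2.2 ∉ ({u, v, t.1.1.1, t.1.1.2, t.1.2.1, t.1.2.2} : Finset (Fin n))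

lemma six_card (x y z w z' w' : Fin n) : (six x y z w z' w').card ≤ 6 := Finset.card_le_six

lemma core (H : Finset (Finset (Fin n))) (c : ℕ) (hc : 0 < c) (ρ η η' : ℝ) (hρ : 0 < ρ) (hη : 0 < η)
    (hη' : η' ≤ (ρ / 2) ^ 3 * (η / 2) ^ 3 / ((12 * c + 3 : ℕ) ^ 6 * (2 ^ (12 * c + 3)) ^ 3 : ℕ))
    (hn1 : 4 * (8 * c + 8 : ℕ) ≤ ρ * n) (hn2 : 2 * (8 * c + 8 : ℕ) ≤ η * n)
    (u v : Fin n) (R0 : Fin n → Fin n → Prop) (R1 R2 : Fin n → Fin n → Fin n → Fin n → Prop)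
    (h0 : ρ * n ^ 2 ≤ q2 (fun x y => ind (R0 x y)))
    (h1 : ∀ x y, R0 x y → ρ * n ^ 2 ≤ q2 (fun z w => ind (R1 x y z w)))
    (h2 : ∀ x y, R0 x y → ρ * n ^ 2 ≤ q2 (fun z w => ind (R2 x y z w)))
    (a1 b1 a2 b2 a3 b3 : T6 n → Fin n)
    (c1 : ∀ t, G6 u v R0 R1 R2 t → Close H c η (a1 t) (b1 t))
    (c2 : ∀ t, G6 u v R0 R1 R2 t → Close H c η (a2 t) (b2 t))
    (c3 : ∀ t, G6 u v R0 R1 R2 t → Close H c η (a3 t) (b3 t))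
    (fin : ∀ t, G6 u v R0 R1 R2 t → ∀ S1 S2 S3, IsConnector H c (a1 t) (b1 t) S1 →
      IsConnector H c (a2 t) (b2 t) S2 → IsConnector H c (a3 t) (b3 t) S3 →
      Disjoint S1 ({u, v} ∪ sx6 t) → Disjoint S2 ({u, v} ∪ sx6 t ∪ S1) →
      Disjoint S3 ({u, v} ∪ sx6 t ∪ S1 ∪ S2) →
      IsConnector H (3 * c + 1) u v (sx6 t ∪ S1 ∪ S2 ∪ S3)) :
    Close H (3 * c + 1) η' u v := by
  have hn0 : (0 : ℝ) ≤ n := Nat.cast_nonneg n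
  have uv2 : ({u, v} : Finset (Fin n)).card ≤ 2 := Finset.card_le_two
  -- layer 1
  have l0 := pairL R0 ρ {u, v} (8 * c + 8) (by omega) hρ hn1 h0
  have l1 := ct_nest _ (fun (q0 q : Pr n) => R1 q0.1 q0.2 q.1 q.2 ∧ q.1 ∉ ({u, v, q0.1, q0.2} : Finset (Fin n)) ∧
    q.2 ∉ ({u, v, q0.1, q0.2} : Finset (Fin n))) _ (ρ / 2 * n ^ 2) (by positivity) l0 (fun q0 hq =>
      pairL (R1 q0.1 q0.2) ρ {u, v, q0.1, q0.2} (8 * c + 8)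
        (le_trans Finset.card_le_four (by omega)) hρ hn1 (h1 _ _ hq.1))
  have l2 := ct_nest _ (fun (q0 : Pr n × Pr n) (q : Pr n) => R2 q0.1.1 q0.1.2 q.1 q.2 ∧
    q.1 ∉ ({u, v, q0.1.1, q0.1.2, q0.2.1, q0.2.2} : Finset (Fin n)) ∧
    q.2 ∉ ({u, v, q0.1.1, q0.1.2, q0.2.1, q0.2.2} : Finset (Fin n))) _ (ρ / 2 * n ^ 2) (by positivity) l1
    (fun q0 hq =>
      pairL (R2 q0.1.1 q0.1.2) ρ {u, v, q0.1.1, q0.1.2, q0.2.1, q0.2.2} (8 * c + 8)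
        (le_trans Finset.card_le_six (by omega)) hρ hn1 (h2 _ _ hq.1.1))
  have l2' : ρ / 2 * n ^ 2 * (ρ / 2 * n ^ 2) * (ρ / 2 * n ^ 2) ≤ ct (G6 u v R0 R1 R2) := by
    refine l2.trans (ct_mono ?_)
    rintro t ⟨⟨⟨s1, s2⟩, s3, s4⟩, s5, s6⟩
    exact ⟨s1, s2, s3, s4, s5, s6⟩
  have cs : ∀ t : T6 n, ({u, v} ∪ sx6 t).card ≤ 8 := fun t => by
    have := card_union_le ({u, v} : Finset (Fin n)) (sx6 t)
    have h6 : (sx6 t).card ≤ 6 := six_card _ _ _ _ _ _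
    omega
  have l3 := ct_nest _ (fun (t : T6 n) (S1 : Finset (Fin n)) => IsConnector H c (a1 t) (b1 t) S1 ∧
    Disjoint S1 ({u, v} ∪ sx6 t)) _ (η / 2 * n ^ (4 * c - 1)) (by positivity) l2' (fun t ht =>
      setL H c hc η _ (8 * c + 8) (by have := cs t; omega) _ _ hn2 (c1 t ht))
  have l4 := ct_nest _ (fun (t : T6 n × Finset (Fin n)) (S2 : Finset (Fin n)) =>
    IsConnector H c (a2 t.1) (b2 t.1) S2 ∧
    Disjoint S2 ({u, v} ∪ sx6 t.1 ∪ t.2)) _ (η / 2 * n ^ (4 * c - 1)) (by positivity) l3 (fun t ht =>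
      setL H c hc η _ (8 * c + 8) (by
        have := cs t.1; have h1 := ht.2.1.2.2.1
        have := card_union_le ({u, v} ∪ sx6 t.1) t.2
        omega) _ _ hn2 (c2 t.1 ht.1))
  have l5 := ct_nest _ (fun (t : (T6 n × Finset (Fin n)) × Finset (Fin n)) (S3 : Finset (Fin n)) =>
    IsConnector H c (a3 t.1.1) (b3 t.1.1) S3 ∧
    Disjoint S3 ({u, v} ∪ sx6 t.1.1 ∪ t.1.2 ∪ t.2)) _ (η / 2 * n ^ (4 * c - 1)) (by positivity) l4 (fun t ht =>
      setL H c hc η _ (8 * c + 8) (by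
        have := cs t.1.1; have h1 := ht.1.2.1.2.2.1; have h2 := ht.2.1.2.2.1
        have := card_union_le ({u, v} ∪ sx6 t.1.1) t.1.2
        have := card_union_le ({u, v} ∪ sx6 t.1.1 ∪ t.1.2) t.2
        omega) _ _ hn2 (c3 t.1.1 ht.1.1))
  rw [ct_eq_card] at l5
  set TT := univ.filter (fun q : T9 n => ((G6 u v R0 R1 R2 q.1.1.1 ∧
    IsConnector H c (a1 q.1.1.1) (b1 q.1.1.1) q.1.1.2 ∧ Disjoint q.1.1.2 ({u, v} ∪ sx6 q.1.1.1)) ∧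
    IsConnector H c (a2 q.1.1.1) (b2 q.1.1.1) q.1.2 ∧ Disjoint q.1.2 ({u, v} ∪ sx6 q.1.1.1 ∪ q.1.1.2)) ∧
    IsConnector H c (a3 q.1.1.1) (b3 q.1.1.1) q.2 ∧ Disjoint q.2 ({u, v} ∪ sx6 q.1.1.1 ∪ q.1.1.2 ∪ q.1.2)) with hTT
  let U : T9 n → Finset (Fin n) := fun q => sx6 q.1.1.1 ∪ q.1.1.2 ∪ q.1.2 ∪ q.2
  have hU : ∀ q ∈ TT, IsConnector H (3 * c + 1) u v (U q) := by
    intro q hq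
    obtain ⟨-, ⟨⟨g, s1, d1⟩, s2, d2⟩, s3, d3⟩ := mem_filter.1 hq
    exact fin _ g _ _ _ s1 s2 s3 d1 d2 d3
  have hfib := Finset.card_le_mul_card_image (f := U) TT ((12 * c + 3) ^ 6 * (2 ^ (12 * c + 3)) ^ 3) (by
    intro S hS
    obtain ⟨q0, hq0, rfl⟩ := mem_image.1 hS
    have hcard : (U q0).card = 12 * c + 3 := by rw [(hU q0 hq0).2.2.1]; omega
    set S := U q0
    calc _ ≤ ((((((S ×ˢ S) ×ˢ (S ×ˢ S)) ×ˢ (S ×ˢ S)) ×ˢ S.powerset) ×ˢ S.powerset) ×ˢ S.powerset).card := by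
          refine card_le_card ?_
          intro q hq
          have hq' : U q = S := (mem_filter.1 hq).2
          simp only [mem_product, mem_powerset]
          rw [← hq']
          simp only [U, sx6, six]
          refine ⟨⟨⟨⟨⟨⟨?_, ?_⟩, ?_, ?_⟩, ?_, ?_⟩, ?_⟩, ?_⟩, ?_⟩
          · simp
          · simp
          · simp
          · simp
          · simp
          · simp
          · intro a ha; simp [ha]
          · intro a ha; simp [ha]
          · intro a ha; simp [ha]
      _ = _ := by
        simp only [card_product, card_powerset, hcard]; ring)
  have himg : (TT.image U).card ≤ {S : Finset (Fin n) | IsConnector H (3 * c + 1) u v S}.ncard := by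
    rw [← Set.ncard_coe_finset]
    refine Set.ncard_le_ncard ?_ (Set.toFinite _)
    intro S hS
    obtain ⟨q, hq, rfl⟩ := mem_image.1 (mem_coe.1 hS)
    exact hU q hq
  unfold Close
  set M : ℕ := (12 * c + 3) ^ 6 * (2 ^ (12 * c + 3)) ^ 3 with hM
  have hMpos : 0 < (M : ℝ) := by
    have : 0 < M := by positivity
    exact_mod_cast this
  have hle : ((TT.card : ℕ) : ℝ) ≤ M * ({S : Finset (Fin n) | IsConnector H (3 * c + 1) u v S}.ncard : ℝ) := by
    have := hfib.trans (Nat.mul_le_mul_left M himg)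
    exact_mod_cast this
  have hexp : (n : ℝ) ^ (4 * (3 * c + 1) - 1) = n ^ 2 * n ^ 2 * n ^ 2 * n ^ (4 * c - 1) * n ^ (4 * c - 1) * n ^ (4 * c - 1) := by
    rw [← pow_add, ← pow_add, ← pow_add, ← pow_add, ← pow_add]; congr 1; omega
  have hA : η' * M ≤ (ρ / 2) ^ 3 * (η / 2) ^ 3 := by
    rwa [le_div_iff₀ hMpos] at hη'
  have hnK : 0 ≤ (n : ℝ) ^ (4 * (3 * c + 1) - 1) := by positivity
  have h5 := mul_le_mul_of_nonneg_right hA hnK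
  have h6 : (ρ / 2) ^ 3 * (η / 2) ^ 3 * (n : ℝ) ^ (4 * (3 * c + 1) - 1) =
    ρ / 2 * n ^ 2 * (ρ / 2 * n ^ 2) * (ρ / 2 * n ^ 2) * (η / 2 * n ^ (4 * c - 1)) * (η / 2 * n ^ (4 * c - 1)) *
      (η / 2 * n ^ (4 * c - 1)) := by rw [hexp]; ring
  rw [h6] at h5
  have h7 := h5.trans (l5.trans hle)
  have h8 : (M : ℝ) * (η' * n ^ (4 * (3 * c + 1) - 1)) ≤
      M * ({S : Finset (Fin n) | IsConnector H (3 * c + 1) u v S}.ncard : ℝ) := by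
    refine le_trans (le_of_eq ?_) h7; ring
  exact le_of_mul_le_mul_left h8 hMpos

end partII
end St15
namespace St15
open Classical
section partIII
variable {n : ℕ} {H : Finset (Finset (Fin n))}

lemma dj {A B : Finset (Fin n)} (h : ∀ a, a ∈ A → a ∈ B → False) : Disjoint A B :=
  Finset.disjoint_left.2 fun a ha hb => h a ha hb

lemma six_card' {x y z w z' w' : Fin n} (h : [x, y, z, w, z', w'].Nodup) :
    (six x y z w z' w').card = 6 := by
  have : six x y z w z' w' = [x, y, z, w, z', w'].toFinset := by ext a; simp [six]
  rw [this, List.toFinset_card_of_nodup h]; rfl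

lemma finCard {c : ℕ} (hc : 0 < c) {x y z w z' w' : Fin n} {S1 S2 S3 : Finset (Fin n)}
    (h : [x, y, z, w, z', w'].Nodup) (k1 : S1.card = 4 * c - 1) (k2 : S2.card = 4 * c - 1)
    (k3 : S3.card = 4 * c - 1) (d1 : Disjoint (six x y z w z' w') S1)
    (d2 : Disjoint (six x y z w z' w' ∪ S1) S2) (d3 : Disjoint (six x y z w z' w' ∪ S1 ∪ S2) S3) :
    (six x y z w z' w' ∪ S1 ∪ S2 ∪ S3).card = 4 * (3 * c + 1) - 1 := by
  rw [card_union_of_disjoint d3, card_union_of_disjoint d2, card_union_of_disjoint d1, six_card' h]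
  omega

set_option maxHeartbeats 2000000 in
lemma finA {c : ℕ} (hc : 0 < c) {u v x y z w z' w' : Fin n} {S1 S2 S3 : Finset (Fin n)}
    (hN : [u, v, x, y, z, w, z', w'].Nodup) (K1 : gK H x y z w) (K2 : gK H x y z' w')
    (s1 : IsConnector H c u w S1) (s2 : IsConnector H c z z' S2) (s3 : IsConnector H c w' v S3)
    (d1 : Disjoint S1 ({u, v} ∪ six x y z w z' w')) (d2 : Disjoint S2 ({u, v} ∪ six x y z w z' w' ∪ S1))
    (d3 : Disjoint S3 ({u, v} ∪ six x y z w z' w' ∪ S1 ∪ S2)) :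
    IsConnector H (3 * c + 1) u v (six x y z w z' w' ∪ S1 ∪ S2 ∪ S3) := by
  obtain ⟨-, -, k1, f1, f1'⟩ := s1
  obtain ⟨-, -, k2, f2, f2'⟩ := s2
  obtain ⟨-, -, k3, f3, f3'⟩ := s3
  have hN' : [x, y, z, w, z', w'].Nodup := (List.nodup_cons.1 (List.nodup_cons.1 hN).2).2
  rw [Finset.disjoint_left] at d1 d2 d3
  simp only [mem_union, six, mem_insert, mem_singleton] at d1 d2 d3
  simp only [List.nodup_cons, List.mem_cons, List.not_mem_nil, or_false, not_or] at hN
  refine ⟨?_, ?_, finCard hc hN' k1 k2 k3 ?_ ?_ ?_, ?_, ?_⟩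
  · simp only [mem_union, six, mem_insert, mem_singleton]; grind
  · simp only [mem_union, six, mem_insert, mem_singleton]; grind
  · refine dj fun a h1 h2 => ?_
    simp only [mem_union, six, mem_insert, mem_singleton] at h1 h2; grind
  · refine dj fun a h1 h2 => ?_
    simp only [mem_union, six, mem_insert, mem_singleton] at h1 h2; grind
  · refine dj fun a h1 h2 => ?_
    simp only [mem_union, six, mem_insert, mem_singleton] at h1 h2; grind
  · refine fac4 f1 (fac_single K1) f2' f3 ?_ ?_ ?_ ?_ ?_ ?_ ?_
    iterate 6
      refine dj fun a h1 h2 => ?_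
      simp only [mem_insert, mem_singleton] at h1 h2; grind
    ext a; simp only [mem_union, six, mem_insert, mem_singleton]; apply iff_of_eq; ac_rfl
  · refine fac4 f1' (fac_single K2) f2 f3' ?_ ?_ ?_ ?_ ?_ ?_ ?_
    iterate 6
      refine dj fun a h1 h2 => ?_
      simp only [mem_insert, mem_singleton] at h1 h2; grind
    ext a; simp only [mem_union, six, mem_insert, mem_singleton]; apply iff_of_eq; ac_rfl

set_option maxHeartbeats 2000000 in
lemma finB {c : ℕ} (hc : 0 < c) {u v x y z w z' w' : Fin n} {S1 S2 S3 : Finset (Fin n)}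
    (hN : [u, v, x, y, z, w, z', w'].Nodup) (K2 : gK H x y z' w')
    (s1 : IsConnector H c u v S1) (s2 : IsConnector H c z z' S2) (s3 : IsConnector H c u w S3)
    (d1 : Disjoint S1 ({u, v} ∪ six x y z w z' w')) (d2 : Disjoint S2 ({u, v} ∪ six x y z w z' w' ∪ S1))
    (d3 : Disjoint S3 ({u, v} ∪ six x y z w z' w' ∪ S1 ∪ S2)) :
    IsConnector H (3 * c + 1) u v (six x y z w z' w' ∪ S1 ∪ S2 ∪ S3) := by
  obtain ⟨-, -, k1, f1, f1'⟩ := s1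
  obtain ⟨-, -, k2, f2, f2'⟩ := s2
  obtain ⟨-, -, k3, f3, f3'⟩ := s3
  have hN' : [x, y, z, w, z', w'].Nodup := (List.nodup_cons.1 (List.nodup_cons.1 hN).2).2
  rw [Finset.disjoint_left] at d1 d2 d3
  simp only [mem_union, six, mem_insert, mem_singleton] at d1 d2 d3
  simp only [List.nodup_cons, List.mem_cons, List.not_mem_nil, or_false, not_or] at hN
  refine ⟨?_, ?_, finCard hc hN' k1 k2 k3 ?_ ?_ ?_, ?_, ?_⟩
  · simp only [mem_union, six, mem_insert, mem_singleton]; grind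
  · simp only [mem_union, six, mem_insert, mem_singleton]; grind
  · refine dj fun a h1 h2 => ?_
    simp only [mem_union, six, mem_insert, mem_singleton] at h1 h2; grind
  · refine dj fun a h1 h2 => ?_
    simp only [mem_union, six, mem_insert, mem_singleton] at h1 h2; grind
  · refine dj fun a h1 h2 => ?_
    simp only [mem_union, six, mem_insert, mem_singleton] at h1 h2; grind
  · refine fac4 f1 (fac_single K2) f2 f3' ?_ ?_ ?_ ?_ ?_ ?_ ?_
    iterate 6
      refine dj fun a h1 h2 => ?_
      simp only [mem_insert, mem_singleton] at h1 h2; grind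
    ext a; simp only [mem_union, six, mem_insert, mem_singleton]; apply iff_of_eq; ac_rfl
  · refine fac4 f1' (fac_single K2) f2 f3' ?_ ?_ ?_ ?_ ?_ ?_ ?_
    iterate 6
      refine dj fun a h1 h2 => ?_
      simp only [mem_insert, mem_singleton] at h1 h2; grind
    ext a; simp only [mem_union, six, mem_insert, mem_singleton]; apply iff_of_eq; ac_rfl

lemma g6N {d : ℕ} {p : Fin n → Fin d} {i j j' : Fin d} {u v : Fin n} (huv : u ≠ v)
    {R0 : Fin n → Fin n → Prop} {t : T6 n}
    (g : G6 u v R0 (fun x y z w => p z = i ∧ p w = j ∧ gK H x y z w)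
      (fun x y z w => p z = i ∧ p w = j' ∧ gK H x y z w) t) :
    [u, v, t.1.1.1, t.1.1.2, t.1.2.1, t.1.2.2, t.2.1, t.2.2].Nodup := by
  obtain ⟨-, d0, ⟨-, -, r1⟩, d1, ⟨-, -, r2⟩, d2⟩ := g
  have e1 := gKne r1
  have e2 := gKne (gK12 (gK23 (gK34 (gK12 (gK23 r1)))))
  have e3 := gKne (gK12 (gK23 (gK34 (gK12 (gK23 r2)))))
  simp only [mem_insert, mem_singleton, not_or] at d0 d1 d2
  simp only [List.nodup_cons, List.mem_cons, List.not_mem_nil, or_false, not_or]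
  grind

lemma closeCase {d : ℕ} {p : Fin n → Fin d} (c : ℕ) (hc : 0 < c) (ρ η η' : ℝ) (hρ : 0 < ρ) (hη : 0 < η)
    (hη' : η' ≤ (ρ / 2) ^ 3 * (η / 2) ^ 3 / ((12 * c + 3 : ℕ) ^ 6 * (2 ^ (12 * c + 3)) ^ 3 : ℕ))
    (hn1 : 4 * (8 * c + 8 : ℕ) ≤ ρ * n) (hn2 : 2 * (8 * c + 8 : ℕ) ≤ η * n)
    (hcl : ∀ a b, p a = p b → a ≠ b → Close H c η a b) (i j j' : Fin d)
    (hq : ρ * n ^ 2 ≤ q2 (fun x y => ind (ρ * n ^ 2 ≤ tau H p x y i j ∧ ρ * n ^ 2 ≤ tau H p x y i j')))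
    (u v : Fin n) (huv : u ≠ v) (hu : p u = j) (hv : p v = j ∨ p v = j') :
    Close H (3 * c + 1) η' u v := by
  rcases hv with hv | hv
  · refine core H c hc ρ η η' hρ hη hη' hn1 hn2 u v
      (fun x y => ρ * n ^ 2 ≤ tau H p x y i j ∧ ρ * n ^ 2 ≤ tau H p x y i j')
      (fun x y z w => p z = i ∧ p w = j ∧ gK H x y z w)
      (fun x y z w => p z = i ∧ p w = j' ∧ gK H x y z w) hq (fun x y h => h.1) (fun x y h => h.2)
      (fun _ => u) (fun _ => v) (fun t => t.1.2.1) (fun t => t.2.1) (fun _ => u) (fun t => t.1.2.2)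
      ?_ ?_ ?_ ?_
    · intro t g; exact hcl _ _ (hu.trans hv.symm) huv
    · intro t g
      have hN := g6N huv g
      simp only [List.nodup_cons, List.mem_cons, List.not_mem_nil, or_false, not_or] at hN
      exact hcl _ _ (g.r1.1.trans g.r2.1.symm) (by tauto)
    · intro t g
      have hN := g6N huv g
      simp only [List.nodup_cons, List.mem_cons, List.not_mem_nil, or_false, not_or] at hN
      exact hcl _ _ (hu.trans g.r1.2.1.symm) (by tauto)
    · intro t g S1 S2 S3 s1 s2 s3 d1 d2 d3
      exact finB hc (g6N huv g) g.r2.2.2 s1 s2 s3 d1 d2 d3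
  · refine core H c hc ρ η η' hρ hη hη' hn1 hn2 u v
      (fun x y => ρ * n ^ 2 ≤ tau H p x y i j ∧ ρ * n ^ 2 ≤ tau H p x y i j')
      (fun x y z w => p z = i ∧ p w = j ∧ gK H x y z w)
      (fun x y z w => p z = i ∧ p w = j' ∧ gK H x y z w) hq (fun x y h => h.1) (fun x y h => h.2)
      (fun _ => u) (fun t => t.1.2.2) (fun t => t.1.2.1) (fun t => t.2.1) (fun t => t.2.2) (fun _ => v)
      ?_ ?_ ?_ ?_
    · intro t g
      have hN := g6N huv g
      simp only [List.nodup_cons, List.mem_cons, List.not_mem_nil, or_false, not_or] at hN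
      exact hcl _ _ (hu.trans g.r1.2.1.symm) (by tauto)
    · intro t g
      have hN := g6N huv g
      simp only [List.nodup_cons, List.mem_cons, List.not_mem_nil, or_false, not_or] at hN
      exact hcl _ _ (g.r1.1.trans g.r2.1.symm) (by tauto)
    · intro t g
      have hN := g6N huv g
      simp only [List.nodup_cons, List.mem_cons, List.not_mem_nil, or_false, not_or] at hN
      exact hcl _ _ (g.r2.2.1.trans hv.symm) (by tauto)
    · intro t g S1 S2 S3 s1 s2 s3 d1 d2 d3
      exact finA hc (g6N huv g) g.r1.2.2 g.r2.2.2 s1 s2 s3 d1 d2 d3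

end partIII
end St15
namespace St15
open Classical
section partIV
variable {n : ℕ} {H : Finset (Finset (Fin n))}

lemma typed {d : ℕ} {p : Fin n → Fin d} (V : Fin d → Finset (Fin n)) (hp : ∀ x i, x ∈ V i ↔ p x = i)
    (i1 i2 i3 i4 : Fin d) :
    ({S : Finset (Fin n) | SpansK4m H S ∧
      ∃ v₁ ∈ V i1, ∃ v₂ ∈ V i2, ∃ v₃ ∈ V i3, ∃ v₄ ∈ V i4, S = {v₁, v₂, v₃, v₄}}.ncard : ℝ) ≤
    q4 (fun x y z w => ind (p x = i1 ∧ p y = i2 ∧ p z = i3 ∧ p w = i4 ∧ gK H x y z w)) := by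
  let P : Fin n × Fin n × Fin n × Fin n → Prop := fun q =>
    p q.1 = i1 ∧ p q.2.1 = i2 ∧ p q.2.2.1 = i3 ∧ p q.2.2.2 = i4 ∧ gK H q.1 q.2.1 q.2.2.1 q.2.2.2
  have e : q4 (fun x y z w => ind (p x = i1 ∧ p y = i2 ∧ p z = i3 ∧ p w = i4 ∧ gK H x y z w)) = ct P := by
    unfold q4 ct; simp only [Fintype.sum_prod_type, P]
  rw [e, ct_eq_card]
  let F : Fin n × Fin n × Fin n × Fin n → Finset (Fin n) := fun q => {q.1, q.2.1, q.2.2.1, q.2.2.2}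
  have h1 := card_image_le (s := univ.filter P) (f := F)
  refine le_trans ?_ (Nat.cast_le.2 h1)
  rw [← Set.ncard_coe_finset]
  refine Nat.cast_le.2 (Set.ncard_le_ncard ?_ (Set.toFinite _))
  rintro S ⟨hS, v1, h1, v2, h2, v3, h3, v4, h4, rfl⟩
  refine mem_coe.2 (mem_image.2 ⟨(v1, v2, v3, v4), ?_, rfl⟩)
  rw [mem_filter]
  exact ⟨mem_univ _, (hp _ _).1 h1, (hp _ _).1 h2, (hp _ _).1 h3, (hp _ _).1 h4, hS⟩

end partIV
end St15
/-- merging two parts of the partition into a closed set, given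
many `K₄⁻`-copies of a suitable type. -/
theorem stmt_15 (c : ℕ) (hc : 0 < c) :
    ∃ γ₀ : ℝ, 0 < γ₀ ∧ ∀ γ : ℝ, 0 < γ → γ ≤ γ₀ →
      ∃ δ₀ : ℝ, 0 < δ₀ ∧ ∀ ε η : ℝ, 0 < ε → ε ≤ δ₀ → 0 < η → η ≤ δ₀ →
        ∃ η'₀ : ℝ, 0 < η'₀ ∧ ∀ η' : ℝ, 0 < η' → η' ≤ η'₀ →
          ∃ n₀ : ℕ, ∀ n : ℕ, n₀ ≤ n →
            ∀ H : Finset (Finset (Fin n)), Is3Graph n H →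
              CodegLB H ((1 / 2 - γ) * n) →
              ∀ d : ℕ, 2 ≤ d → d ≤ 4 →
                ∀ V : Fin d → Finset (Fin n),
                  (∀ i j, i ≠ j → Disjoint (V i) (V j)) →
                  (Finset.univ.biUnion V = (Finset.univ : Finset (Fin n))) →
                  (∀ i, ClosedOn H c η (V i) ∧ (1 / 4 - 4 * γ) * n ≤ ((V i).card : ℝ)) →
                  ∀ i₁ i₂ i₃ i₄ : Fin d,
                    i₁ ≠ i₃ → i₁ ≠ i₄ → i₂ ≠ i₃ → i₂ ≠ i₄ →
                    ε * (n : ℝ) ^ 4 ≤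
                      ({S : Finset (Fin n) | SpansK4m H S ∧
                        ∃ v₁ ∈ V i₁, ∃ v₂ ∈ V i₂, ∃ v₃ ∈ V i₃, ∃ v₄ ∈ V i₄,
                          S = {v₁, v₂, v₃, v₄}}.ncard : ℝ) →
                    ∃ i j : Fin d, i ≠ j ∧ ClosedOn H (3 * c + 1) η' (V i ∪ V j) := by
  classical
  refine ⟨(10 ^ 7)⁻¹, by positivity, fun γ hγ hγ0 => ⟨1, one_pos, fun ε η hε hε1 hη hη1 => ?_⟩⟩
  set ρ : ℝ := ε / 10 ^ 40 with hρd
  have hρ : 0 < ρ := by positivity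
  refine ⟨(ρ / 2) ^ 3 * (η / 2) ^ 3 / ((12 * c + 3 : ℕ) ^ 6 * (2 ^ (12 * c + 3)) ^ 3 : ℕ), by
    have : 0 < ((12 * c + 3 : ℕ) ^ 6 * (2 ^ (12 * c + 3)) ^ 3 : ℕ) := by positivity
    have : (0 : ℝ) < ((12 * c + 3 : ℕ) ^ 6 * (2 ^ (12 * c + 3)) ^ 3 : ℕ) := by exact_mod_cast this
    positivity, fun η' hη'0 hη' => ?_⟩
  refine ⟨10 ^ 7 + ⌈4 * ((8 * c + 8 : ℕ) : ℝ) / ρ⌉₊ + ⌈2 * ((8 * c + 8 : ℕ) : ℝ) / η⌉₊, ?_⟩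
  intro n hn H h3 hcod d hd2 hd V hdis hcov hV i₁ i₂ i₃ i₄ h13 h14 h23 h24 ht
  have hn1 : 4 * ((8 * c + 8 : ℕ) : ℝ) ≤ ρ * n := by
    have h1 := Nat.le_ceil (4 * ((8 * c + 8 : ℕ) : ℝ) / ρ)
    have h2 : (⌈4 * ((8 * c + 8 : ℕ) : ℝ) / ρ⌉₊ : ℝ) ≤ n := Nat.cast_le.2 (by omega)
    rw [mul_comm ρ, ← div_le_iff₀ hρ]; exact h1.trans h2
  have hn2 : 2 * ((8 * c + 8 : ℕ) : ℝ) ≤ η * n := by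
    have h1 := Nat.le_ceil (2 * ((8 * c + 8 : ℕ) : ℝ) / η)
    have h2 : (⌈2 * ((8 * c + 8 : ℕ) : ℝ) / η⌉₊ : ℝ) ≤ n := Nat.cast_le.2 (by omega)
    rw [mul_comm η, ← div_le_iff₀ hη]; exact h1.trans h2
  have hn0 : (0 : ℝ) ≤ n := Nat.cast_nonneg n
  have hex : ∀ x, ∃ i, x ∈ V i := by
    intro x
    have : x ∈ Finset.univ.biUnion V := by rw [hcov]; exact mem_univ x
    obtain ⟨i, -, hi⟩ := mem_biUnion.1 this
    exact ⟨i, hi⟩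
  choose p hp0 using hex
  have hp : ∀ x i, x ∈ V i ↔ p x = i := by
    intro x i
    constructor
    · intro hx
      by_contra hne
      exact Finset.disjoint_left.1 (hdis _ _ hne) (hp0 x) hx
    · rintro rfl; exact hp0 x
  have hγn : γ * n ≤ n / 10 ^ 7 := by
    have := mul_le_mul_of_nonneg_right hγ0 hn0
    rw [div_eq_inv_mul]; exact this
  have codeg : ∀ {x y : Fin n}, x ≠ y → (n:ℝ)/2 - n/10^7 ≤ St15.cnt (St15.gE H x y) := by
    intro x y hxy
    have h := hcod x y hxy
    have e : St15.cnt (St15.gE H x y) = (degOn H x y Finset.univ : ℝ) :=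
      St15.ct_eq_card (fun z => ({x, y, z} : Finset (Fin n)) ∈ H)
    rw [e]; linarith
  have part : ∀ x, (n:ℝ)/4 - 4*(n/10^7) ≤ St15.cnt (fun e => p e = p x) := by
    intro x
    have h := (hV (p x)).2
    have e : St15.cnt (fun e => p e = p x) = ((V (p x)).card : ℝ) := by
      have e1 : St15.cnt (fun e => p e = p x) = ((univ.filter fun e => p e = p x).card : ℝ) :=
        St15.ct_eq_card (fun e => p e = p x)
      have e2 : (univ.filter fun e => p e = p x) = V (p x) := by
        ext a; rw [mem_filter, hp]; simp
      rw [e1, e2]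
    rw [e]; linarith
  obtain ⟨i, j, j', hj, hq⟩ := St15.partI h3 (by omega) hd codeg part ε hε hε1 i₁ i₂ i₃ i₄ h13 h14 h23 h24
    (ht.trans (St15.typed V hp i₁ i₂ i₃ i₄))
  have hcl : ∀ a b, p a = p b → a ≠ b → Close H c η a b := by
    intro a b hab hne
    exact (hV (p a)).1 a (hp0 a) b ((hp b (p a)).2 hab.symm) hne
  refine ⟨j, j', hj, ?_⟩
  intro u hu v hv huv
  rw [mem_union, hp, hp] at hu hv
  rcases hu with hu | hu
  · exact St15.closeCase c hc ρ η η' hρ hη hη' hn1 hn2 hcl i j j' hq.le u v huv hu hv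
  · refine St15.closeCase c hc ρ η η' hρ hη hη' hn1 hn2 hcl i j' j ?_ u v huv hu hv.symm
    exact hq.le.trans (St15.q2_mono fun x y => St15.ind_mono fun h => ⟨h.2, h.1⟩)
end
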